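/- arXiv:2107.02240 — 3 statements merged into one kernel-verified Lean document; each statement's English description precedes it below -/
import Mathlib

section
/- Fix n ≥ 2. Every irreducible finite-dimensional complex representation ρ of GL_n(F_q) of tensor rank n satisfies the exact identity χ_ρ(T) / dim(ρ) = −1 / (q^{n−1} − 1), where T = I + E_{12} is the transvection. -/
open Matrix CategoryTheory
open scoped BigOperators

/-- The number of matrices `m ∈ M_{n,ℓ}(F_q)` fixed by `g ∈ GL_n(F_q)`, i.e. the character
of the permutation representation `ω_{n,ℓ}` at `g`. -/
noncomputable def fixedCount (n : ℕ) (F : Type) [Field F] [Fintype F]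
    (g : GL (Fin n) F) (ℓ : ℕ) : ℕ :=
  Nat.card {m : Matrix (Fin n) (Fin ℓ) F // (g : Matrix (Fin n) (Fin n) F) * m = m}

/-- `ρ` appears in the permutation representation `ω_{n,ℓ}`, i.e. the character inner
product `(1/#GL_n(F_q)) Σ_g χ_ρ(g⁻¹)·#{m : g m = m}` is nonzero. -/
noncomputable def AppearsInOmega (n : ℕ) (F : Type) [Field F] [Fintype F]
    (ρ : FDRep ℂ (GL (Fin n) F)) (ℓ : ℕ) : Prop :=
  letI : Fintype (GL (Fin n) F) := Fintype.ofFinite _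
  ((Nat.card (GL (Fin n) F) : ℂ))⁻¹ *
    ∑ g : GL (Fin n) F, ρ.character g⁻¹ * (fixedCount n F g ℓ : ℂ) ≠ 0

/-- Some twist `χ ⊗ ρ` of `ρ` by a one-dimensional representation `χ` appears in
`ω_{n,ℓ}`. -/
noncomputable def TwistAppearsInOmega (n : ℕ) (F : Type) [Field F] [Fintype F]
    (ρ : FDRep ℂ (GL (Fin n) F)) (ℓ : ℕ) : Prop :=
  ∃ χ : (GL (Fin n) F) →* ℂˣ,
    letI : Fintype (GL (Fin n) F) := Fintype.ofFinite _
    ((Nat.card (GL (Fin n) F) : ℂ))⁻¹ *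
      ∑ g : GL (Fin n) F,
        ((χ g⁻¹ : ℂˣ) : ℂ) * ρ.character g⁻¹ * (fixedCount n F g ℓ : ℂ) ≠ 0

/-- `ρ` has tensor rank `k`: `k` is the minimal `ℓ` such that some twist of `ρ` by a
one-dimensional representation appears in `ω_{n,ℓ}`. -/
noncomputable def HasTensorRank (n : ℕ) (F : Type) [Field F] [Fintype F]
    (ρ : FDRep ℂ (GL (Fin n) F)) (k : ℕ) : Prop :=
  TwistAppearsInOmega n F ρ k ∧ ∀ ℓ < k, ¬ TwistAppearsInOmega n F ρ ℓ

/-- The transvection `T = I + E₁₂` as an element of `GL_n(F_q)` (for `n ≥ 2`). -/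
noncomputable def transvectionGL (F : Type) [Field F] [Fintype F] (n : ℕ) (hn : 2 ≤ n) :
    GL (Fin n) F :=
  Matrix.GeneralLinearGroup.mkOfDetNeZero
    (Matrix.transvection ⟨0, by omega⟩ ⟨1, by omega⟩ 1)
    (by rw [Matrix.det_transvection_of_ne _ _ (by simp) 1]; exact one_ne_zero)

/-- Orthogonality of characters of a finite commutative group, summed over the characters. -/
theorem sum_monoidHom_apply_eq_zero {A : Type*} [CommGroup A] [Finite A] [Fintype (A →* ℂˣ)]
    {a : A} (ha : a ≠ 1) : ∑ ψ : A →* ℂˣ, (ψ a : ℂ) = 0 := by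
  have : NeZero (Monoid.exponent A) := ⟨Monoid.exponent_ne_zero_of_finite⟩
  obtain ⟨φ, hφ⟩ := CommGroup.exists_apply_ne_one_of_hasEnoughRootsOfUnity A ℂ ha
  have h : (φ a : ℂ) * ∑ ψ : A →* ℂˣ, (ψ a : ℂ) = ∑ ψ : A →* ℂˣ, (ψ a : ℂ) := by
    rw [Finset.mul_sum, ← Fintype.sum_equiv (Equiv.mulLeft φ)
      (fun ψ : A →* ℂˣ => ((φ * ψ) a : ℂ)) (fun ψ : A →* ℂˣ => (ψ a : ℂ)) fun _ => rfl]
    simp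
  exact (mul_left_eq_self₀.1 h).resolve_left fun h => hφ (Units.ext h)

/-- If all twists of a function by characters composed with `d` have sum zero, then so does
its restriction to the kernel of `d`. -/
theorem sum_ite_eq_zero_of_forall_sum_twist_eq_zero {G A : Type*} [Group G] [Fintype G]
    [CommGroup A] [Finite A] [DecidableEq A] (d : G →* A) (f : G → ℂ)
    (hf : ∀ ψ : A →* ℂˣ, ∑ g, (ψ (d g⁻¹) : ℂ) * f g = 0) :
    ∑ g, (if d g = 1 then f g else 0) = 0 := by
  have : NeZero (Monoid.exponent A) := ⟨Monoid.exponent_ne_zero_of_finite⟩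
  have : Finite (A →* ℂˣ) := .of_equiv A
    (CommGroup.monoidHom_mulEquiv_of_hasEnoughRootsOfUnity A ℂ).some.symm.toEquiv
  have : Fintype (A →* ℂˣ) := Fintype.ofFinite _
  have hc : (Fintype.card (A →* ℂˣ) : ℂ) ≠ 0 := by simp
  refine (mul_eq_zero.1 ?_).resolve_left hc
  have h : ∑ ψ : A →* ℂˣ, ∑ g, (ψ (d g⁻¹) : ℂ) * f g = 0 := Finset.sum_eq_zero fun ψ _ => hf ψ
  rw [Finset.sum_comm] at h
  rw [Finset.mul_sum]
  refine Eq.trans ?_ h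
  refine Finset.sum_congr rfl fun g _ => ?_
  rw [← Finset.sum_mul]
  split_ifs with hg
  · simp [hg]
  · rw [sum_monoidHom_apply_eq_zero (by simpa using hg)]
    simp

theorem FDRep.exists_nat_sum_character_subgroup {G : Type*} [Group G] (ρ : FDRep ℂ G)
    (H : Subgroup G) [Fintype H] : ∃ N : ℕ, ∑ h : H, ρ.character (h : G)⁻¹ = N := by
  have : Invertible (Nat.card H : ℂ) := invertibleOfNonzero (by simp)
  have h := Representation.card_inv_mul_sum_char_eq_finrank
    (ρ.ρ.comp H.subtype : Representation ℂ H ρ)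
  refine ⟨Nat.card H * Module.finrank ℂ
    (Representation.invariants (ρ.ρ.comp H.subtype : Representation ℂ H ρ)), ?_⟩
  rw [Nat.cast_mul, ← h, mul_inv_cancel_left₀ (by simp),
    ← Equiv.sum_comp (Equiv.inv H) fun g => ρ.character (g : G)⁻¹]
  refine Finset.sum_congr rfl fun g _ => ?_
  simp [FDRep.character, Representation.character]

/-- Vanishing of a sum of subgroup averages of a character forces each of them to vanish. -/
theorem FDRep.sum_character_subgroup_eq_zero {G M : Type*} [Group G] [Fintype G] [Fintype M]
    (ρ : FDRep ℂ G) (H : M → Subgroup G) [∀ m g, Decidable (g ∈ H m)]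
    (h : ∑ g, ρ.character g⁻¹ * ∑ m, (if g ∈ H m then 1 else 0) = 0) (m : M) :
    ∑ g : H m, ρ.character (g : G)⁻¹ = 0 := by
  choose N hN using fun m => ρ.exists_nat_sum_character_subgroup (H m)
  have key : ∑ m, (N m : ℂ) = 0 := by
    rw [← h]
    simp_rw [Finset.mul_sum]
    rw [Finset.sum_comm]
    refine Finset.sum_congr rfl fun m _ => ?_
    rw [← hN]
    simp_rw [mul_ite, mul_one, mul_zero]
    rw [← Finset.sum_filter, Finset.sum_subtype _ (p := fun g => g ∈ H m) (by simp)]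
  rw [hN]
  have key' : ∑ m, N m = 0 := by exact_mod_cast key
  exact_mod_cast Finset.sum_eq_zero_iff.1 key' m (Finset.mem_univ m)

/-- The subgroup of elements of determinant one fixing a given matrix. -/
def specialStabilizer {n ℓ : ℕ} {F : Type} [Field F] (m : Matrix (Fin n) (Fin ℓ) F) :
    Subgroup (GL (Fin n) F) where
  carrier := {g | Matrix.GeneralLinearGroup.det g = 1 ∧
    (g : Matrix (Fin n) (Fin n) F) * m = m}
  one_mem' := by simp
  mul_mem' := by
    rintro a b ⟨ha, ha'⟩ ⟨hb, hb'⟩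
    exact ⟨by simp [ha, hb], by rw [Units.val_mul, Matrix.mul_assoc, hb', ha']⟩
  inv_mem' := by
    rintro a ⟨ha, ha'⟩
    refine ⟨by simp [ha], ?_⟩
    conv_lhs => rw [← ha', ← Matrix.mul_assoc, ← Units.val_mul, inv_mul_cancel, Units.val_one,
      Matrix.one_mul]

theorem sum_character_specialStabilizer_eq_zero {n ℓ : ℕ} {F : Type} [Field F] [Fintype F]
    {ρ : FDRep ℂ (GL (Fin n) F)} (h : ¬ TwistAppearsInOmega n F ρ ℓ)
    (m : Matrix (Fin n) (Fin ℓ) F) [Fintype (specialStabilizer m)] :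
    ∑ g : specialStabilizer m, ρ.character (g : GL (Fin n) F)⁻¹ = 0 := by
  classical
  let _ : Fintype (GL (Fin n) F) := Fintype.ofFinite _
  simp only [TwistAppearsInOmega, not_exists, not_not] at h
  have h₁ := sum_ite_eq_zero_of_forall_sum_twist_eq_zero
    (Matrix.GeneralLinearGroup.det : GL (Fin n) F →* Fˣ)
    (fun g => ρ.character g⁻¹ * (fixedCount n F g ℓ : ℂ)) fun ψ => by
      have := (mul_eq_zero.1 (h (ψ.comp Matrix.GeneralLinearGroup.det))).resolve_left (by simp)
      simpa [mul_assoc] using this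
  convert FDRep.sum_character_subgroup_eq_zero ρ
    (fun m : Matrix (Fin n) (Fin ℓ) F => specialStabilizer m) ?_ m
  refine Eq.trans ?_ h₁
  refine Finset.sum_congr rfl fun g _ => ?_
  split_ifs with hg
  · simp [fixedCount, specialStabilizer, hg, Fintype.card_subtype, Nat.card_eq_fintype_card]
  · simp [specialStabilizer, hg]

/-- The coordinate inclusion of `F^(k+1)` into `F^(k+2)` omitting the coordinate `1`. -/
def omitOne (k : ℕ) (F : Type) [Field F] : Matrix (Fin (k + 2)) (Fin (k + 1)) F :=
  (1 : Matrix (Fin (k + 2)) (Fin (k + 2)) F).submatrix (fun i => i) (Fin.succAbove 1)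

theorem mul_omitOne_eq_iff {k : ℕ} {F : Type} [Field F]
    (A : Matrix (Fin (k + 2)) (Fin (k + 2)) F) :
    A * omitOne k F = omitOne k F ↔ A = (1 : Matrix _ _ F).updateCol 1 (fun i => A i 1) := by
  have h : A * omitOne k F = A.submatrix (fun i => i) (Fin.succAbove 1) := by
    ext i j
    simp [omitOne, Matrix.mul_apply, Matrix.one_apply]
  rw [h, omitOne]
  constructor
  · intro h
    ext i j
    rcases Fin.eq_self_or_eq_succAbove 1 j with rfl | ⟨j, rfl⟩
    · simp
    · have := congrFun (congrFun h i) j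
      simpa [Fin.succAbove_ne] using this
  · intro h
    ext i j
    rw [h]
    simp [Fin.succAbove_ne]

theorem det_one_updateCol {ι R : Type*} [Fintype ι] [DecidableEq ι] [CommRing R] (i : ι)
    (v : ι → R) : ((1 : Matrix ι ι R).updateCol i v).det = v i := by
  rw [← Matrix.cramer_apply, Matrix.cramer_one, Module.End.one_apply]

/-- The special stabilizer of the coordinate inclusion is the group of translations by vectors
with vanishing coordinate `1`. -/
noncomputable def specialStabilizerOmitOneEquiv (k : ℕ) (F : Type) [Field F] :
    specialStabilizer (omitOne k F) ≃ (Fin (k + 1) → F) where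
  toFun g i := (g : GL (Fin (k + 2)) F).1 (Fin.succAbove 1 i) 1
  invFun w := ⟨Matrix.GeneralLinearGroup.mkOfDetNeZero
      ((1 : Matrix _ _ F).updateCol 1 (Fin.insertNth 1 (1 : F) w))
      (by rw [det_one_updateCol]; simp), by
    constructor
    · ext
      simp [Matrix.GeneralLinearGroup.mkOfDetNeZero, det_one_updateCol]
    · rw [mul_omitOne_eq_iff]
      simp [Matrix.GeneralLinearGroup.mkOfDetNeZero]⟩
  left_inv g := by
    obtain ⟨g, hg, hg'⟩ := g
    rw [mul_omitOne_eq_iff] at hg'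
    have h1 : g.1 1 1 = 1 := by
      have := congrArg Units.val hg
      rwa [Matrix.GeneralLinearGroup.val_det_apply, hg', det_one_updateCol] at this
    ext i j
    conv_rhs => rw [hg']
    have h : Fin.insertNth 1 (1 : F) (fun i => g.1 (Fin.succAbove 1 i) 1) = fun i => g.1 i 1 := by
      rw [Fin.insertNth_eq_iff]
      exact ⟨h1.symm, rfl⟩
    simp [Matrix.GeneralLinearGroup.mkOfDetNeZero, h]
  right_inv w := by
    ext i
    simp [Matrix.GeneralLinearGroup.mkOfDetNeZero]

/-- A nonzero vector with vanishing coordinate `1` is the column `0` of an invertible matrix whose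
row `1` is the standard one. -/
theorem exists_GL_col_zero_row_one {k : ℕ} {F : Type} [Field F] {w : Fin (k + 2) → F}
    (hw1 : w 1 = 0) (hw0 : w ≠ 0) :
    ∃ P : GL (Fin (k + 2)) F, P.1.col 0 = w ∧ P.1.row 1 = Pi.single 1 1 := by
  obtain ⟨i, hi⟩ := Function.ne_iff.1 hw0
  have hi1 : i ≠ 1 := by
    rintro rfl
    exact hi hw1
  have hswap : Equiv.swap 0 i 1 = 1 := Equiv.swap_apply_of_ne_of_ne (by simp) hi1.symm
  refine ⟨Matrix.GeneralLinearGroup.mkOfDetNeZero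
    (((1 : Matrix _ _ F).updateCol 0 (w ∘ Equiv.swap 0 i)).submatrix (Equiv.swap 0 i) id) ?_,
    ?_, ?_⟩
  · rw [Matrix.det_permute, det_one_updateCol]
    rcases Int.units_eq_one_or (Equiv.Perm.sign (Equiv.swap 0 i)) with h | h <;>
      simpa [h] using hi
  · ext j
    simp [Matrix.GeneralLinearGroup.mkOfDetNeZero]
  · ext j
    rcases eq_or_ne j 0 with rfl | hj
    · simp [Matrix.GeneralLinearGroup.mkOfDetNeZero, hswap, hw1]
    · simp [Matrix.GeneralLinearGroup.mkOfDetNeZero, hswap, hj, Matrix.one_apply, Pi.single_apply,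
        eq_comm]

/-- Nontrivial translations are conjugate to the standard transvection. -/
theorem isConj_transvectionGL {k : ℕ} {F : Type} [Field F] [Fintype F] (hn : 2 ≤ k + 2)
    (u : GL (Fin (k + 2)) F) (hu : u ∈ specialStabilizer (omitOne k F)) (hu1 : u ≠ 1) :
    IsConj (transvectionGL F (k + 2) hn) u := by
  obtain ⟨w, hw1, hw0, huw⟩ : ∃ w : Fin (k + 2) → F, w 1 = 0 ∧ w ≠ 0 ∧
      u.1 = 1 + Matrix.vecMulVec w (Pi.single 1 1) := by
    obtain ⟨hdet, hu⟩ := hu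
    rw [mul_omitOne_eq_iff] at hu
    have h11 : u.1 1 1 = 1 := by
      have := congrArg Units.val hdet
      rwa [Matrix.GeneralLinearGroup.val_det_apply, hu, det_one_updateCol] at this
    have huw : u.1 = 1 + Matrix.vecMulVec
        (fun i => u.1 i 1 - (1 : Matrix (Fin (k + 2)) (Fin (k + 2)) F) i 1) (Pi.single 1 1) := by
      ext i j
      conv_lhs => rw [hu]
      by_cases hj : j = 1
      · subst hj
        simp [Matrix.vecMulVec_apply]
      · simp [Matrix.vecMulVec_apply, hj]
    refine ⟨_, ?_, fun h => hu1 (Units.ext ?_), huw⟩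
    · simp [h11]
    · rw [huw, h]
      simp
  obtain ⟨P, hP0, hP1⟩ := exists_GL_col_zero_row_one hw1 hw0
  refine isConj_iff.2 ⟨P, mul_inv_eq_iff_eq_mul.2 (Units.ext ?_)⟩
  have hT : (transvectionGL F (k + 2) hn).1 =
      1 + Matrix.vecMulVec (Pi.single 0 1) (Pi.single 1 1) := by
    ext i j
    simp [transvectionGL, Matrix.GeneralLinearGroup.mkOfDetNeZero, Matrix.transvection,
      Matrix.single_eq_single_vecMulVec_single]
  rw [Units.val_mul, Units.val_mul, hT, huw, Matrix.mul_add, Matrix.add_mul, Matrix.mul_one,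
    Matrix.one_mul, Matrix.mul_vecMulVec, Matrix.vecMulVec_mul, Matrix.mulVec_single_one,
    Matrix.single_one_vecMul]
  rw [hP0, hP1]

/-- fix `n ≥ 2`.  Every irreducible representation `ρ` of `GL_n(F_q)` of
tensor rank `n` satisfies the exact identity `χ_ρ(T)/dim(ρ) = −1/(q^{n−1} − 1)`. -/
theorem char_ratio_of_tensorRank_top (n : ℕ) (hn : 2 ≤ n)
    (F : Type) [Field F] [Fintype F]
    (ρ : FDRep ℂ (GL (Fin n) F)) (hρ : Simple ρ) (hrank : HasTensorRank n F ρ n) :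
    ρ.character (transvectionGL F n hn) / (Module.finrank ℂ ρ : ℂ) =
      -1 / ((Fintype.card F : ℂ) ^ (n - 1) - 1) := by
  obtain ⟨k, rfl⟩ : ∃ k, n = k + 2 := ⟨n - 2, by omega⟩
  have hd : (Module.finrank ℂ ρ : ℂ) ≠ 0 := by
    intro h0
    have := Module.finrank_zero_iff.1 (Nat.cast_eq_zero.1 h0)
    obtain ⟨χ, hχ⟩ := hrank.1
    refine hχ ?_
    have (g : GL (Fin (k + 2)) F) : ρ.character g = 0 := by
      rw [FDRep.character, Subsingleton.elim (ρ.ρ g) 0, map_zero]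
    simp [this]
  classical
  let _ : Fintype (GL (Fin (k + 2)) F) := Fintype.ofFinite _
  let _ : Fintype (specialStabilizer (omitOne k F)) := Fintype.ofFinite _
  have hsum := sum_character_specialStabilizer_eq_zero (hrank.2 (k + 1) (by omega)) (omitOne k F)
  have hcard : Fintype.card (specialStabilizer (omitOne k F)) = Fintype.card F ^ (k + 1) := by
    rw [Fintype.card_congr (specialStabilizerOmitOneEquiv k F)]
    simp
  have hconj (g : specialStabilizer (omitOne k F)) (hg : g ∈ Finset.univ.erase 1) :
      ρ.character (g : GL (Fin (k + 2)) F)⁻¹ = ρ.character (transvectionGL F (k + 2) hn) := by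
    have hg1 : (g : GL (Fin (k + 2)) F)⁻¹ ≠ 1 := by simpa using hg
    obtain ⟨c, hc⟩ := isConj_iff.1 (isConj_transvectionGL hn _ (inv_mem g.2) hg1)
    rw [← hc, FDRep.char_conj]
  rw [← Finset.add_sum_erase _ _ (Finset.mem_univ 1), Finset.sum_congr rfl hconj,
    Finset.sum_const, Finset.card_erase_of_mem (Finset.mem_univ 1), Finset.card_univ, hcard,
    nsmul_eq_mul, Nat.cast_sub (Nat.one_le_pow _ _ Fintype.card_pos)] at hsum
  simp only [OneMemClass.coe_one, inv_one, FDRep.char_one, Nat.cast_pow, Nat.cast_one] at hsum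
  have hq : (Fintype.card F : ℂ) ^ (k + 1) - 1 ≠ 0 := by
    rw [sub_ne_zero]
    exact_mod_cast (Nat.one_lt_pow (by omega) Fintype.one_lt_card).ne'
  rw [show k + 2 - 1 = k + 1 by omega, div_eq_div_iff hd hq]
  linear_combination hsum
end

section
/- Fix n ≥ 2 and 0 ≤ k ≤ n − 2, and let N_{⊗,k}(q) denote the number of isomorphism classes of irreducible finite-dimensional complex representations of GL_n(F_q) of tensor rank k. Then N_{⊗,k}(q) / q^{k+1} → 1 as q → ∞ over prime powers. -/
open Matrix CategoryTheory
open scoped BigOperators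

/-- `N_{⊗,k}(q)`: the number of isomorphism classes of irreducible representations of
`GL_n(F_q)` of tensor rank `k`. -/
noncomputable def tensorRankIsoClasses (n : ℕ) (F : Type) [Field F] [Fintype F]
    (k : ℕ) : ℕ :=
  Nat.card (Quotient (Setoid.mk
    (fun ρ σ : {ρ : FDRep ℂ (GL (Fin n) F) // Simple ρ ∧ HasTensorRank n F ρ k} =>
      Nonempty (ρ.1 ≅ σ.1))
    ⟨fun _ => ⟨Iso.refl _⟩,
     fun h => h.elim fun i => ⟨i.symm⟩,
     fun h h' => h.elim fun i => h'.elim fun j => ⟨i.trans j⟩⟩))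

section RepTheory

variable {G : Type} [Group G] [Fintype G]

theorem FDRep.exists_smul_one_of_commute (V : FDRep ℂ G) [Simple V] (T : V →ₗ[ℂ] V)
    (hT : ∀ g, T ∘ₗ V.ρ g = V.ρ g ∘ₗ T) : ∃ c : ℂ, T = c • (1 : V →ₗ[ℂ] V) := by
  have h1 : Module.finrank ℂ (V ⟶ V) = 1 := finrank_endomorphism_simple_eq_one ℂ V
  let f : V ⟶ V := ⟨FGModuleCat.ofHom T, fun g => by
    ext x
    exact LinearMap.congr_fun (hT g) x⟩
  obtain ⟨c, hc⟩ := (finrank_eq_one_iff_of_nonzero' (𝟙 V) (id_nonzero V)).mp h1 f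
  refine ⟨c, ?_⟩
  have := congrArg (fun φ : V ⟶ V => φ.hom.hom.hom) hc
  exact this.symm

theorem FDRep.sum_classFun_smul (V : FDRep ℂ G) [Simple V] (f : G → ℂ)
    (hf : ∀ g h, f (h * g * h⁻¹) = f g) :
    ∃ c : ℂ, ∑ g, f g • V.ρ g = c • (1 : V →ₗ[ℂ] V) ∧
      c * Module.finrank ℂ V = ∑ g, f g * V.character g := by
  obtain ⟨c, hc⟩ := V.exists_smul_one_of_commute (∑ g, f g • V.ρ g) (fun h => by
    change (∑ g, f g • V.ρ g) * V.ρ h = V.ρ h * (∑ g, f g • V.ρ g)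
    rw [Finset.sum_mul, Finset.mul_sum, ← (MulAut.conj h).toEquiv.sum_comp]
    refine Finset.sum_congr rfl fun g _ => ?_
    simp only [MulEquiv.toEquiv_eq_coe, MulEquiv.coe_toEquiv, MulAut.conj_apply, hf,
      smul_mul_assoc, mul_smul_comm, ← map_mul]
    simp)
  refine ⟨c, hc, ?_⟩
  have := congrArg (LinearMap.trace ℂ V) hc
  simp only [map_sum, map_smul, LinearMap.trace_one, smul_eq_mul] at this
  rw [← this]
  rfl

theorem FDRep.finrank_ne_zero_of_simple (V : FDRep ℂ G) [Simple V] :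
    (Module.finrank ℂ V : ℂ) ≠ 0 := by
  intro h
  have h0 : Module.finrank ℂ V = 0 := by exact_mod_cast h
  have := Module.finrank_zero_iff.mp h0
  apply id_nonzero V
  ext x
  exact Subsingleton.elim (α := V) _ _

end RepTheory

section RepTheory

variable {G : Type} [Group G] [Fintype G]

open scoped MonoidAlgebra in
theorem FDRep.smul_eq_zero_of_isSimpleModule (f : G → ℂ)
    (h : ∀ V : FDRep ℂ G, Simple V → ∑ g, f g • V.ρ g = 0)
    (M : Type) [AddCommGroup M] [Module ℂ M] [Module ℂ[G] M] [IsScalarTower ℂ ℂ[G] M]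
    [Module.Finite ℂ M] [IsSimpleModule ℂ[G] M] (v : M) :
    (∑ g, MonoidAlgebra.single g (f g) : ℂ[G]) • v = 0 := by
  let ρ : Representation ℂ G M := Representation.ofModule' M
  have hρ : ∀ (r : ℂ[G]) (m : M), ρ.asAlgebraHom r m = r • m := fun r m => by
    simp only [ρ, Representation.ofModule', Representation.asAlgebraHom, Equiv.apply_symm_apply]
    rfl
  let e : ρ.asModule ≃ₗ[ℂ[G]] M :=
    { ρ.asModuleEquiv.toAddEquiv with
      map_smul' := fun r m => hρ r (ρ.asModuleEquiv m) }
  have : Representation.IsIrreducible ρ :=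
    (Representation.irreducible_iff_isSimpleModule_asModule ρ).mpr (IsSimpleModule.congr e)
  have : Invertible (Nat.card G : ℂ) := invertibleOfNonzero (by simp)
  have hs : Simple (FDRep.of ρ) := by
    rw [FDRep.simple_iff_char_is_norm_one]
    have := Representation.char_orthonormal ρ ρ
    rw [if_pos ⟨Representation.Equiv.refl ρ⟩, inv_mul_eq_iff_eq_mul₀ (by simp), mul_one] at this
    exact this
  have h1 : ρ.asAlgebraHom (∑ g, MonoidAlgebra.single g (f g)) = 0 := by
    simp only [map_sum, Representation.asAlgebraHom_single]
    exact h _ hs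
  rw [← hρ, h1, LinearMap.zero_apply]

open scoped MonoidAlgebra in
theorem FDRep.eq_zero_of_forall_simple (f : G → ℂ)
    (h : ∀ V : FDRep ℂ G, Simple V → ∑ g, f g • V.ρ g = 0) : f = 0 := by
  classical
  let z : ℂ[G] := ∑ g, MonoidAlgebra.single g (f g)
  have : Module.Finite ℂ ℂ[G] :=
    Module.Finite.equiv (MonoidAlgebra.coeffLinearEquiv (S := ℂ) (R := ℂ) (M := G)).symm
  have key : ∀ S : Submodule ℂ[G] ℂ[G], IsSimpleModule ℂ[G] S → ∀ v ∈ S, z * v = 0 := by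
    intro S hS v hv
    have : Module.Finite ℂ S :=
      inferInstanceAs (Module.Finite ℂ (S.restrictScalars ℂ))
    exact congrArg Subtype.val (FDRep.smul_eq_zero_of_isSimpleModule f h S ⟨v, hv⟩)
  let N : Submodule ℂ[G] ℂ[G] :=
    { carrier := {v | ∀ a, z * (a * v) = 0}
      add_mem' := fun hx hy a => by rw [mul_add, mul_add, hx, hy, add_zero]
      zero_mem' := fun a => by simp
      smul_mem' := fun b x hx a => by
        rw [smul_eq_mul, ← mul_assoc a]; exact hx _ }
  have hN : N = ⊤ := by
    rw [eq_top_iff, ← IsSemisimpleModule.sSup_simples_eq_top ℂ[G] ℂ[G]]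
    refine sSup_le fun S hS v hv a => ?_
    exact key S hS _ (S.smul_mem a hv)
  have hz : z = 0 := by
    have : (1 : ℂ[G]) ∈ N := hN ▸ Submodule.mem_top
    simpa using this 1
  funext g
  have := congrArg (fun w : ℂ[G] => w.coeff g) hz
  simpa [z, Finsupp.single_apply] using this

/-- The sum of the operators `η h • ρ h` over the elements `h` of a subgroup. -/
noncomputable def twistedSum {V : Type} [AddCommGroup V] [Module ℂ V] (ρ : Representation ℂ G V)
    (η : G →* ℂˣ) (K : Subgroup G) : V →ₗ[ℂ] V :=
  open scoped Classical in ∑ h : K, ((η h : ℂˣ) : ℂ) • ρ h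

theorem smul_twistedSum {V : Type} [AddCommGroup V] [Module ℂ V] (ρ : Representation ℂ G V)
    (η : G →* ℂˣ) (K : Subgroup G) {k : G} (hk : k ∈ K) :
    (((η k : ℂˣ) : ℂ) • ρ k) * twistedSum ρ η K = twistedSum ρ η K := by
  classical
  simp only [twistedSum]
  rw [Finset.mul_sum, ← Equiv.sum_comp (Equiv.mulLeft (⟨k, hk⟩ : K)) (fun h : K =>
    ((η h : ℂˣ) : ℂ) • ρ h)]
  refine Finset.sum_congr rfl fun h _ => ?_
  simp [smul_smul, mul_comm]

theorem twistedSum_mul_self {V : Type} [AddCommGroup V] [Module ℂ V] (ρ : Representation ℂ G V)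
    (η : G →* ℂˣ) (K : Subgroup G) :
    twistedSum ρ η K * twistedSum ρ η K = (Nat.card K : ℂ) • twistedSum ρ η K := by
  classical
  nth_rw 1 [twistedSum]
  rw [Finset.sum_mul, Finset.sum_congr rfl fun h _ => smul_twistedSum ρ η K h.2]
  simp [Nat.cast_smul_eq_nsmul]

theorem exists_trace_twistedSum {V : Type} [AddCommGroup V] [Module ℂ V] [Module.Finite ℂ V]
    (ρ : Representation ℂ G V) (η : G →* ℂˣ) (K : Subgroup G) :
    ∃ r : ℕ, LinearMap.trace ℂ V (twistedSum ρ η K) = r ∧ (r = 0 ↔ twistedSum ρ η K = 0) := by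
  set E := twistedSum ρ η K with hE
  have hK : (Nat.card K : ℂ) ≠ 0 := by exact_mod_cast Nat.card_pos.ne'
  have hid : IsIdempotentElem ((Nat.card K : ℂ)⁻¹ • E) := by
    rw [IsIdempotentElem, smul_mul_smul_comm, twistedSum_mul_self, smul_smul]
    congr 1
    field_simp
  have ht := (LinearMap.IsIdempotentElem.isProj_range _ hid).trace
  rw [map_smul, smul_eq_mul, inv_mul_eq_iff_eq_mul₀ hK] at ht
  refine ⟨Nat.card K * Module.finrank ℂ (LinearMap.range ((Nat.card K : ℂ)⁻¹ • E)), ?_, ?_⟩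
  · rw [ht]; push_cast; rfl
  · rw [mul_eq_zero, or_iff_right Nat.card_pos.ne', Submodule.finrank_eq_zero, LinearMap.range_eq_bot,
      smul_eq_zero, or_iff_right (inv_ne_zero hK)]

end RepTheory

section RepTheory

variable {G : Type} [Group G] [Fintype G]

open scoped Classical in
theorem card_le_card_of_conj_separated (K : Subgroup G) {T : Type} [Fintype T] (x : T → G)
    (hx : ∀ s t, ∀ h ∈ K, IsConj (x s) (x t * h) → s = t) {J : Type} [Fintype J]
    (ρ : J → FDRep ℂ G)
    (hρ : ∀ V : FDRep ℂ G, Simple V → twistedSum V.ρ 1 K ≠ 0 → ∃ j, Nonempty (V ≅ ρ j)) :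
    Fintype.card T ≤ Fintype.card J := by
  let f : (T → ℂ) → G → ℂ := fun c g => ∑ t, c t * if IsConj (x t) g then 1 else 0
  let Λ : (T → ℂ) →ₗ[ℂ] (J → ℂ) :=
    { toFun := fun c j => ∑ g, f c g * (ρ j).character g
      map_add' := fun c d => by
        funext j
        simp only [f, Pi.add_apply, add_mul, Finset.sum_add_distrib]
      map_smul' := fun a c => by
        funext j
        simp only [f, Pi.smul_apply, smul_eq_mul, RingHom.id_apply, Finset.mul_sum, Finset.sum_mul,
          mul_assoc] }
  have hΛ : Function.Injective Λ := by
    rw [← LinearMap.ker_eq_bot, LinearMap.ker_eq_bot']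
    intro c hc
    have hf : ∀ g h, f c (h * g * h⁻¹) = f c g := fun g h => by
      have : IsConj g (h * g * h⁻¹) := isConj_iff.mpr ⟨h, rfl⟩
      refine Finset.sum_congr rfl fun t _ => ?_
      have : IsConj (x t) (h * g * h⁻¹) ↔ IsConj (x t) g :=
        ⟨fun h' => h'.trans this.symm, fun h' => h'.trans this⟩
      simp only [this]
    let Φ : G → ℂ := fun g => ∑ h : K, f c (g * h)
    have hΦ : Φ = 0 := by
      refine FDRep.eq_zero_of_forall_simple Φ fun V hV => ?_
      have h1 : ∑ g, Φ g • V.ρ g = (∑ g, f c g • V.ρ g) * twistedSum V.ρ 1 K := by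
        simp only [Φ, twistedSum, Finset.sum_mul, Finset.mul_sum, Finset.sum_smul]
        rw [Finset.sum_comm, ← Equiv.sum_comp (Equiv.inv K)]
        refine Finset.sum_congr rfl fun h _ => ?_
        rw [← Equiv.sum_comp (Equiv.mulRight (h : G))]
        refine Finset.sum_congr rfl fun g _ => ?_
        simp [← map_mul]
      rw [h1]
      by_cases h0 : twistedSum V.ρ 1 K = 0
      · rw [h0, mul_zero]
      · obtain ⟨j, ⟨i⟩⟩ := hρ V hV h0
        obtain ⟨a, ha, ha'⟩ := V.sum_classFun_smul (f c) hf
        have : ∑ g, f c g * V.character g = 0 := by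
          rw [FDRep.char_iso i]
          exact congrFun hc j
        rw [this, mul_eq_zero, or_iff_left V.finrank_ne_zero_of_simple] at ha'
        rw [ha, ha', zero_smul, zero_mul]
    funext t
    have h2 : Φ (x t) = c t * ((Finset.univ.filter fun h : K => IsConj (x t) (x t * h)).card : ℂ) := by
      simp only [Φ, f]
      rw [Finset.sum_comm, Finset.sum_eq_single t]
      · rw [← Finset.mul_sum, Finset.sum_boole]
      · intro s _ hst
        refine Finset.sum_eq_zero fun h _ => ?_
        rw [if_neg fun hc => hst (hx s t h h.2 hc), mul_zero]
      · simp
    rw [hΦ, Pi.zero_apply, eq_comm, mul_eq_zero] at h2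
    refine h2.resolve_right ?_
    rw [Nat.cast_eq_zero, Finset.card_eq_zero, Finset.filter_eq_empty_iff]
    push Not
    exact ⟨1, Finset.mem_univ _, by rw [Subgroup.coe_one, mul_one]⟩
  simpa using LinearMap.finrank_le_finrank_of_injective hΛ

theorem FDRep.linearIndependent_trace {ι : Type*} (ρ : ι → FDRep ℂ G)
    (hs : ∀ i, Simple (ρ i)) (hρ : ∀ i j, Nonempty (ρ i ≅ ρ j) → i = j)
    (E : ∀ i, ρ i →ₗ[ℂ] ρ i) (hE : ∀ i, LinearMap.trace ℂ _ (E i) ≠ 0) (η : G →* ℂˣ) :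
    LinearIndependent ℂ fun i (x : G) =>
      ((η x : ℂˣ) : ℂ) * LinearMap.trace ℂ _ ((ρ i).ρ x * E i) := by
  classical
  have : Invertible (Nat.card G : ℂ) := invertibleOfNonzero (by simp)
  rw [linearIndependent_iff']
  intro s c hc i hi
  have hc' : ∀ x : G, ∑ j ∈ s, c j * LinearMap.trace ℂ _ ((ρ j).ρ x * E j) = 0 := by
    intro x
    have h := congrFun hc x
    simp only [Finset.sum_apply, Pi.smul_apply, smul_eq_mul, Pi.zero_apply, mul_left_comm (c _),
      ← Finset.mul_sum] at h
    exact (mul_eq_zero.mp h).resolve_left (η x).ne_zero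
  have horth : ∀ j, ∃ a : ℂ, ∑ x, (ρ i).character x⁻¹ * LinearMap.trace ℂ _ ((ρ j).ρ x * E j)
      = a * LinearMap.trace ℂ _ (E j) ∧ (a = 0 ↔ j ≠ i) := by
    intro j
    have := hs i
    have := hs j
    obtain ⟨a, ha, ha'⟩ := (ρ j).sum_classFun_smul (fun x => (ρ i).character x⁻¹) (fun g h => by
      rw [_root_.mul_inv_rev, _root_.mul_inv_rev, inv_inv, ← mul_assoc, FDRep.char_conj])
    refine ⟨a, ?_, ?_⟩
    · rw [← smul_eq_mul, ← map_smul, ← smul_one_mul, ← ha, Finset.sum_mul, map_sum]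
      refine Finset.sum_congr rfl fun x _ => ?_
      rw [smul_mul_assoc, map_smul, smul_eq_mul]
    · have ho := FDRep.char_orthonormal (ρ j) (ρ i)
      rw [inv_mul_eq_iff_eq_mul₀ (by simp)] at ho
      simp only [mul_comm ((ρ j).character _)] at ho
      rw [ho] at ha'
      have hd := (ρ j).finrank_ne_zero_of_simple
      constructor
      · rintro rfl rfl
        rw [if_pos ⟨Iso.refl _⟩] at ha'
        simp at ha'
        exact Fintype.card_ne_zero (by exact_mod_cast ha'.symm)
      · intro hij
        rw [if_neg fun h => hij (hρ _ _ h), mul_zero] at ha'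
        exact (mul_eq_zero.mp ha').resolve_right hd
  have hsum : ∑ x, (ρ i).character x⁻¹ *
      ∑ j ∈ s, c j * LinearMap.trace ℂ _ ((ρ j).ρ x * E j) = 0 := by
    simp [hc']
  simp only [Finset.mul_sum, mul_left_comm _ (c _)] at hsum
  rw [Finset.sum_comm] at hsum
  simp only [← Finset.mul_sum] at hsum
  rw [Finset.sum_eq_single i] at hsum
  · obtain ⟨a, ha, ha'⟩ := horth i
    rw [ha] at hsum
    refine (mul_eq_zero.mp hsum).resolve_right (mul_ne_zero ?_ (hE i))
    exact fun h => ha'.mp h rfl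
  · intro j _ hj
    obtain ⟨a, ha, ha'⟩ := horth j
    rw [ha, ha'.mpr hj, zero_mul, mul_zero]
  · exact fun h => absurd hi h

end RepTheory

section Geometry

theorem LinearMap.exists_equiv_comp_eq_of_ker_eq {F Z V : Type*} [Field F] [AddCommGroup Z]
    [Module F Z] [AddCommGroup V] [Module F V] [Module.Finite F V] (A B : Z →ₗ[F] V)
    (h : LinearMap.ker A = LinearMap.ker B) : ∃ e : V ≃ₗ[F] V, ∀ z, e (A z) = B z := by
  let e₀ : LinearMap.range A ≃ₗ[F] LinearMap.range B :=
    A.quotKerEquivRange.symm.trans ((Submodule.quotEquivOfEq _ _ h).trans B.quotKerEquivRange)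
  have he₀ : ∀ z, e₀ ⟨A z, z, rfl⟩ = ⟨B z, z, rfl⟩ := fun z => by
    have : A.quotKerEquivRange.symm ⟨A z, z, rfl⟩ = Submodule.Quotient.mk z :=
      A.quotKerEquivRange_symm_apply_image z _
    simp only [e₀, LinearEquiv.trans_apply, this]
    rfl
  obtain ⟨S, hS⟩ := (LinearMap.range A).exists_isCompl
  obtain ⟨T, hT⟩ := (LinearMap.range B).exists_isCompl
  have hd : Module.finrank F S = Module.finrank F T := by
    have h1 := Submodule.finrank_add_eq_of_isCompl hS
    have h2 := Submodule.finrank_add_eq_of_isCompl hT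
    have h3 := e₀.finrank_eq
    omega
  let e : V ≃ₗ[F] V := (Submodule.prodEquivOfIsCompl _ _ hS).symm.trans
    ((e₀.prodCongr (LinearEquiv.ofFinrankEq S T hd)).trans (Submodule.prodEquivOfIsCompl _ _ hT))
  refine ⟨e, fun z => ?_⟩
  have h1 : (Submodule.prodEquivOfIsCompl _ _ hS).symm (A z) = (⟨A z, z, rfl⟩, 0) :=
    Submodule.prodEquivOfIsCompl_symm_apply_left _ _ hS (⟨A z, z, rfl⟩ : LinearMap.range A)
  simp [e, h1, he₀]

/-- The sum of `φ g` over the `g` with `g ∘ a = b`. -/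
noncomputable def compSum {F V X G : Type*} [Field F] [AddCommGroup V] [Module F V]
    [AddCommGroup X] [Module F X] [Group G] [Fintype G] (π : G ≃* (V ≃ₗ[F] V)) (φ : G → ℂ)
    (a b : X →ₗ[F] V) : ℂ :=
  open scoped Classical in ∑ g, if ∀ x, π g (a x) = b x then φ g else 0

open scoped Classical in
theorem compSum_eq_zero {F : Type*} [Field F] [Fintype F] {V X : Type*} [AddCommGroup V]
    [Module F V] [Fintype V] [AddCommGroup X] [Module F X] [Module.Finite F X] {G : Type*} [Group G]
    [Fintype G] (π : G ≃* (V ≃ₗ[F] V)) (a : X →ₗ[F] V) (ha : Function.Injective a) (φ : G → ℂ)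
    (hφ : ∀ g h, φ (h * g * h⁻¹) = φ g)
    (hN : ∀ W : Submodule F V, Module.finrank F W < Module.finrank F X → ∀ g₀,
      compSum π φ W.subtype ((π g₀).toLinearMap ∘ₗ W.subtype) = 0)
    (hP : ∀ y : X →ₗ[F] X, Function.Injective y → compSum π φ a (a ∘ₗ y) = 0) (b : X →ₗ[F] V) :
    compSum π φ a b = 0 := by
  simp only [compSum] at hP hN ⊢
  have : Module.Finite F V := Module.Finite.of_finite
  induction hd : Module.finrank F (LinearMap.range a ⊔ LinearMap.range b : Submodule F V)
    using Nat.strong_induction_on generalizing b with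
  | _ d ih =>
  by_cases hb : ∃ g₀, ∀ x, π g₀ (a x) = b x
  swap
  · refine Finset.sum_eq_zero fun g _ => if_neg fun h => hb ⟨g, h⟩
  obtain ⟨g₀, hg₀⟩ := hb
  have hbi : Function.Injective b := fun x y hxy => ha ((π g₀).injective (by rw [hg₀, hg₀, hxy]))
  by_cases hr : LinearMap.range b ≤ LinearMap.range a
  · let y : X →ₗ[F] X := (LinearEquiv.ofInjective a ha).symm.toLinearMap ∘ₗ
      b.codRestrict (LinearMap.range a) fun x => hr ⟨x, rfl⟩
    have hy : ∀ x, a (y x) = b x := fun x => by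
      have := congrArg Subtype.val ((LinearEquiv.ofInjective a ha).apply_symm_apply
        ⟨b x, hr ⟨x, rfl⟩⟩)
      exact this
    have := hP y fun x x' hx => hbi (by rw [← hy, ← hy, hx])
    simpa only [LinearMap.comp_apply, hy] using this
  · obtain ⟨_, ⟨x₀, rfl⟩, hx₀⟩ := SetLike.not_le_iff_exists.mp hr
    obtain ⟨μ₀, hμ₀, hμa₀⟩ := Submodule.exists_le_ker_of_notMem hx₀
    obtain ⟨μ, hμ, hμa⟩ : ∃ μ : V →ₗ[F] F, μ (b x₀) = 1 ∧ ∀ x, μ (a x) = 0 :=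
      ⟨(μ₀ (b x₀))⁻¹ • μ₀, by simp [hμ₀], fun x => by
        have : μ₀ (a x) = 0 := hμa₀ ⟨x, rfl⟩
        simp [this]⟩
    let b' : V → X →ₗ[F] V := fun u => b + (μ ∘ₗ b).smulRight u
    have hb' : ∀ u x, b' u x = b x + μ (b x) • u := fun u x => rfl
    let W' := LinearMap.ker (μ ∘ₗ b)
    let A₀ := LinearMap.range a ⊔ W'.map b
    have hA₀ : ∀ v ∈ A₀, μ v = 0 := by
      intro v hv
      obtain ⟨_, ⟨x, rfl⟩, _, ⟨y, hy, rfl⟩, rfl⟩ := Submodule.mem_sup.mp hv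
      rw [map_add, hμa, zero_add]
      exact hy
    have hW' : ∀ y, y - μ (b y) • x₀ ∈ W' := fun y => by
      simp [W', hμ]
    have hlt : Module.finrank F (W'.map a) < Module.finrank F X := by
      refine (Submodule.finrank_map_le a W').trans_lt (Submodule.finrank_lt ?_)
      intro h
      have : x₀ ∈ W' := h ▸ Submodule.mem_top
      exact one_ne_zero (hμ.symm.trans this)
    have hsum : ∑ u, ∑ g, (if ∀ x, π g (a x) = b' u x then φ g else 0) = 0 := by
      rw [Finset.sum_comm]
      refine (Finset.sum_congr rfl fun g _ => ?_).trans (hN _ hlt g₀)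
      split_ifs with hg
      · rw [Finset.sum_eq_single (π g (a x₀) - b x₀), if_pos]
        · intro x
          have h1 := hg ⟨_, _, hW' x, rfl⟩
          rw [Submodule.subtype_apply, LinearMap.comp_apply, Submodule.subtype_apply,
            LinearEquiv.coe_coe, hg₀] at h1
          simp only [map_sub, map_smul] at h1
          rw [hb', smul_sub, ← sub_eq_zero]
          rw [← sub_eq_zero] at h1
          rw [← h1]
          abel
        · intro u _ hu
          refine if_neg fun h => hu ?_
          rw [h, hb', hμ, one_smul, add_sub_cancel_left]
        · simp
      · refine Finset.sum_eq_zero fun u _ => if_neg fun h => hg ?_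
        rintro ⟨_, x, hx, rfl⟩
        have hx' : μ (b x) = 0 := hx
        change π g (a x) = π g₀ (a x)
        rw [hg₀, h, hb', hx', zero_smul, add_zero]
    have hu : ∀ u, ∑ g, (if ∀ x, π g (a x) = b' u x then φ g else 0) =
        if b x₀ + u ∈ A₀ then 0 else ∑ g, (if ∀ x, π g (a x) = b x then φ g else 0) := by
      intro u
      split_ifs with hu
      · refine ih _ ?_ (b' u) rfl
        rw [← hd]
        refine (Submodule.finrank_mono (t := A₀) (sup_le le_sup_left ?_)).trans_lt
          (Submodule.finrank_lt_finrank_of_lt (lt_of_le_of_ne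
            (sup_le_sup_left (LinearMap.map_le_range) _) ?_))
        · rintro _ ⟨x, rfl⟩
          have : b' u x = b (x - μ (b x) • x₀) + μ (b x) • (b x₀ + u) := by
            rw [hb', map_sub, map_smul, smul_add]; abel
          rw [this]
          exact add_mem (le_sup_right (a := LinearMap.range a) ⟨_, hW' x, rfl⟩)
            (A₀.smul_mem _ hu)
        · intro h
          have : b x₀ ∈ A₀ := h ▸ le_sup_right (a := LinearMap.range a) ⟨x₀, rfl⟩
          exact one_ne_zero (hμ.symm.trans (hA₀ _ this))
      · have hk : LinearMap.ker (a.coprod b) = LinearMap.ker (a.coprod (b' u)) := by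
          ext ⟨x, y⟩
          simp only [LinearMap.mem_ker, LinearMap.coprod_apply, hb']
          constructor
          · intro h
            have := congrArg μ h
            rw [map_add, hμa, zero_add, map_zero] at this
            rw [this, zero_smul, add_zero, h]
          · intro h
            by_cases hc : μ (b y) = 0
            · rwa [hc, zero_smul, add_zero] at h
            · refine absurd ?_ hu
              have h1 : μ (b y) • (b x₀ + u) = -(a x + b (y - μ (b y) • x₀)) := by
                rw [eq_neg_iff_add_eq_zero, ← h, map_sub, map_smul, smul_add]; abel
              rw [← A₀.smul_mem_iff hc, h1]
              exact neg_mem (add_mem (le_sup_left (b := W'.map b) ⟨x, rfl⟩)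
                (le_sup_right (a := LinearMap.range a) ⟨_, hW' y, rfl⟩))
        obtain ⟨e, he⟩ := LinearMap.exists_equiv_comp_eq_of_ker_eq _ _ hk
        have hea : ∀ x, e (a x) = a x := fun x => by simpa using he (x, 0)
        have heb : ∀ x, e (b x) = b' u x := fun x => by simpa using he (0, x)
        rw [← Equiv.sum_comp (MulAut.conj (π.symm e)).toEquiv]
        refine Finset.sum_congr rfl fun g _ => ?_
        simp only [MulEquiv.toEquiv_eq_coe, EquivLike.coe_coe, MulAut.conj_apply, hφ]
        have : (∀ x, π (π.symm e * g * (π.symm e)⁻¹) (a x) = b' u x) ↔ ∀ x, π g (a x) = b x := by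
          refine forall_congr' fun x => ?_
          have : (e⁻¹ : V ≃ₗ[F] V) (a x) = a x := by
            rw [← hea x]; exact (e.symm_apply_apply _).trans (hea x).symm
          rw [map_mul, map_mul, map_inv, π.apply_symm_apply, LinearEquiv.mul_apply,
            LinearEquiv.mul_apply, this, ← heb, e.injective.eq_iff]
        simp only [this]
    simp only [hu] at hsum
    rw [Finset.sum_ite, Finset.sum_const_zero, zero_add, Finset.sum_const, nsmul_eq_mul,
      mul_eq_zero] at hsum
    refine hsum.resolve_left ?_
    rw [Nat.cast_eq_zero, Finset.card_eq_zero, Finset.filter_eq_empty_iff]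
    push Not
    refine ⟨0, Finset.mem_univ _, fun h => ?_⟩
    rw [add_zero] at h
    exact one_ne_zero (hμ.symm.trans (hA₀ _ h))

end Geometry

section Similarity

open Polynomial

theorem Module.AEval'.exists_equiv_pi {F X : Type} [Field F] [AddCommGroup X] [Module F X]
    [Module.Finite F X] (y : X →ₗ[F] X) :
    ∃ (ι : Type) (_ : Fintype ι) (p : ι → F[X]) (e : ι → ℕ),
      (∀ i, Irreducible (p i) ∧ (p i).Monic ∧ e i ≠ 0) ∧
      Nonempty (Module.AEval' y ≃ₗ[F[X]] ∀ i, F[X] ⧸ Ideal.span {p i ^ e i}) ∧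
      ∑ i, e i * (p i).natDegree = Module.finrank F X := by
  classical
  obtain ⟨ι, hι, p, hp, e, ⟨E⟩⟩ := Module.equiv_directSum_of_isTorsion (R := F[X])
    (M := Module.AEval' y) (Module.AEval.isTorsion_of_finiteDimensional F X y)
  have hspan : ∀ i, Ideal.span {p i ^ e i} = Ideal.span {normalize (p i) ^ e i} := fun i =>
    Ideal.span_singleton_eq_span_singleton.mpr ((associated_normalize _).pow_pow)
  let r : (∀ i, F[X] ⧸ Ideal.span {p i ^ e i}) →ₗ[F[X]]
      ∀ i : {i // e i ≠ 0}, F[X] ⧸ Ideal.span {p i.1 ^ e i.1} :=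
    LinearMap.pi fun i => LinearMap.proj i.1
  have hr : Function.Bijective r := by
    have hsub : ∀ i, e i = 0 → Subsingleton (F[X] ⧸ Ideal.span {p i ^ e i}) := fun i hi => by
      rw [hi, pow_zero, Ideal.span_singleton_one]
      exact Ideal.Quotient.subsingleton_iff.mpr rfl
    constructor
    · intro v w hvw
      funext i
      by_cases hi : e i = 0
      · have := hsub i hi
        exact Subsingleton.elim _ _
      · exact congrFun hvw ⟨i, hi⟩
    · intro v
      refine ⟨fun i => if hi : e i ≠ 0 then v ⟨i, hi⟩ else 0, ?_⟩
      funext i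
      simp [r, i.2]
  let E' : Module.AEval' y ≃ₗ[F[X]]
      ∀ i : {i // e i ≠ 0}, F[X] ⧸ Ideal.span {normalize (p i.1) ^ e i.1} :=
    E.trans ((DirectSum.linearEquivFunOnFintype F[X] ι _).trans
      ((LinearEquiv.ofBijective r hr).trans
        (LinearEquiv.piCongrRight fun i => Submodule.quotEquivOfEq _ _ (hspan i.1))))
  refine ⟨{i // e i ≠ 0}, inferInstance, fun i => normalize (p i.1), fun i => e i.1, fun i =>
    ⟨(normalize_associated _).irreducible_iff.mpr (hp _),
      Polynomial.monic_normalize (hp _).ne_zero, i.2⟩, ⟨E'⟩, ?_⟩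
  have hfin : ∀ i : {i // e i ≠ 0}, Module.Finite F (F[X] ⧸ Ideal.span {normalize (p i.1) ^ e i.1}) :=
    fun i => ((Polynomial.monic_normalize (hp _).ne_zero).pow _).finite_quotient
  have := ((Module.AEval'.of y).trans (E'.restrictScalars F)).finrank_eq
  rw [this, Module.finrank_pi_fintype]
  refine Finset.sum_congr rfl fun i _ => ?_
  rw [finrank_quotient_span_eq_natDegree, natDegree_pow]

theorem exists_equiv_comp_eq_of_card_fiber_eq {α β γ : Type*} [Fintype α] [Fintype β]
    (f : α → γ) (g : β → γ) (h : ∀ c, Nat.card {a // f a = c} = Nat.card {b // g b = c}) :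
    ∃ σ : α ≃ β, ∀ a, g (σ a) = f a := by
  have e : ∀ c, {a // f a = c} ≃ {b // g b = c} := fun c =>
    (Finite.equivFin _).trans ((finCongr (h c)).trans (Finite.equivFin _).symm)
  refine ⟨(Equiv.sigmaFiberEquiv f).symm.trans
    ((Equiv.sigmaCongrRight e).trans (Equiv.sigmaFiberEquiv g)), fun a => ?_⟩
  exact (e (f a) ⟨a, rfl⟩).2

/-- Two endomorphisms of `X` are similar when an automorphism of `X` intertwines them. -/
def IsSimilar {F X : Type} [Field F] [AddCommGroup X] [Module F X] (y z : X →ₗ[F] X) : Prop :=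
  ∃ e : X ≃ₗ[F] X, ∀ v, e (y v) = z (e v)

theorem isSimilar_of_equiv {F X : Type} [Field F] [AddCommGroup X] [Module F X]
    {y z : X →ₗ[F] X} (E : Module.AEval' y ≃ₗ[F[X]] Module.AEval' z) : IsSimilar y z := by
  refine ⟨(Module.AEval'.of y).trans ((E.restrictScalars F).trans (Module.AEval'.of z).symm),
    fun v => ?_⟩
  simp only [LinearEquiv.trans_apply, LinearEquiv.restrictScalars_apply]
  rw [← Module.AEval'.X_smul_of, map_smul, Module.AEval'.of_symm_X_smul]

open scoped Classical in
theorem exists_invariant_of_endomorphism {F X : Type} [Field F] [AddCommGroup X] [Module F X]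
    [Module.Finite F X] : ∃ (s : (X →ₗ[F] X) → Finset F[X]) (n : (X →ₗ[F] X) → F[X] → ℕ → ℕ),
      (∀ y, ∀ p ∈ s y, Irreducible p ∧ p.Monic) ∧
      (∀ y, ∑ p ∈ s y, p.natDegree ≤ Module.finrank F X) ∧
      (∀ y, ∑ p ∈ s y, p.natDegree = Module.finrank F X →
        ∀ p e, n y p e = if p ∈ s y ∧ e = 1 then 1 else 0) ∧
      (∀ y p e, n y p e ≤ Module.finrank F X) ∧
      (∀ y p e, n y p e ≠ 0 → p ∈ s y ∧ e ≤ Module.finrank F X) ∧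
      ∀ y z, n y = n z → IsSimilar y z := by
  choose ι hι p e hpe E hd using fun y : X →ₗ[F] X => Module.AEval'.exists_equiv_pi y
  have hdeg : ∀ y i, 1 ≤ (p y i).natDegree := fun y i => (hpe y i).1.natDegree_pos
  have he : ∀ y i, 1 ≤ e y i := fun y i => Nat.one_le_iff_ne_zero.mpr (hpe y i).2.2
  have hle : ∀ y, ∑ q ∈ Finset.univ.image (p y), q.natDegree ≤ ∑ i, (p y i).natDegree := fun y =>
    Finset.sum_image_le_of_nonneg (fun _ _ => Nat.zero_le _)
  have hle' : ∀ y, ∑ i, (p y i).natDegree ≤ Module.finrank F X := fun y => by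
    rw [← hd y]
    exact Finset.sum_le_sum fun i _ => Nat.le_mul_of_pos_left _ (he y i)
  refine ⟨fun y => Finset.univ.image (p y), fun y q d => Nat.card {i // (p y i, e y i) = (q, d)},
    ?_, fun y => (hle y).trans (hle' y), ?_, ?_, ?_, ?_⟩
  · intro y q hq
    obtain ⟨i, -, rfl⟩ := Finset.mem_image.mp hq
    exact ⟨(hpe y i).1, (hpe y i).2.1⟩
  · intro y hy q d
    replace hy : ∑ q ∈ Finset.univ.image (p y), q.natDegree = Module.finrank F X := hy
    have h1 : ∑ i, (p y i).natDegree = Module.finrank F X :=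
      le_antisymm (hle' y) (hy ▸ hle y)
    have he1 : ∀ i, e y i = 1 := by
      rw [← hd y] at h1
      have := (Finset.sum_eq_sum_iff_of_le (fun i _ =>
        Nat.le_mul_of_pos_left (p y i).natDegree (he y i))).mp h1
      intro i
      have h2 := this i (Finset.mem_univ i)
      exact Nat.eq_of_mul_eq_mul_right (hdeg y i) (h2.symm.trans (one_mul _).symm)
    have hinj : Function.Injective (p y) := by
      intro i j hij
      by_contra hne
      have h2 : ∑ q ∈ Finset.univ.image (p y), q.natDegree ≤
          ∑ i ∈ Finset.univ.erase j, (p y i).natDegree := by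
        have h3 : Finset.univ.image (p y) = (Finset.univ.erase j).image (p y) := by
          ext q
          simp only [Finset.mem_image, Finset.mem_univ, true_and, Finset.mem_erase, and_true]
          constructor
          · rintro ⟨l, rfl⟩
            by_cases hl : l = j
            · exact ⟨i, hne, hl ▸ hij⟩
            · exact ⟨l, hl, rfl⟩
          · rintro ⟨l, -, rfl⟩
            exact ⟨l, rfl⟩
        rw [h3]
        exact Finset.sum_image_le_of_nonneg (fun _ _ => Nat.zero_le _)
      have h3 := Finset.sum_erase_add Finset.univ (fun i => (p y i).natDegree) (Finset.mem_univ j)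
      have h4 := hdeg y j
      omega
    split_ifs with h
    · obtain ⟨i, -, rfl⟩ := Finset.mem_image.mp h.1
      rw [Nat.card_eq_one_iff_unique]
      exact ⟨⟨fun a b => Subtype.ext (hinj ((congrArg Prod.fst a.2).trans
        (congrArg Prod.fst b.2).symm))⟩, ⟨⟨i, by rw [he1, h.2]⟩⟩⟩
    · rw [Nat.card_eq_zero]
      refine Or.inl ⟨fun i => h ⟨?_, ?_⟩⟩
      · rw [show q = _ from (congrArg Prod.fst i.2).symm]
        exact Finset.mem_image_of_mem _ (Finset.mem_univ _)
      · rw [show d = _ from (congrArg Prod.snd i.2).symm]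
        exact he1 _
  · intro y q d
    refine (Finite.card_subtype_le _).trans (le_trans ?_ (hle' y))
    rw [Nat.card_eq_fintype_card, ← Finset.card_univ, Finset.card_eq_sum_ones]
    exact Finset.sum_le_sum fun i _ => hdeg y i
  · intro y q d h
    obtain ⟨⟨i, hi⟩⟩ := (Nat.card_ne_zero.mp h).1
    obtain ⟨rfl, rfl⟩ := Prod.ext_iff.mp hi
    refine ⟨Finset.mem_image_of_mem _ (Finset.mem_univ _), ?_⟩
    rw [← hd y]
    exact (Nat.le_mul_of_pos_right _ (hdeg y i)).trans
      (Finset.single_le_sum (f := fun i => e y i * (p y i).natDegree)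
        (fun _ _ => Nat.zero_le _) (Finset.mem_univ i))
  · intro y z h
    obtain ⟨σ, hσ⟩ := exists_equiv_comp_eq_of_card_fiber_eq (fun i => (p y i, e y i))
      (fun i => (p z i, e z i)) fun c => congrFun (congrFun h c.1) c.2
    have hσ1 : ∀ i, p y i = p z (σ i) := fun i => (congrArg Prod.fst (hσ i)).symm
    have hσ2 : ∀ i, e y i = e z (σ i) := fun i => (congrArg Prod.snd (hσ i)).symm
    refine isSimilar_of_equiv ((E y).some.trans (LinearEquiv.trans
      (LinearEquiv.piCongrRight fun i => ?_) ((LinearEquiv.piCongrLeft F[X] _ σ).trans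
        (E z).some.symm)))
    exact Submodule.quotEquivOfEq _ _ (by rw [hσ1, hσ2])

theorem Finset.eq_of_prod_eq_of_irreducible_monic {F : Type} [Field F] {s t : Finset F[X]}
    (hs : ∀ p ∈ s, Irreducible p ∧ p.Monic) (ht : ∀ p ∈ t, Irreducible p ∧ p.Monic)
    (h : ∏ p ∈ s, p = ∏ p ∈ t, p) : s = t := by
  have key : ∀ {s t : Finset F[X]}, (∀ p ∈ s, Irreducible p ∧ p.Monic) →
      (∀ p ∈ t, Irreducible p ∧ p.Monic) → ∏ p ∈ s, p = ∏ p ∈ t, p → s ⊆ t := by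
    intro s t hs ht h p hp
    have hd : p ∣ ∏ p ∈ t, p := h ▸ Finset.dvd_prod_of_mem _ hp
    obtain ⟨r, hr, hpr⟩ := ((hs p hp).1.prime.dvd_finsetProd_iff _).mp hd
    have := eq_of_monic_of_associated (hs p hp).2 (ht r hr).2
      ((hs p hp).1.associated_of_dvd (ht r hr).1 hpr)
    exact this ▸ hr
  exact (key hs ht h).antisymm (key ht hs h.symm)

theorem Polynomial.Monic.eq_of_natDegree_eq_of_coeff_eq {F : Type} [Field F] {f g : F[X]}
    (hf : f.Monic) (hg : g.Monic) (hd : f.natDegree = g.natDegree)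
    (h : ∀ i < f.natDegree, f.coeff i = g.coeff i) : f = g := by
  ext i
  rcases lt_trichotomy i f.natDegree with hi | hi | hi
  · exact h i hi
  · rw [hi, hf.coeff_natDegree, hd, hg.coeff_natDegree]
  · rw [coeff_eq_zero_of_natDegree_lt hi, coeff_eq_zero_of_natDegree_lt (hd ▸ hi)]

open scoped Classical in
theorem card_le_of_pairwise_not_isSimilar {F X : Type} [Field F] [Fintype F] [AddCommGroup X]
    [Module F X] [Module.Finite F X] {T : Type} [Fintype T] (y : T → X →ₗ[F] X)
    (hy : ∀ s t, IsSimilar (y s) (y t) → s = t) (k : ℕ) (hk : Module.finrank F X = k) :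
    Fintype.card T ≤ Fintype.card F ^ k +
      k * (Fintype.card F ^ (k - 1) * ((k + 1) ^ (k + 1)) ^ k) := by
  obtain ⟨s, n, hs, hsd, hsq, hn, hn0, hsim⟩ := exists_invariant_of_endomorphism (F := F) (X := X)
  rw [hk] at hsd hsq hn hn0
  let g : T → F[X] := fun t => ∏ p ∈ s (y t), p
  have hgm : ∀ t, (g t).Monic := fun t => monic_prod_of_monic _ _ fun p hp => (hs _ p hp).2
  have hgd : ∀ t, (g t).natDegree = ∑ p ∈ s (y t), p.natDegree := fun t =>
    natDegree_prod_of_monic _ _ fun p hp => (hs _ p hp).2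
  have hgk : ∀ t, (g t).natDegree ≤ k := fun t => (hgd t).trans_le (hsd _)
  have hsg : ∀ t u, g t = g u → s (y t) = s (y u) := fun t u h =>
    Finset.eq_of_prod_eq_of_irreducible_monic (hs _) (hs _) h
  have hcard : ∀ t, (s (y t)).card ≤ k := fun t => by
    refine le_trans ?_ (hsd (y t))
    rw [Finset.card_eq_sum_ones]
    exact Finset.sum_le_sum fun p hp => (hs _ p hp).1.natDegree_pos
  let enum : T → Fin k → F[X] := fun t j => (s (y t)).toList.getD j 0
  have henum : ∀ t, ∀ p ∈ s (y t), ∃ j, enum t j = p := by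
    intro t p hp
    obtain ⟨j, hj, rfl⟩ := List.getElem_of_mem (Finset.mem_toList.mpr hp)
    refine ⟨⟨j, ?_⟩, ?_⟩
    · rw [Finset.length_toList] at hj
      exact hj.trans_le (hcard t)
    · simp only [enum]
      exact List.getD_eq_getElem _ _ hj
  let Ψ : T → (Fin k → F) ⊕ (Fin k × (Fin (k - 1) → F) × (Fin k → Fin (k + 1) → Fin (k + 1))) :=
    fun t => if h : (g t).natDegree = k then Sum.inl fun i => (g t).coeff i else
      Sum.inr (⟨(g t).natDegree, lt_of_le_of_ne (hgk t) h⟩, fun i => (g t).coeff i,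
        fun j e => ⟨n (y t) (enum t j) e, Nat.lt_succ_of_le (hn _ _ _)⟩)
  have hΨ : Function.Injective Ψ := by
    intro t u htu
    refine hy t u (hsim _ _ ?_)
    by_cases ht : (g t).natDegree = k <;> by_cases hu : (g u).natDegree = k
    · simp only [Ψ, dif_pos ht, dif_pos hu, Sum.inl.injEq] at htu
      have hg : g t = g u := (hgm t).eq_of_natDegree_eq_of_coeff_eq (hgm u) (ht.trans hu.symm)
        fun i hi => congrFun htu ⟨i, ht ▸ hi⟩
      funext p e
      rw [hsq _ ((hgd t).symm.trans ht), hsq _ ((hgd u).symm.trans hu), hsg t u hg]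
    · simp [Ψ, dif_pos ht, dif_neg hu] at htu
    · simp [Ψ, dif_neg ht, dif_pos hu] at htu
    · simp only [Ψ, dif_neg ht, dif_neg hu, Sum.inr.injEq, Prod.mk.injEq, Fin.mk.injEq] at htu
      obtain ⟨h1, h2, h3⟩ := htu
      have hg : g t = g u := (hgm t).eq_of_natDegree_eq_of_coeff_eq (hgm u) h1 fun i hi =>
        congrFun h2 ⟨i, by have := hgk t; omega⟩
      have hst := hsg t u hg
      have he : enum t = enum u := by simp only [enum, hst]
      funext p e
      by_cases hp : p ∈ s (y t) ∧ e ≤ k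
      · obtain ⟨j, rfl⟩ := henum t p hp.1
        have := congrFun (congrFun h3 j) ⟨e, Nat.lt_succ_of_le hp.2⟩
        rw [he]
        simpa [he] using this
      · rw [by_contra fun h => hp (hn0 (y t) p e h),
          by_contra fun h => hp (hst ▸ hn0 (y u) p e h)]
  refine (Fintype.card_le_of_injective Ψ hΨ).trans_eq ?_
  simp

end Similarity

section Characters

variable {m : Type} [Fintype m] [DecidableEq m] {F : Type} [Field F]

/-- The invertible diagonal matrix with the given units on the diagonal. -/
noncomputable def Matrix.GeneralLinearGroup.diagonalUnits : (m → Fˣ) →* GL m F :=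
  (Units.map (Matrix.diagonalRingHom m F).toMonoidHom).comp MulEquiv.piUnits.symm.toMonoidHom

theorem Matrix.GeneralLinearGroup.coe_diagonalUnits (d : m → Fˣ) :
    (Matrix.GeneralLinearGroup.diagonalUnits d : Matrix m m F) = diagonal fun i => (d i : F) := rfl

theorem MonoidHom.apply_eq_of_semiconjBy {G A : Type*} [Group G] [CommGroup A] (χ : G →* A)
    {x y z : G} (h : x * y = z * x) : χ y = χ z := by
  have := congrArg χ h
  rw [map_mul, map_mul, mul_comm] at this
  exact mul_right_cancel this

theorem Matrix.GeneralLinearGroup.monoidHom_transvection {A : Type*} [CommGroup A]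
    (χ : GL m F →* A) {u : F} (hu0 : u ≠ 0) (hu1 : u ≠ 1) {i j : m} (hij : i ≠ j) (c : F)
    (g : GL m F) (hg : (g : Matrix m m F) = transvection i j c) : χ g = 1 := by
  let t : F → GL m F := fun c => mkOfDetNeZero (transvection i j c) (by simp [det_transvection_of_ne, hij])
  have ht : ∀ c, (t c : Matrix m m F) = transvection i j c := fun c => rfl
  let D : GL m F := diagonalUnits (Pi.mulSingle i (Units.mk0 u hu0))
  have hD : ∀ c, D * t c = t (u * c) * D := by
    intro c
    apply Units.ext
    rw [Units.val_mul, Units.val_mul, ht, ht, coe_diagonalUnits]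
    ext a b
    simp only [diagonal_mul, mul_diagonal, transvection, add_apply, single_apply, one_apply]
    by_cases hb : b = i
    · subst hb
      by_cases ha : a = b
      · subst ha; simp [hij.symm]
      · simp [ha, hij.symm]
    · by_cases hab : a = b
      · subst hab; simp [Ne.symm hb, hb]
      · by_cases ha : a = i
        · subst ha
          by_cases hj : b = j
          · subst hj
            simp [hb, Ne.symm hb]
          · simp [hb, Ne.symm hb, Ne.symm hj]
        · simp [hab, Ne.symm ha]
  have hmul : ∀ c d, t c * t d = t (c + d) := fun c d => by
    apply Units.ext
    rw [Units.val_mul, ht, ht, ht, transvection_mul_transvection_same _ _ hij]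
  have hz : u - 1 ≠ 0 := sub_ne_zero.mpr hu1
  have h1 := χ.apply_eq_of_semiconjBy (hD (c / (u - 1)))
  have h2 : t (u * (c / (u - 1))) = t c * t (c / (u - 1)) := by
    rw [hmul]
    congr 1
    field_simp
    ring
  rw [h2, map_mul, right_eq_mul] at h1
  rw [← h1]
  exact congrArg χ (Units.ext hg)

theorem Matrix.GeneralLinearGroup.monoidHom_ext {A : Type*} [CommGroup A] (i₀ : m) {u : F}
    (hu0 : u ≠ 0) (hu1 : u ≠ 1) {χ ψ : GL m F →* A}
    (h : ∀ a : Fˣ, χ (diagonalUnits (Pi.mulSingle i₀ a)) = ψ (diagonalUnits (Pi.mulSingle i₀ a))) :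
    χ = ψ := by
  suffices hs : ∀ χ : GL m F →* A, (∀ a : Fˣ, χ (diagonalUnits (Pi.mulSingle i₀ a)) = 1) → χ = 1 by
    have := hs (χ / ψ) fun a => by rw [MonoidHom.div_apply, h, div_self']
    exact div_eq_one.mp this
  intro χ hχ
  have hdiag : χ.comp diagonalUnits = 1 := by
    refine MonoidHom.functions_ext _ _ _ fun i a => ?_
    rw [MonoidHom.comp_apply, MonoidHom.one_apply, ← hχ a]
    let S : GL m F := mkOfDetNeZero ((Equiv.swap i i₀).permMatrix F)
      (by rw [det_permutation]; exact (((Equiv.swap i i₀).sign.isUnit.map (Int.castRingHom F))).ne_zero)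
    refine (χ.apply_eq_of_semiconjBy (x := S) (Units.ext ?_)).symm
    have hS : (S : Matrix m m F) = (Equiv.swap i i₀).permMatrix F := rfl
    rw [Units.val_mul, Units.val_mul, hS, coe_diagonalUnits, coe_diagonalUnits]
    ext a' b
    rw [diagonal_mul, mul_diagonal, mul_comm]
    by_cases hab : Equiv.swap i i₀ a' = b
    · congr 2
      simp only [Pi.mulSingle_apply, ← hab]
      congr 1
      rw [eq_iff_iff, Equiv.swap_apply_eq_iff, Equiv.swap_apply_right]
    · have : (Equiv.swap i i₀).permMatrix F a' b = 0 := by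
        simp [Equiv.Perm.permMatrix, PEquiv.toMatrix_apply, hab]
      rw [this, mul_zero, mul_zero]
  ext g
  have key : ∀ g' : GL m F, (g' : Matrix m m F) = g → χ g' = 1 := by
    refine diagonal_transvection_induction_of_det_ne_zero
      (fun M => ∀ g' : GL m F, (g' : Matrix m m F) = M → χ g' = 1) g
      ((Matrix.isUnit_iff_isUnit_det _).mp g.isUnit).ne_zero ?_ ?_ ?_
    · intro D hD g' hg'
      rw [det_diagonal, Finset.prod_ne_zero_iff] at hD
      have : g' = diagonalUnits fun i => Units.mk0 (D i) (hD i (Finset.mem_univ i)) :=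
        Units.ext hg'
      rw [this]
      exact DFunLike.congr_fun hdiag _
    · intro t g' hg'
      exact monoidHom_transvection χ hu0 hu1 t.hij t.c g' hg'
    · intro A B hA hB hPA hPB g' hg'
      have : g' = mkOfDetNeZero A hA * mkOfDetNeZero B hB := Units.ext hg'
      rw [this, map_mul, hPA _ rfl, hPB _ rfl, mul_one]
  simp [key g rfl]

theorem Matrix.GeneralLinearGroup.card_monoidHom_le [Fintype F] [Nonempty m]
    (hF : 3 ≤ Fintype.card F) :
    Finite (GL m F →* ℂˣ) ∧ Nat.card (GL m F →* ℂˣ) ≤ Fintype.card F - 1 := by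
  classical
  obtain ⟨u, hu⟩ : ∃ u : F, u ∉ ({0, 1} : Finset F) := by
    by_contra! h
    have := Finset.card_le_card (fun x _ => h x : Finset.univ ⊆ ({0, 1} : Finset F))
    have h2 := Finset.card_le_two (a := (0 : F)) (b := 1)
    rw [Finset.card_univ] at this
    omega
  simp only [Finset.mem_insert, Finset.mem_singleton, not_or] at hu
  obtain ⟨i₀⟩ := ‹Nonempty m›
  let r : (GL m F →* ℂˣ) → (Fˣ →* ℂˣ) := fun χ =>
    (χ.comp diagonalUnits).comp (MonoidHom.mulSingle (fun _ : m => Fˣ) i₀)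
  have hr : Function.Injective r := fun χ ψ h =>
    monoidHom_ext i₀ hu.1 hu.2 fun a => DFunLike.congr_fun h a
  have hc := CommGroup.card_monoidHom_of_hasEnoughRootsOfUnity Fˣ ℂ
  have : Finite (Fˣ →* ℂˣ) := Nat.finite_of_card_ne_zero (by rw [hc]; exact Nat.card_pos.ne')
  refine ⟨Finite.of_injective r hr, (Nat.card_le_card_of_injective r hr).trans_eq ?_⟩
  rw [hc, Nat.card_units, Nat.card_eq_fintype_card]

end Characters

section FixingSubgroup

set_option linter.unusedSectionVars false

variable {F : Type} [Field F] {V : Type} [AddCommGroup V] [Module F V] {G : Type} [Group G]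
  [Fintype G]

/-- The elements of `G` that act trivially on the subspace `W`. -/
def fixingSubspace (π : G ≃* (V ≃ₗ[F] V)) (W : Submodule F V) : Subgroup G where
  carrier := {g | ∀ w ∈ W, π g w = w}
  mul_mem' := fun {g h} hg hh w hw => by
    rw [map_mul, LinearEquiv.mul_apply, hh w hw, hg w hw]
  one_mem' := fun w _ => by rw [map_one]; rfl
  inv_mem' := fun {g} hg w hw => by
    rw [map_inv]
    exact (LinearEquiv.symm_apply_eq _).mpr (hg w hw).symm

theorem mem_fixingSubspace {π : G ≃* (V ≃ₗ[F] V)} {W : Submodule F V} {g : G} :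
    g ∈ fixingSubspace π W ↔ ∀ w ∈ W, π g w = w := Iff.rfl

open scoped Classical in
theorem trace_mul_twistedSum (ρ : FDRep ℂ G) (χ : G →* ℂˣ) (K : Subgroup G) (g₀ : G) :
    ((χ g₀ : ℂˣ) : ℂ) * LinearMap.trace ℂ _ (ρ.ρ g₀ * twistedSum ρ.ρ χ K) =
      ∑ g, if g₀⁻¹ * g ∈ K then ((χ g : ℂˣ) : ℂ) * ρ.character g else 0 := by
  rw [← Equiv.sum_comp (Equiv.mulLeft g₀), ← smul_eq_mul, ← map_smul, twistedSum, Finset.mul_sum,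
    Finset.smul_sum, map_sum]
  simp only [Equiv.coe_mulLeft, inv_mul_cancel_left]
  rw [← Finset.sum_filter, Finset.sum_subtype (p := fun g => g ∈ K) _ (by simp)]
  refine Finset.sum_congr rfl fun h _ => ?_
  rw [mul_smul_comm, smul_smul, map_smul, smul_eq_mul, ← map_mul, map_mul χ, Units.val_mul]
  rfl

open scoped Classical in
theorem compSum_subtype (π : G ≃* (V ≃ₗ[F] V)) (ρ : FDRep ℂ G) (χ : G →* ℂˣ)
    (W : Submodule F V) (g₀ : G) :
    compSum π (fun g => ((χ g : ℂˣ) : ℂ) * ρ.character g) W.subtype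
        ((π g₀).toLinearMap ∘ₗ W.subtype) =
      ((χ g₀ : ℂˣ) : ℂ) *
        LinearMap.trace ℂ _ (ρ.ρ g₀ * twistedSum ρ.ρ χ (fixingSubspace π W)) := by
  rw [trace_mul_twistedSum, compSum]
  refine Finset.sum_congr rfl fun g _ => if_congr ?_ rfl rfl
  rw [mem_fixingSubspace]
  have : ∀ w, π (g₀⁻¹ * g) w = w ↔ π g w = π g₀ w := fun w => by
    rw [map_mul, map_inv, LinearEquiv.mul_apply]
    exact LinearEquiv.symm_apply_eq _
  simp only [this]
  exact ⟨fun h w hw => h ⟨w, hw⟩, fun h x => h x x.2⟩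

open scoped Classical in
theorem compSum_conj {X Y : Type*} [AddCommGroup X] [Module F X] [AddCommGroup Y] [Module F Y]
    (π : G ≃* (V ≃ₗ[F] V)) (φ : G → ℂ) (hφ : ∀ g h, φ (h * g * h⁻¹) = φ g) (e : V ≃ₗ[F] V)
    (a b : X →ₗ[F] V) (a' b' : Y →ₗ[F] V) (s : X ≃ₗ[F] Y) (ha : ∀ x, e (a x) = a' (s x))
    (hb : ∀ x, e (b x) = b' (s x)) : compSum π φ a b = compSum π φ a' b' := by
  rw [compSum, compSum, ← Equiv.sum_comp (MulAut.conj (π.symm e)).toEquiv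
    (fun g => if ∀ x, π g (a' x) = b' x then φ g else 0)]
  refine Finset.sum_congr rfl fun g _ => ?_
  simp only [MulEquiv.toEquiv_eq_coe, EquivLike.coe_coe, MulAut.conj_apply, hφ]
  refine if_congr ?_ rfl rfl
  rw [← s.toEquiv.forall_congr_right]
  refine forall_congr' fun x => ?_
  have : (e⁻¹ : V ≃ₗ[F] V) (a' (s x)) = a x := by
    rw [← ha]; exact e.symm_apply_apply _
  rw [LinearEquiv.coe_toEquiv, map_mul, map_mul, map_inv, π.apply_symm_apply,
    LinearEquiv.mul_apply, LinearEquiv.mul_apply, this, ← hb, e.injective.eq_iff]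

theorem twistedChar_conj (ρ : FDRep ℂ G) (χ : G →* ℂˣ) (g h : G) :
    ((χ (h * g * h⁻¹) : ℂˣ) : ℂ) * ρ.character (h * g * h⁻¹) = ((χ g : ℂˣ) : ℂ) * ρ.character g := by
  rw [FDRep.char_conj, map_mul, map_mul, mul_comm (χ h), mul_assoc, ← map_mul, mul_inv_cancel,
    map_one, mul_one]

theorem trace_twistedSum_eq_of_finrank_eq [Module.Finite F V] (π : G ≃* (V ≃ₗ[F] V))
    (ρ : FDRep ℂ G) (χ : G →* ℂˣ) (W W' : Submodule F V)
    (h : Module.finrank F W = Module.finrank F W') :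
    LinearMap.trace ℂ _ (twistedSum ρ.ρ χ (fixingSubspace π W)) =
      LinearMap.trace ℂ _ (twistedSum ρ.ρ χ (fixingSubspace π W')) := by
  have h1 : ∀ W : Submodule F V, LinearMap.trace ℂ _ (twistedSum ρ.ρ χ (fixingSubspace π W)) =
      compSum π (fun g => ((χ g : ℂˣ) : ℂ) * ρ.character g) W.subtype W.subtype := by
    intro W
    have := compSum_subtype π ρ χ W 1
    simp only [map_one, one_mul, Units.val_one] at this
    rw [← this]
    rfl
  let s := LinearEquiv.ofFinrankEq W W' h
  obtain ⟨e, he⟩ := LinearMap.exists_equiv_comp_eq_of_ker_eq W.subtype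
    (W'.subtype ∘ₗ s.toLinearMap) (by
      rw [W.ker_subtype, eq_comm, LinearMap.ker_eq_bot]
      exact W'.subtype_injective.comp s.injective)
  rw [h1, h1]
  exact compSum_conj π _ (twistedChar_conj ρ χ) e _ _ _ _ s he he

/-- Similarity of endomorphisms as a setoid. -/
def similarSetoid (F X : Type) [Field F] [AddCommGroup X] [Module F X] : Setoid (X →ₗ[F] X) where
  r := IsSimilar
  iseqv :=
    { refl := fun _ => ⟨LinearEquiv.refl F X, fun _ => rfl⟩
      symm := fun {y z} ⟨e, he⟩ => ⟨e.symm, fun v => by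
        rw [LinearEquiv.symm_apply_eq, he, e.apply_symm_apply]⟩
      trans := fun {y z w} ⟨e, he⟩ ⟨f, hf⟩ => ⟨e.trans f, fun v => by
        rw [LinearEquiv.trans_apply, he, hf]; rfl⟩ }

theorem card_le_of_fixingSubspace [Fintype F] [Fintype V] (π : G ≃* (V ≃ₗ[F] V)) (χ : G →* ℂˣ)
    (k : ℕ) {ι : Type*} (ρ : ι → FDRep ℂ G) (hs : ∀ i, Simple (ρ i))
    (hρ : ∀ i j, Nonempty (ρ i ≅ ρ j) → i = j)
    (hN : ∀ i (W : Submodule F V), Module.finrank F W < k → twistedSum (ρ i).ρ χ (fixingSubspace π W) = 0)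
    (hW : ∀ i, ∃ W : Submodule F V, Module.finrank F W ≤ k ∧ twistedSum (ρ i).ρ χ (fixingSubspace π W) ≠ 0) :
    Finite ι ∧ Nat.card ι ≤ Fintype.card F ^ k +
      k * (Fintype.card F ^ (k - 1) * ((k + 1) ^ (k + 1)) ^ k) := by
  classical
  have : Module.Finite F V := Module.Finite.of_finite
  rcases isEmpty_or_nonempty ι with hι | ⟨⟨i₀⟩⟩
  · exact ⟨inferInstance, by simp⟩
  have hWk : ∀ i, ∃ W : Submodule F V, Module.finrank F W = k ∧
      twistedSum (ρ i).ρ χ (fixingSubspace π W) ≠ 0 := fun i => by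
    obtain ⟨W, h1, h2⟩ := hW i
    exact ⟨W, le_antisymm h1 (not_lt.mp fun h => h2 (hN i W h)), h2⟩
  obtain ⟨W₀, hW₀, -⟩ := hWk i₀
  let a := W₀.subtype
  have ha : Function.Injective a := W₀.subtype_injective
  let E : ∀ i, ρ i →ₗ[ℂ] ρ i := fun i => twistedSum (ρ i).ρ χ (fixingSubspace π W₀)
  have hE : ∀ i, LinearMap.trace ℂ _ (E i) ≠ 0 := fun i => by
    obtain ⟨W, h1, h2⟩ := hWk i
    obtain ⟨r, hr, hr0⟩ := exists_trace_twistedSum (ρ i).ρ χ (fixingSubspace π W)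
    rw [trace_twistedSum_eq_of_finrank_eq π (ρ i) χ W₀ W (hW₀.trans h1.symm), hr]
    exact Nat.cast_ne_zero.mpr fun h => h2 (hr0.mp h)
  let φ : ι → G → ℂ := fun i g => ((χ g : ℂˣ) : ℂ) * (ρ i).character g
  let θ : ι → (W₀ →ₗ[F] W₀) → ℂ := fun i y => compSum π (φ i) a (a ∘ₗ y)
  have hθ : ∀ i y z, IsSimilar y z → θ i y = θ i z := by
    rintro i y z ⟨s, hs⟩
    obtain ⟨e, he⟩ := LinearMap.exists_equiv_comp_eq_of_ker_eq a (a ∘ₗ s.toLinearMap) (by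
      rw [LinearMap.ker_eq_bot.mpr ha, eq_comm, LinearMap.ker_eq_bot]
      exact ha.comp s.injective)
    refine compSum_conj π _ (twistedChar_conj (ρ i) χ) e a _ a _ s he fun x => ?_
    rw [LinearMap.comp_apply, he, LinearMap.comp_apply, LinearMap.comp_apply]
    exact congrArg a (hs x)
  let T := Quotient (similarSetoid F W₀)
  have : Finite (W₀ →ₗ[F] W₀) := Finite.of_injective _ DFunLike.coe_injective
  let _ : Fintype T := Fintype.ofFinite T
  let Θ : ι → T → ℂ := fun i t => θ i t.out
  have hΘ : ∀ i y, Θ i (Quotient.mk _ y) = θ i y := fun i y =>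
    hθ i _ _ (Quotient.mk_out (s := similarSetoid F W₀) y)
  have hli : LinearIndependent ℂ Θ := by
    rw [linearIndependent_iff']
    intro s c hc
    have hlt := linearIndependent_iff'.mp (FDRep.linearIndependent_trace ρ hs hρ E hE χ) s c
    refine hlt ?_
    let ψ : G → ℂ := fun g => ∑ i ∈ s, c i * φ i g
    have hψ : ∀ {X : Type} [AddCommGroup X] [Module F X] (a b : X →ₗ[F] V),
        compSum π ψ a b = ∑ i ∈ s, c i * compSum π (φ i) a b := by
      intro X _ _ a b
      simp only [compSum, Finset.mul_sum]
      rw [Finset.sum_comm]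
      refine Finset.sum_congr rfl fun g _ => ?_
      split_ifs <;> simp [ψ]
    have hfin := compSum_eq_zero π a ha ψ
      (fun g h => Finset.sum_congr rfl fun i _ => by simp only [φ, twistedChar_conj])
      (fun W hW g₀ => by
        rw [hψ]
        refine Finset.sum_eq_zero fun i _ => ?_
        rw [compSum_subtype, hN i W (hW.trans_eq hW₀), mul_zero, map_zero, mul_zero, mul_zero])
      (fun y _ => by
        have := congrFun hc (Quotient.mk _ y)
        simp only [Finset.sum_apply, Pi.smul_apply, hΘ, smul_eq_mul, Pi.zero_apply] at this
        rw [hψ]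
        exact this)
    funext g₀
    have h0 := hfin ((π g₀).toLinearMap ∘ₗ a)
    rw [hψ] at h0
    simp only [Finset.sum_apply, Pi.smul_apply, smul_eq_mul, Pi.zero_apply]
    rw [← h0]
    refine Finset.sum_congr rfl fun i _ => ?_
    rw [compSum_subtype]
  have hfin : Finite ι := hli.finite
  refine ⟨hfin, ?_⟩
  let _ : Fintype ι := Fintype.ofFinite ι
  have h1 := hli.fintype_card_le_finrank
  rw [Module.finrank_fintype_fun_eq_card] at h1
  rw [Nat.card_eq_fintype_card]
  exact h1.trans (card_le_of_pairwise_not_isSimilar (fun t : T => t.out)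
    (fun t u h => by
      rw [← Quotient.out_eq t, ← Quotient.out_eq u]
      exact Quotient.sound h) k hW₀)

end FixingSubgroup

section Omega

set_option linter.unusedSectionVars false

variable {F : Type} [Field F] {n : ℕ}

/-- Invertible matrices act on column vectors by linear equivalences. -/
noncomputable def glEquiv (n : ℕ) (F : Type) [Field F] :
    GL (Fin n) F ≃* ((Fin n → F) ≃ₗ[F] (Fin n → F)) :=
  Matrix.GeneralLinearGroup.toLin.trans (LinearMap.GeneralLinearGroup.generalLinearEquiv _ _)

theorem glEquiv_apply (g : GL (Fin n) F) (v : Fin n → F) :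
    glEquiv n F g v = (g : Matrix (Fin n) (Fin n) F) *ᵥ v := rfl

/-- The span of the columns of a matrix. -/
def colSpan {ℓ : ℕ} (m : Matrix (Fin n) (Fin ℓ) F) : Submodule F (Fin n → F) :=
  Submodule.span F (Set.range m.col)

theorem mem_fixingSubspace_colSpan {ℓ : ℕ} (m : Matrix (Fin n) (Fin ℓ) F) (g : GL (Fin n) F) :
    g ∈ fixingSubspace (glEquiv n F) (colSpan m) ↔ (g : Matrix (Fin n) (Fin n) F) * m = m := by
  have hcol : ∀ j, (g : Matrix (Fin n) (Fin n) F) *ᵥ m.col j =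
      ((g : Matrix (Fin n) (Fin n) F) * m).col j := fun j => by
    ext i; rfl
  constructor
  · intro h
    ext i j
    have := h (m.col j) (Submodule.subset_span ⟨j, rfl⟩)
    rw [glEquiv_apply, hcol] at this
    exact congrFun this i
  · intro h w hw
    induction hw using Submodule.span_induction with
    | mem x hx =>
      obtain ⟨j, rfl⟩ := hx
      rw [glEquiv_apply, hcol, h]
    | zero => rw [map_zero]
    | add x y _ _ hx hy => rw [map_add, hx, hy]
    | smul a x _ hx => rw [map_smul, hx]

theorem finrank_colSpan_le {ℓ : ℕ} (m : Matrix (Fin n) (Fin ℓ) F) :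
    Module.finrank F (colSpan m) ≤ ℓ :=
  (finrank_range_le_card m.col).trans_eq (Fintype.card_fin ℓ)

theorem exists_colSpan_eq {ℓ : ℕ} (W : Submodule F (Fin n → F)) (hW : Module.finrank F W ≤ ℓ) :
    ∃ m : Matrix (Fin n) (Fin ℓ) F, colSpan m = W := by
  let b := Module.finBasis F W
  refine ⟨Matrix.of fun i j => if h : (j : ℕ) < Module.finrank F W then (b ⟨j, h⟩ : Fin n → F) i
    else 0, le_antisymm ?_ ?_⟩
  · rw [colSpan, Submodule.span_le]
    rintro _ ⟨j, rfl⟩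
    by_cases h : (j : ℕ) < Module.finrank F W
    · exact (congrArg (· ∈ W) (funext fun i => by simp [Matrix.col, h])).mpr (b ⟨j, h⟩).2
    · exact (congrArg (· ∈ W) (funext fun i => by simp [Matrix.col, h])).mpr W.zero_mem
  · intro w hw
    have h1 : (⟨w, hw⟩ : W) ∈ Submodule.span F (Set.range b) := by
      rw [b.span_eq]; exact Submodule.mem_top
    have h2 := Submodule.mem_map_of_mem (f := W.subtype) h1
    rw [Submodule.map_span, ← Set.range_comp] at h2
    refine Submodule.span_mono ?_ h2
    rintro _ ⟨j, rfl⟩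
    refine ⟨⟨j, j.2.trans_le hW⟩, ?_⟩
    ext i
    simp [Matrix.col]

variable [Fintype F]

theorem fixedCount_inv (g : GL (Fin n) F) (ℓ : ℕ) : fixedCount n F g⁻¹ ℓ = fixedCount n F g ℓ := by
  refine Nat.card_congr (Equiv.subtypeEquivRight fun m => ?_)
  rw [← mem_fixingSubspace_colSpan, ← mem_fixingSubspace_colSpan, inv_mem_iff]

theorem twistAppearsInOmega_iff [Fintype (GL (Fin n) F)] (ρ : FDRep ℂ (GL (Fin n) F)) (ℓ : ℕ) :
    TwistAppearsInOmega n F ρ ℓ ↔ ∃ (χ : GL (Fin n) F →* ℂˣ) (W : Submodule F (Fin n → F)),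
      Module.finrank F W ≤ ℓ ∧
        twistedSum ρ.ρ χ (fixingSubspace (glEquiv n F) W) ≠ 0 := by
  classical
  refine exists_congr fun χ => ?_
  rw [Subsingleton.elim (Fintype.ofFinite (GL (Fin n) F)) ‹_›]
  have h1 : ∑ g : GL (Fin n) F,
        ((χ g⁻¹ : ℂˣ) : ℂ) * ρ.character g⁻¹ * (fixedCount n F g ℓ : ℂ) =
      ∑ m : Matrix (Fin n) (Fin ℓ) F, LinearMap.trace ℂ _
        (twistedSum ρ.ρ χ (fixingSubspace (glEquiv n F) (colSpan m))) := by
    rw [← Equiv.sum_comp (Equiv.inv _)]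
    have h2 : ∀ m : Matrix (Fin n) (Fin ℓ) F, LinearMap.trace ℂ _
        (twistedSum ρ.ρ χ (fixingSubspace (glEquiv n F) (colSpan m))) =
        ∑ g : GL (Fin n) F, if (g : Matrix (Fin n) (Fin n) F) * m = m then
          ((χ g : ℂˣ) : ℂ) * ρ.character g else 0 := by
      intro m
      have := trace_mul_twistedSum ρ χ (fixingSubspace (glEquiv n F) (colSpan m)) 1
      simp only [map_one, one_mul, Units.val_one, inv_one] at this
      rw [this]
      exact Finset.sum_congr rfl fun g _ =>
        if_congr (mem_fixingSubspace_colSpan m g) rfl rfl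
    simp only [h2]
    rw [Finset.sum_comm]
    refine Finset.sum_congr rfl fun g _ => ?_
    rw [Equiv.inv_apply, inv_inv, fixedCount_inv, ← Finset.sum_filter, Finset.sum_const,
      nsmul_eq_mul, mul_comm, fixedCount, Nat.card_eq_fintype_card, Fintype.card_subtype]
  rw [h1, Ne, mul_eq_zero, not_or]
  choose r hr hr0 using fun m : Matrix (Fin n) (Fin ℓ) F =>
    exists_trace_twistedSum ρ.ρ χ (fixingSubspace (glEquiv n F) (colSpan m))
  simp only [hr]
  rw [← Nat.cast_sum, Nat.cast_eq_zero, Finset.sum_eq_zero_iff]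
  simp only [Finset.mem_univ, true_imp_iff, hr0, not_forall]
  have hcard : ((Nat.card (GL (Fin n) F) : ℂ))⁻¹ ≠ 0 :=
    inv_ne_zero (Nat.cast_ne_zero.mpr Nat.card_pos.ne')
  constructor
  · rintro ⟨-, m, hm⟩
    exact ⟨_, finrank_colSpan_le m, hm⟩
  · rintro ⟨W, hW, h⟩
    obtain ⟨m, rfl⟩ := exists_colSpan_eq W hW
    exact ⟨hcard, m, h⟩

end Omega

section UpperBound

variable {n : ℕ} {F : Type} [Field F] [Fintype F]

/-- Isomorphism of irreducible representations of tensor rank `k`. -/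
abbrev tensorRankSetoid (n : ℕ) (F : Type) [Field F] [Fintype F] (k : ℕ) :
    Setoid {ρ : FDRep ℂ (GL (Fin n) F) // Simple ρ ∧ HasTensorRank n F ρ k} :=
  Setoid.mk (fun ρ σ => Nonempty (ρ.1 ≅ σ.1))
    ⟨fun _ => ⟨Iso.refl _⟩,
     fun h => h.elim fun i => ⟨i.symm⟩,
     fun h h' => h.elim fun i => h'.elim fun j => ⟨i.trans j⟩⟩

theorem card_tensorRankSetoid_le (hn : 0 < n) (hF : 3 ≤ Fintype.card F) (k : ℕ) :
    Finite (Quotient (tensorRankSetoid n F k)) ∧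
      Nat.card (Quotient (tensorRankSetoid n F k)) ≤ (Fintype.card F - 1) *
        (Fintype.card F ^ k + k * (Fintype.card F ^ (k - 1) * ((k + 1) ^ (k + 1)) ^ k)) := by
  have : Nonempty (Fin n) := ⟨⟨0, hn⟩⟩
  obtain ⟨hfin, hcard⟩ := Matrix.GeneralLinearGroup.card_monoidHom_le (m := Fin n) hF
  let _ : Fintype (GL (Fin n) F) := Fintype.ofFinite _
  let _ : Fintype (GL (Fin n) F →* ℂˣ) := Fintype.ofFinite _
  choose χ hχ using fun c : Quotient (tensorRankSetoid n F k) =>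
    (twistAppearsInOmega_iff c.out.1 k).mp c.out.2.2.1
  have hfib : ∀ η : GL (Fin n) F →* ℂˣ, Finite {c // χ c = η} ∧ Nat.card {c // χ c = η} ≤
      Fintype.card F ^ k + k * (Fintype.card F ^ (k - 1) * ((k + 1) ^ (k + 1)) ^ k) := by
    intro η
    refine card_le_of_fixingSubspace (glEquiv n F) η k (fun c => c.1.out.1)
      (fun c => c.1.out.2.1) ?_ ?_ ?_
    · intro c d h
      refine Subtype.ext ?_
      rw [← Quotient.out_eq c.1, ← Quotient.out_eq d.1]
      exact Quotient.sound h
    · intro c W hW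
      by_contra h
      exact c.1.out.2.2.2 _ hW ((twistAppearsInOmega_iff c.1.out.1 _).mpr ⟨η, W, le_rfl, h⟩)
    · rintro ⟨c, rfl⟩
      exact hχ c
  have := fun η => (hfib η).1
  have e := Equiv.sigmaFiberEquiv χ
  refine ⟨Finite.of_equiv _ e, ?_⟩
  rw [← Nat.card_congr e, Nat.card_sigma]
  refine (Finset.sum_le_sum fun η _ => (hfib η).2).trans ?_
  rw [Finset.sum_const, smul_eq_mul, Finset.card_univ, ← Nat.card_eq_fintype_card]
  exact Nat.mul_le_mul_right _ hcard

end UpperBound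

section LowerBound

theorem CommGroup.sum_monoidHom_eq_zero {A : Type} [CommGroup A] [Finite A]
    [Fintype (A →* ℂˣ)] {a : A} (ha : a ≠ 1) : ∑ χ : A →* ℂˣ, ((χ a : ℂˣ) : ℂ) = 0 := by
  obtain ⟨ψ, hψ⟩ := CommGroup.exists_apply_ne_one_of_hasEnoughRootsOfUnity A ℂ ha
  have h : ((ψ a : ℂˣ) : ℂ) * ∑ χ : A →* ℂˣ, ((χ a : ℂˣ) : ℂ) =
      ∑ χ : A →* ℂˣ, ((χ a : ℂˣ) : ℂ) := by
    rw [Finset.mul_sum]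
    refine Fintype.sum_equiv (Equiv.mulLeft ψ) _ _ fun χ => ?_
    simp
  have h1 : ((ψ a : ℂˣ) : ℂ) - 1 ≠ 0 := sub_ne_zero.mpr fun h => hψ (Units.ext h)
  refine (mul_eq_zero.mp (?_ : (((ψ a : ℂˣ) : ℂ) - 1) * _ = 0)).resolve_left h1
  rw [sub_mul, one_mul, h, sub_self]

theorem exists_twistedSum_ne_zero {G A V : Type} [Group G] [Fintype G] [CommGroup A] [Finite A]
    [AddCommGroup V] [Module ℂ V] (ρ : Representation ℂ G V) (δ : G →* A) (H : Subgroup G)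
    (h : twistedSum ρ 1 (H ⊓ δ.ker) ≠ 0) : ∃ χ : G →* ℂˣ, twistedSum ρ χ H ≠ 0 := by
  classical
  by_contra! h0
  have hc := CommGroup.card_monoidHom_of_hasEnoughRootsOfUnity A ℂ
  have : Finite (A →* ℂˣ) := Nat.finite_of_card_ne_zero (by rw [hc]; exact Nat.card_pos.ne')
  let _ : Fintype (A →* ℂˣ) := Fintype.ofFinite _
  have h1 : ∑ χ : A →* ℂˣ, twistedSum ρ (χ.comp δ) H =
      (Fintype.card (A →* ℂˣ) : ℂ) • twistedSum ρ 1 (H ⊓ δ.ker) := by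
    simp only [twistedSum]
    rw [Finset.sum_comm]
    simp only [← Finset.sum_smul]
    rw [← Finset.sum_subtype (Finset.univ.filter (· ∈ H)) (by simp)
        (fun g => (∑ χ : A →* ℂˣ, (((χ.comp δ) g : ℂˣ) : ℂ)) • ρ g),
      ← Finset.sum_subtype (Finset.univ.filter (· ∈ H ⊓ δ.ker)) (by simp)
        (fun g => (((1 : G →* ℂˣ) g : ℂˣ) : ℂ) • ρ g), Finset.smul_sum,
      Finset.sum_filter, Finset.sum_filter]
    refine Finset.sum_congr rfl fun g _ => ?_
    by_cases hg : g ∈ H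
    · by_cases hd : δ g = 1
      · simp [hg, hd, MonoidHom.mem_ker, Subgroup.mem_inf]
      · simp [hg, hd, MonoidHom.mem_ker, Subgroup.mem_inf, CommGroup.sum_monoidHom_eq_zero hd]
    · simp [hg, Subgroup.mem_inf]
  rw [Finset.sum_eq_zero fun χ _ => h0 _] at h1
  exact (smul_ne_zero (Nat.cast_ne_zero.mpr Fintype.card_ne_zero) h) h1.symm

theorem card_le_sum_tensorRankIsoClasses {n : ℕ} {F : Type} [Field F] [Fintype F] (hn : 0 < n)
    (hF : 3 ≤ Fintype.card F) (k : ℕ) (W : Submodule F (Fin n → F))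
    (hW : Module.finrank F W ≤ k) {T : Type} [Fintype T] (x : T → GL (Fin n) F)
    (hx : ∀ s t, ∀ h ∈ fixingSubspace (glEquiv n F) W ⊓ Matrix.GeneralLinearGroup.det.ker,
      IsConj (x s) (x t * h) → s = t) :
    Fintype.card T ≤ ∑ j : Fin (k + 1), tensorRankIsoClasses n F j := by
  let _ : Fintype (GL (Fin n) F) := Fintype.ofFinite _
  have := fun j : Fin (k + 1) => (card_tensorRankSetoid_le hn hF j).1
  let J := Σ j : Fin (k + 1), Quotient (tensorRankSetoid n F j)
  let e : J ≃ Fin (Nat.card J) := Finite.equivFin J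
  have h := card_le_card_of_conj_separated _ x hx (fun i => (e.symm i).2.out.1) fun V hV h => by
    classical
    obtain ⟨χ, hχ⟩ := exists_twistedSum_ne_zero V.ρ _ _ h
    have hk := (twistAppearsInOmega_iff V k).mpr ⟨χ, W, hW, hχ⟩
    have hex : ∃ ℓ, TwistAppearsInOmega n F V ℓ := ⟨k, hk⟩
    let j : Fin (k + 1) := ⟨Nat.find hex, Nat.lt_succ_of_le (Nat.find_min' hex hk)⟩
    let V' : {ρ : FDRep ℂ (GL (Fin n) F) // Simple ρ ∧ HasTensorRank n F ρ j} :=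
      ⟨V, hV, Nat.find_spec hex, fun ℓ hℓ => Nat.find_min hex hℓ⟩
    refine ⟨e ⟨j, Quotient.mk _ V'⟩, ?_⟩
    rw [e.symm_apply_apply]
    exact (Quotient.mk_out (s := tensorRankSetoid n F j) V').map Iso.symm
  rwa [Fintype.card_fin, Nat.card_sigma] at h

end LowerBound

section Polynomials

open Polynomial

variable {F : Type} [Field F]

theorem Matrix.exists_charpoly_eq {k : ℕ} {f : F[X]} (hf : f.Monic) (hk : f.natDegree = k) :
    ∃ A : Matrix (Fin k) (Fin k) F, A.charpoly = f := by
  subst hk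
  exact ⟨Algebra.leftMulMatrix (AdjoinRoot.powerBasis hf.ne_zero).basis
    (AdjoinRoot.powerBasis hf.ne_zero).gen, by
      exact (charpoly_leftMulMatrix _).trans (AdjoinRoot.minpoly_powerBasis_gen_of_monic hf)⟩

theorem Polynomial.exists_quadratic_irreducible [Fintype F] (d : Fˣ) :
    ∃ s : F, (X ^ 2 - C s * X + C (d : F)).Monic ∧
      (X ^ 2 - C s * X + C (d : F)).natDegree = 2 ∧
      Irreducible (X ^ 2 - C s * X + C (d : F)) := by
  have hns : ¬ Function.Surjective fun r : Fˣ => (r : F) + (d : F) / r := fun h => by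
    have h1 := Nat.card_le_card_of_surjective _ h
    rw [Nat.card_units] at h1
    have : 0 < Nat.card F := Nat.card_pos
    omega
  obtain ⟨s, hs⟩ := not_forall.mp hns
  have hq : X ^ 2 - C s * X + C (d : F) = C 1 * X ^ 2 + C (-s) * X + C (d : F) := by
    simp [sub_eq_add_neg]
  have hdeg : (X ^ 2 - C s * X + C (d : F)).natDegree = 2 := by
    rw [hq, natDegree_quadratic one_ne_zero]
  refine ⟨s, ?_, hdeg, ?_⟩
  · rw [Monic, hq, leadingCoeff_quadratic one_ne_zero]
  · refine irreducible_of_degree_le_three_of_not_isRoot (by rw [hdeg]; decide) fun r hr => hs ?_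
    simp only [IsRoot, eval_add, eval_sub, eval_pow, eval_X, eval_mul, eval_C] at hr
    have hr0 : r ≠ 0 := by
      rintro rfl
      simp at hr
    refine ⟨Units.mk0 r hr0, ?_⟩
    change r + d / r = s
    field_simp
    linear_combination hr

theorem Polynomial.natDegree_X_pow_add_degreeLT {k : ℕ} (r : degreeLT F k) :
    (X ^ k + (r : F[X])).natDegree = k := by
  refine natDegree_eq_of_degree_eq_some ?_
  rw [degree_add_eq_left_of_degree_lt, degree_X_pow]
  rw [degree_X_pow]
  exact mem_degreeLT.mp r.2

theorem Polynomial.card_dvd_mul_le [Fintype F] (k : ℕ) {p : F[X]} (hp : p.Monic) :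
    Nat.card {r : degreeLT F k // p ∣ X ^ k + (r : F[X])} * Fintype.card F ^ p.natDegree ≤
      Fintype.card F ^ k := by
  have hfin : ∀ j, Finite (degreeLT F j) := fun j =>
    Finite.of_equiv _ (degreeLTEquiv F j).toEquiv.symm
  have hcard : ∀ j, Nat.card (degreeLT F j) = Fintype.card F ^ j := fun j => by
    rw [Nat.card_congr (degreeLTEquiv F j).toEquiv]
    simp
  rw [← hcard p.natDegree, ← hcard k, ← Nat.card_prod]
  rcases le_or_gt p.natDegree k with hle | hlt
  · refine Nat.card_le_card_of_injective
      (fun rs => rs.1.1 + Submodule.inclusion (degreeLT_mono hle) rs.2) ?_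
    rintro ⟨⟨r, hr⟩, s⟩ ⟨⟨r', hr'⟩, s'⟩ h
    have h' : (r : F[X]) + s = r' + s' := congrArg Subtype.val h
    have hd : p ∣ (s' : F[X]) - s := by
      have := dvd_sub hr hr'
      rwa [show X ^ k + (r : F[X]) - (X ^ k + (r' : F[X])) = (s' : F[X]) - (s : F[X]) by
        linear_combination h'] at this
    have hs : (s' : F[X]) - s = 0 := by
      refine eq_zero_of_dvd_of_degree_lt hd ?_
      rw [degree_eq_natDegree hp.ne_zero]
      exact mem_degreeLT.mp ((degreeLT F p.natDegree).sub_mem s'.2 s.2)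
    have hs' : s = s' := Subtype.ext (sub_eq_zero.mp hs).symm
    subst hs'
    have : r = r' := Subtype.ext (add_right_cancel h')
    subst this
    rfl
  · have : IsEmpty {r : degreeLT F k // p ∣ X ^ k + (r : F[X])} := ⟨fun ⟨r, hr⟩ => by
      have hm := monic_X_pow_add (mem_degreeLT.mp r.2)
      have h1 := natDegree_le_of_dvd hr hm.ne_zero
      rw [natDegree_X_pow_add_degreeLT] at h1
      omega⟩
    simp

theorem Polynomial.card_not_dvd [Fintype F] (k : ℕ) {ι : Type} [Fintype ι]
    (hι : Fintype.card ι ≤ Fintype.card F) {Q : ι → F[X]} (hQ : ∀ i, (Q i).Monic)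
    (hQ2 : ∀ i, (Q i).natDegree = 2) :
    Fintype.card F * Fintype.card F ^ k ≤
      Fintype.card F * Nat.card {r : degreeLT F k // ¬ X ∣ X ^ k + (r : F[X]) ∧
        ¬ (X - C 1) ∣ X ^ k + (r : F[X]) ∧ ∀ i, ¬ Q i ∣ X ^ k + (r : F[X])} +
      3 * Fintype.card F ^ k := by
  classical
  have : Finite (degreeLT F k) := Finite.of_equiv _ (degreeLTEquiv F k).toEquiv.symm
  let _ : Fintype (degreeLT F k) := Fintype.ofFinite _
  have hcard : Fintype.card (degreeLT F k) = Fintype.card F ^ k := by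
    rw [Fintype.card_congr (degreeLTEquiv F k).toEquiv]
    simp
  let D : F[X] → Finset (degreeLT F k) := fun p => Finset.univ.filter fun r => p ∣ X ^ k + (r : F[X])
  have hD : ∀ {p : F[X]}, p.Monic →
      (D p).card * Fintype.card F ^ p.natDegree ≤ Fintype.card F ^ k := fun hp => by
    have := card_dvd_mul_le k hp
    rwa [Nat.card_eq_fintype_card, Fintype.card_subtype] at this
  have h1 := hD (monic_X (R := F))
  have h2 := hD (monic_X_sub_C (1 : F))
  have h3 := fun i => hD (hQ i)
  simp only [natDegree_X, natDegree_X_sub_C, hQ2, pow_one] at h1 h2 h3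
  set q := Fintype.card F with hq
  have h4 : (Finset.univ.biUnion fun i => D (Q i)).card * q ≤ q ^ k := by
    have hq0 : 0 < q := Fintype.card_pos
    refine Nat.le_of_mul_le_mul_right (?_ : _ * q ≤ _ * q) hq0
    calc (Finset.univ.biUnion fun i => D (Q i)).card * q * q
        ≤ (∑ i, (D (Q i)).card) * q * q := by gcongr; exact Finset.card_biUnion_le
      _ = ∑ i, (D (Q i)).card * q ^ 2 := by rw [mul_assoc, Finset.sum_mul, sq]
      _ ≤ ∑ i : ι, q ^ k := Finset.sum_le_sum fun i _ => h3 i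
      _ = Fintype.card ι * q ^ k := by rw [Finset.sum_const, smul_eq_mul, Finset.card_univ]
      _ ≤ q ^ k * q := by rw [mul_comm]; gcongr
  rw [Nat.card_eq_fintype_card, Fintype.card_subtype, ← hcard]
  set good := Finset.univ.filter fun r : degreeLT F k => ¬ X ∣ X ^ k + (r : F[X]) ∧
        ¬ (X - C 1) ∣ X ^ k + (r : F[X]) ∧ ∀ i, ¬ Q i ∣ X ^ k + (r : F[X])
  have hcov : (Finset.univ : Finset (degreeLT F k)) ⊆
      good ∪ (D X ∪ (D (X - C 1) ∪ Finset.univ.biUnion fun i => D (Q i))) := by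
    intro r _
    by_contra h
    simp only [good, D, Finset.mem_union, Finset.mem_filter, Finset.mem_univ, true_and,
      Finset.mem_biUnion, not_or, not_exists] at h
    exact h.1 h.2
  have h5 := (Finset.card_le_card hcov).trans (Finset.card_union_le _ _)
  have h6 := Finset.card_union_le (D X) (D (X - C 1) ∪ Finset.univ.biUnion fun i => D (Q i))
  have h7 := Finset.card_union_le (D (X - C 1)) (Finset.univ.biUnion fun i => D (Q i))
  rw [Finset.card_univ] at h5
  rw [hcard] at h5 ⊢
  nlinarith [Nat.mul_le_mul_left q h5, Nat.mul_le_mul_left q h6, Nat.mul_le_mul_left q h7]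

end Polynomials

section Separation

open Polynomial

variable {F : Type} [Field F]

/-- The span of the first `k` standard basis vectors. -/
def firstCoordinates (F : Type) [Field F] (k l : ℕ) : Submodule F (Fin (k + l) → F) :=
  Submodule.span F (Set.range fun i : Fin k => Pi.single (Fin.castAdd l i) 1)

theorem finrank_firstCoordinates_le (k l : ℕ) :
    Module.finrank F (firstCoordinates F k l) ≤ k :=
  (finrank_range_le_card _).trans_eq (Fintype.card_fin k)

/-- The block diagonal matrix with the given diagonal blocks. -/
def diagBlocks (k l : ℕ) (A : Matrix (Fin k) (Fin k) F) (D : Matrix (Fin l) (Fin l) F) :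
    Matrix (Fin (k + l)) (Fin (k + l)) F :=
  reindex finSumFinEquiv finSumFinEquiv (fromBlocks A 0 0 D)

theorem det_diagBlocks {k l : ℕ} (A : Matrix (Fin k) (Fin k) F) (D : Matrix (Fin l) (Fin l) F) :
    (diagBlocks k l A D).det = A.det * D.det := by
  rw [diagBlocks, det_reindex_self, det_fromBlocks_zero₂₁]

theorem charpoly_diagBlocks {k l : ℕ} (A : Matrix (Fin k) (Fin k) F)
    (D : Matrix (Fin l) (Fin l) F) :
    (diagBlocks k l A D).charpoly = A.charpoly * D.charpoly := by
  rw [diagBlocks, charpoly_reindex, charpoly_fromBlocks_zero₂₁]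

theorem charpoly_dvd_charpoly_diagBlocks_mul {k l : ℕ} (A : Matrix (Fin k) (Fin k) F)
    (D : Matrix (Fin l) (Fin l) F) {h : GL (Fin (k + l)) F}
    (hh : h ∈ fixingSubspace (glEquiv (k + l) F) (firstCoordinates F k l)) :
    A.charpoly ∣ (diagBlocks k l A D * (h : Matrix (Fin (k + l)) (Fin (k + l)) F)).charpoly := by
  let e := finSumFinEquiv (m := k) (n := l)
  let H := reindex e.symm e.symm (h : Matrix (Fin (k + l)) (Fin (k + l)) F)
  have hcol : ∀ (i : Fin (k + l)) (j : Fin k),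
      (h : Matrix (Fin (k + l)) (Fin (k + l)) F) i (Fin.castAdd l j) =
        (Pi.single (Fin.castAdd l j) 1 : Fin (k + l) → F) i := fun i j => by
    have := hh _ (Submodule.subset_span ⟨j, rfl⟩)
    rw [glEquiv_apply, mulVec_single_one] at this
    exact congrFun this i
  have h11 : H.toBlocks₁₁ = 1 := by
    ext i j
    change (h : Matrix (Fin (k + l)) (Fin (k + l)) F) (Fin.castAdd l i) (Fin.castAdd l j) = _
    rw [hcol, Pi.single_apply, one_apply]
    simp
  have h21 : H.toBlocks₂₁ = 0 := by
    ext i j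
    change (h : Matrix (Fin (k + l)) (Fin (k + l)) F) (Fin.natAdd k i) (Fin.castAdd l j) = _
    rw [hcol, Pi.single_apply, if_neg, Matrix.zero_apply]
    intro h
    have := congrArg Fin.val h
    simp only [Fin.val_natAdd, Fin.val_castAdd] at this
    omega
  have hH : H = fromBlocks 1 H.toBlocks₁₂ 0 H.toBlocks₂₂ := by
    rw [← h11, ← h21, fromBlocks_toBlocks]
  have hh : (h : Matrix (Fin (k + l)) (Fin (k + l)) F) = reindex e e H := by
    ext i j; simp [H]
  rw [hh, diagBlocks, reindex_apply, reindex_apply, submatrix_mul_equiv, ← reindex_apply,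
    charpoly_reindex, hH, fromBlocks_multiply]
  simp only [Matrix.mul_one, Matrix.mul_zero, Matrix.zero_mul, add_zero, zero_add]
  rw [charpoly_fromBlocks_zero₂₁]
  exact dvd_mul_right _ _

theorem charpoly_eq_of_isConj {N : ℕ} {g h : GL (Fin N) F} (hgh : IsConj g h) :
    (g : Matrix (Fin N) (Fin N) F).charpoly = (h : Matrix (Fin N) (Fin N) F).charpoly := by
  obtain ⟨c, rfl⟩ := isConj_iff.mp hgh
  rw [Units.val_mul, Units.val_mul, Matrix.coe_units_inv]
  exact (Matrix.charpoly_units_conj c _).symm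

theorem exists_le_sum_tensorRankIsoClasses [Fintype F] (k m : ℕ) (hF : 3 ≤ Fintype.card F) :
    ∃ g : ℕ, Fintype.card F * Fintype.card F ^ k ≤ Fintype.card F * g + 3 * Fintype.card F ^ k ∧
      g * (Fintype.card F - 1) ≤ ∑ j : Fin (k + 1), tensorRankIsoClasses (k + (m + 2)) F j := by
  classical
  choose s hsm hsd hsi using fun d : Fˣ => exists_quadratic_irreducible d
  let Q : Fˣ → F[X] := fun d => X ^ 2 - C (s d) * X + C (d : F)
  have hcard : Fintype.card Fˣ = Fintype.card F - 1 := Fintype.card_units F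
  refine ⟨_, card_not_dvd k (by omega) hsm hsd, ?_⟩
  let R := {r : degreeLT F k // ¬ X ∣ X ^ k + (r : F[X]) ∧
        ¬ (X - C 1) ∣ X ^ k + (r : F[X]) ∧ ∀ d, ¬ Q d ∣ X ^ k + (r : F[X])}
  have : Finite (degreeLT F k) := Finite.of_equiv _ (degreeLTEquiv F k).toEquiv.symm
  let _ : Fintype R := Fintype.ofFinite _
  choose A hA using fun r : R => exists_charpoly_eq (monic_X_pow_add (mem_degreeLT.mp r.1.2))
    (natDegree_X_pow_add_degreeLT r.1)
  have hhm : ∀ d, ((X - C 1) ^ m * Q d).Monic := fun d => ((monic_X_sub_C 1).pow m).mul (hsm d)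
  have hhd : ∀ d, ((X - C 1) ^ m * Q d).natDegree = m + 2 := fun d => by
    rw [((monic_X_sub_C 1).pow m).natDegree_mul (hsm d), hsd d, natDegree_pow, natDegree_X_sub_C,
      mul_one]
  choose D hD using fun d : Fˣ => exists_charpoly_eq (hhm d) (hhd d)
  have hDdet : ∀ d, (D d).det = d := fun d => by
    rw [det_eq_sign_charpoly_coeff, hD, coeff_zero_eq_eval_zero, Fintype.card_fin]
    simp only [eval_mul, eval_pow, eval_sub, eval_X, eval_C, eval_add, Q]
    rw [zero_sub, ← mul_assoc, ← pow_add, show m + 2 + m = 2 * (m + 1) by ring, pow_mul]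
    simp
  have hAdet : ∀ r, (A r).det ≠ 0 := fun r h => by
    rw [det_eq_sign_charpoly_coeff, hA, mul_eq_zero] at h
    exact r.2.1 (X_dvd_iff.mpr (h.resolve_left (pow_ne_zero _ (neg_ne_zero.mpr one_ne_zero))))
  have hdet : ∀ t : R × Fˣ, (diagBlocks k (m + 2) (A t.1) (D t.2)).det ≠ 0 := fun t => by
    rw [det_diagBlocks, hDdet]
    exact mul_ne_zero (hAdet _) t.2.ne_zero
  let x : R × Fˣ → GL (Fin (k + (m + 2))) F := fun t =>
    GeneralLinearGroup.mkOfDetNeZero _ (hdet t)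
  have hx : ∀ t, (x t : Matrix (Fin (k + (m + 2))) (Fin (k + (m + 2))) F) =
      diagBlocks k (m + 2) (A t.1) (D t.2) := fun t => rfl
  have h := card_le_sum_tensorRankIsoClasses (by omega) hF k (firstCoordinates F k (m + 2))
    (finrank_firstCoordinates_le k (m + 2)) x ?_
  · rwa [Fintype.card_prod, hcard, ← Nat.card_eq_fintype_card] at h
  rintro ⟨r, d⟩ ⟨r', d'⟩ h hh hconj
  have h1 := charpoly_eq_of_isConj hconj
  have h2 := charpoly_dvd_charpoly_diagBlocks_mul (A r') (D d') hh.1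
  rw [← hx ⟨r', d'⟩, ← Units.val_mul, ← h1, hx, charpoly_diagBlocks, hA, hA, hD] at h2
  have hcop1 : IsCoprime (X ^ k + (r'.1 : F[X])) (X - C 1) :=
    ((irreducible_X_sub_C (1 : F)).coprime_iff_not_dvd.mpr r'.2.2.1).symm
  have hcop2 : IsCoprime (X ^ k + (r'.1 : F[X])) (Q d) :=
    ((hsi d).coprime_iff_not_dvd.mpr (r'.2.2.2 d)).symm
  have hdvd := (hcop1.pow_right.mul_right hcop2).dvd_of_dvd_mul_right h2
  have hrr : X ^ k + (r.1 : F[X]) = X ^ k + (r'.1 : F[X]) :=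
    eq_of_monic_of_dvd_of_natDegree_le (monic_X_pow_add (mem_degreeLT.mp r'.1.2))
      (monic_X_pow_add (mem_degreeLT.mp r.1.2)) hdvd
      (by rw [natDegree_X_pow_add_degreeLT, natDegree_X_pow_add_degreeLT])
  have hr : r = r' := Subtype.ext (Subtype.ext (add_left_cancel hrr))
  subst hr
  have h3 : GeneralLinearGroup.det (x (r, d)) = GeneralLinearGroup.det (x (r, d')) := by
    obtain ⟨c, hc⟩ := isConj_iff.mp hconj
    have := congrArg GeneralLinearGroup.det hc
    rw [map_mul, map_mul, map_mul, MonoidHom.mem_ker.mp hh.2, mul_one, map_inv,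
      mul_inv_cancel_comm] at this
    exact this
  have h4 : (A r).det * (D d).det = (A r).det * (D d').det := by
    rw [← det_diagBlocks, ← det_diagBlocks]
    exact congrArg Units.val h3
  have h5 := mul_left_cancel₀ (hAdet r) h4
  rw [hDdet, hDdet] at h5
  rw [Units.ext h5]

end Separation

/-- fix `n ≥ 2` and `0 ≤ k ≤ n − 2`.  Then `N_{⊗,k}(q)/q^{k+1} → 1` as
`q → ∞` over prime powers. -/
theorem card_tensorRank_irreps (n : ℕ) (hn : 2 ≤ n) (k : ℕ) (hk : k ≤ n - 2) :
    ∀ ε : ℝ, 0 < ε → ∃ Q : ℕ,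
      ∀ (F : Type) [Field F] [Fintype F], Q ≤ Fintype.card F →
        |(tensorRankIsoClasses n F k : ℝ) / (Fintype.card F : ℝ) ^ (k + 1) - 1| < ε := by
  intro ε hε
  obtain ⟨m, rfl⟩ : ∃ m, n = k + (m + 2) := ⟨n - 2 - k, by omega⟩
  let c : ℕ → ℝ := fun j => j * (((j + 1) ^ (j + 1)) ^ j : ℕ)
  have hc : ∀ j, 0 ≤ c j := fun j => mul_nonneg (Nat.cast_nonneg _) (Nat.cast_nonneg _)
  let B : ℝ := 4 + c k + ∑ j ∈ Finset.range k, (1 + c j)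
  obtain ⟨Q, hQ⟩ := exists_nat_gt (B / ε)
  refine ⟨max Q 3, fun F _ _ hF => ?_⟩
  have hF3 : 3 ≤ Fintype.card F := le_of_max_le_right hF
  set q := Fintype.card F with hq
  have hq1 : (1 : ℝ) ≤ q := by exact_mod_cast (by omega : 1 ≤ q)
  have hq0 : (0 : ℝ) < q := by linarith
  have hqB : B < ε * q := by
    have : (Q : ℝ) ≤ q := by exact_mod_cast le_of_max_le_left hF
    rw [div_lt_iff₀ hε] at hQ
    nlinarith
  have hub : ∀ j, (tensorRankIsoClasses (k + (m + 2)) F j : ℝ) ≤ q ^ (j + 1) + c j * q ^ j := by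
    intro j
    have h := (card_tensorRankSetoid_le (n := k + (m + 2)) (F := F) (by omega) hF3 j).2
    have h' : tensorRankIsoClasses (k + (m + 2)) F j ≤
        q * (q ^ j + j * (q ^ (j - 1) * ((j + 1) ^ (j + 1)) ^ j)) :=
      h.trans (Nat.mul_le_mul_right _ (Nat.sub_le _ _))
    have h2 : q * (q ^ j + j * (q ^ (j - 1) * ((j + 1) ^ (j + 1)) ^ j)) =
        q ^ (j + 1) + j * ((j + 1) ^ (j + 1)) ^ j * q ^ j := by
      rcases j with _ | j
      · simp
      · rw [Nat.add_sub_cancel]; ring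
    rw [h2] at h'
    have h3 : (tensorRankIsoClasses (k + (m + 2)) F j : ℝ) ≤
        ((q ^ (j + 1) + j * ((j + 1) ^ (j + 1)) ^ j * q ^ j : ℕ) : ℝ) := Nat.cast_le.mpr h'
    refine h3.trans_eq ?_
    simp only [c]
    push_cast
    ring
  obtain ⟨g, hg1, hg2⟩ := exists_le_sum_tensorRankIsoClasses (F := F) k m hF3
  rw [← hq] at hg1 hg2
  have hg1' : (q : ℝ) * q ^ k ≤ q * g + 3 * q ^ k := by exact_mod_cast hg1
  have hg2' : (g : ℝ) * (q - 1) ≤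
      ∑ j ∈ Finset.range k, (tensorRankIsoClasses (k + (m + 2)) F j : ℝ) +
        tensorRankIsoClasses (k + (m + 2)) F k := by
    rw [Fin.sum_univ_eq_sum_range (fun j => tensorRankIsoClasses (k + (m + 2)) F j) (k + 1),
      Finset.sum_range_succ] at hg2
    have : ((g * (q - 1) : ℕ) : ℝ) ≤ _ := Nat.cast_le.mpr hg2
    push_cast [Nat.cast_sub (by omega : 1 ≤ q)] at this
    exact this
  have hsum : ∑ j ∈ Finset.range k, (tensorRankIsoClasses (k + (m + 2)) F j : ℝ) ≤
      (∑ j ∈ Finset.range k, (1 + c j)) * q ^ k := by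
    rw [Finset.sum_mul]
    refine Finset.sum_le_sum fun j hj => (hub j).trans ?_
    have hj' := Finset.mem_range.mp hj
    rw [add_mul, one_mul]
    exact add_le_add (pow_le_pow_right₀ hq1 hj')
      (mul_le_mul_of_nonneg_left (pow_le_pow_right₀ hq1 hj'.le) (hc j))
  have hS : 0 ≤ ∑ j ∈ Finset.range k, (1 + c j) :=
    Finset.sum_nonneg fun j _ => by linarith [hc j]
  have hqk : (0 : ℝ) < q ^ k := pow_pos hq0 k
  have hgq : (q : ℝ) * q ^ k - 4 * q ^ k ≤ g * (q - 1) := by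
    have h1 : (q : ℝ) ^ k * (q - 3) ≤ q * g := by linarith
    have h2 : (q : ℝ) ^ k * (q - 3) * (q - 1) ≤ q * (g * (q - 1)) := by nlinarith
    have h3 : (q : ℝ) * (q * q ^ k - 4 * q ^ k) ≤ q * (g * (q - 1)) := by nlinarith
    exact le_of_mul_le_mul_left h3 hq0
  have hN : |(tensorRankIsoClasses (k + (m + 2)) F k : ℝ) - q ^ (k + 1)| ≤ B * q ^ k := by
    have h := hub k
    have hck := mul_nonneg (hc k) hqk.le
    have hSk := mul_nonneg hS hqk.le
    simp only [B]
    rw [abs_le, pow_succ'] at *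
    constructor <;> nlinarith
  rw [div_sub_one (pow_pos hq0 _).ne', abs_div, abs_of_pos (pow_pos hq0 (k + 1)),
    div_lt_iff₀ (pow_pos hq0 _), pow_succ']
  rw [pow_succ'] at hN
  nlinarith
end

section
/- Fix n ≥ 2 and 1 ≤ k ≤ ⌊n/2⌋. Let ω_{n,k} be the representation of GL_n(F_q) × GL_k(F_q) on the space of complex-valued functions on M_{n,k}(F_q) given by (ω_{n,k}(g,h)f)(m) = f(g^{-1} m h). For each irreducible representation τ of GL_k(F_q), let M(τ) = Hom_{GL_k(F_q)}(τ, ω_{n,k}), a representation of GL_n(F_q). Then: (1) M(τ) contains exactly one irreducible constituent η(τ) of U-rank k, it occurs with multiplicity one, and every other irreducible constituent of M(τ) has U-rank strictly less than k; (2) if τ and τ' are non-isomorphic irreducible representations of GL_k(F_q), then η(τ) and η(τ') are non-isomorphic. -/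
open Matrix CategoryTheory
open scoped BigOperators

/-- The reindexing equivalence `Fin (n/2) ⊕ Fin (n − n/2) ≃ Fin n`. -/
def blockEquiv (n : ℕ) : (Fin (n / 2) ⊕ Fin (n - n / 2)) ≃ Fin n :=
  finSumFinEquiv.trans (finCongr (by omega))

/-- The block unipotent matrix `u(A) = [[I, A], [0, I]]`, viewed as an `n × n` matrix. -/
def uMat (F : Type) [Field F] (n : ℕ)
    (A : Matrix (Fin (n / 2)) (Fin (n - n / 2)) F) : Matrix (Fin n) (Fin n) F :=
  (Matrix.fromBlocks 1 A 0 1).submatrix (blockEquiv n).symm (blockEquiv n).symm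

lemma uMat_det (F : Type) [Field F] [Fintype F] (n : ℕ)
    (A : Matrix (Fin (n / 2)) (Fin (n - n / 2)) F) : (uMat F n A).det = 1 := by
  unfold uMat
  rw [Matrix.det_submatrix_equiv_self, Matrix.det_fromBlocks_zero₂₁]
  simp

/-- The block unipotent matrix `u(A)` as an element of `GL_n(F_q)`; these form the abelian
subgroup `U`. -/
noncomputable def uGL (F : Type) [Field F] [Fintype F] (n : ℕ)
    (A : Matrix (Fin (n / 2)) (Fin (n - n / 2)) F) : GL (Fin n) F :=
  Matrix.GeneralLinearGroup.mkOfDetNeZero (uMat F n A)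
    (by rw [uMat_det]; exact one_ne_zero)

/-- The character `ψ_B` of `U` occurs in `ρ|_U`, i.e. its multiplicity
`(1/#U)·Σ_A χ_ρ(u(A)) ψ(−trace(Bᵀ A))` is nonzero. -/
noncomputable def OccursInRes (n : ℕ) (F : Type) [Field F] [Fintype F] (ψ : AddChar F ℂ)
    (ρ : FDRep ℂ (GL (Fin n) F)) (B : Matrix (Fin (n / 2)) (Fin (n - n / 2)) F) : Prop :=
  (∑ A : Matrix (Fin (n / 2)) (Fin (n - n / 2)) F,
      ρ.character (uGL F n A) * ψ (-(Bᵀ * A).trace)) ≠ 0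

/-- `ρ` has `U`-rank `k`: some `ψ_B` with `rank B = k` occurs in `ρ|_U`, and no `ψ_B` with
`rank B > k` occurs. -/
noncomputable def HasURank (n : ℕ) (F : Type) [Field F] [Fintype F] (ψ : AddChar F ℂ)
    (ρ : FDRep ℂ (GL (Fin n) F)) (k : ℕ) : Prop :=
  (∃ B : Matrix (Fin (n / 2)) (Fin (n - n / 2)) F, B.rank = k ∧ OccursInRes n F ψ ρ B) ∧
  (∀ B : Matrix (Fin (n / 2)) (Fin (n - n / 2)) F, k < B.rank → ¬ OccursInRes n F ψ ρ B)

/-- `ρ` has `U`-rank strictly less than `k`: no `ψ_B` with `rank B ≥ k` occurs in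
`ρ|_U`. -/
noncomputable def URankLt (n : ℕ) (F : Type) [Field F] [Fintype F] (ψ : AddChar F ℂ)
    (ρ : FDRep ℂ (GL (Fin n) F)) (k : ℕ) : Prop :=
  ∀ B : Matrix (Fin (n / 2)) (Fin (n - n / 2)) F, k ≤ B.rank → ¬ OccursInRes n F ψ ρ B

/-- The multiplicity of the irreducible representation `σ` of `GL_n(F_q)` in the
multiplicity space `M(τ) = Hom_{GL_k(F_q)}(τ, ω_{n,k})`, computed via inner products of
characters:  the character of `ω_{n,k}` at `(g,h)` is `#{m ∈ M_{n,k}(F_q) : g⁻¹ m h = m}`,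
the character of `M(τ)` at `g` is `(1/#GL_k) Σ_h χ_τ(h⁻¹)·#{m : g⁻¹ m h = m}`, and the
multiplicity of `σ` in `M(τ)` is `(1/#GL_n) Σ_g χ_{M(τ)}(g)·χ_σ(g⁻¹)`. -/
noncomputable def etaMult (n k : ℕ) (F : Type) [Field F] [Fintype F]
    (σ : FDRep ℂ (GL (Fin n) F)) (τ : FDRep ℂ (GL (Fin k) F)) : ℂ :=
  letI : Fintype (GL (Fin n) F) := Fintype.ofFinite _
  letI : Fintype (GL (Fin k) F) := Fintype.ofFinite _
  (Nat.card (GL (Fin n) F) : ℂ)⁻¹ * (Nat.card (GL (Fin k) F) : ℂ)⁻¹ *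
    ∑ g : GL (Fin n) F, ∑ h : GL (Fin k) F,
      σ.character g⁻¹ * τ.character h⁻¹ *
        (Nat.card {m : Matrix (Fin n) (Fin k) F //
            ((g⁻¹ : GL (Fin n) F) : Matrix (Fin n) (Fin n) F) * m *
              (h : Matrix (Fin k) (Fin k) F) = m} : ℂ)

section RepresentationTheory

variable {G : Type} [Group G] [Finite G]

theorem FDRep.simple_of_isIrreducible {V : Type} [AddCommGroup V] [Module ℂ V]
    [FiniteDimensional ℂ V] (ρ : Representation ℂ G V) [ρ.IsIrreducible] :
    Simple (FDRep.of ρ) := by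
  have := Fintype.ofFinite G
  have hG : (Nat.card G : ℂ) ≠ 0 := Nat.cast_ne_zero.2 Nat.card_pos.ne'
  have := invertibleOfNonzero hG
  rw [FDRep.simple_iff_char_is_norm_one]
  have h := Representation.char_orthonormal ρ ρ
  rw [if_pos ⟨Representation.Equiv.refl ρ⟩, inv_mul_eq_one₀ hG] at h
  exact h.symm

theorem FDRep.exists_sum_simple (V : FDRep ℂ G) :
    ∃ (ι : Type) (_ : Fintype ι) (W : ι → FDRep ℂ G),
      (∀ i, Simple (W i)) ∧ ∀ g, V.character g = ∑ i, (W i).character g := by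
  suffices H : ∀ (d : ℕ) (V : Type) [AddCommGroup V] [Module ℂ V] [FiniteDimensional ℂ V]
      (ρ : Representation ℂ G V), Module.finrank ℂ V ≤ d →
      ∃ (ι : Type) (_ : Fintype ι) (W : ι → FDRep ℂ G),
        (∀ i, Simple (W i)) ∧ ∀ g, LinearMap.trace ℂ V (ρ g) = ∑ i, (W i).character g from
    H _ V V.ρ le_rfl
  intro d
  induction d with
  | zero =>
    intro V _ _ _ ρ hV
    have : Subsingleton V := (Module.finrank_zero_iff (R := ℂ)).1 (by omega)
    refine ⟨Empty, inferInstance, Empty.elim, fun i => i.elim, fun g => ?_⟩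
    rw [Subsingleton.elim (ρ g) 0]
    simp
  | succ d ih =>
    intro V _ _ _ ρ hV
    have hG : NeZero (Nat.card G : ℂ) := ⟨Nat.cast_ne_zero.2 Nat.card_pos.ne'⟩
    rcases subsingleton_or_nontrivial V with hs | hs
    · exact ih V ρ (by rw [Module.finrank_zero_of_subsingleton]; omega)
    by_cases hirr : ρ.IsIrreducible
    · exact ⟨Unit, inferInstance, fun _ => FDRep.of ρ,
        fun _ => FDRep.simple_of_isIrreducible ρ, fun g => by simp [FDRep.character]⟩
    have hnt : Nontrivial (Subrepresentation ρ) := by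
      refine ⟨⊥, ⊤, fun h => ?_⟩
      have h' := congrArg Subrepresentation.toSubmodule h
      exact bot_ne_top (α := Submodule ℂ V) h'
    obtain ⟨S, hSb, hSt⟩ : ∃ S : Subrepresentation ρ, S ≠ ⊥ ∧ S ≠ ⊤ := by
      by_contra! hcon
      exact hirr ⟨fun S => or_iff_not_imp_left.2 (hcon S)⟩
    obtain ⟨T, hST⟩ := exists_isCompl S
    have hTt : T ≠ ⊤ := fun h => hSb (by simpa [h] using hST.inf_eq_bot)
    have hc : IsCompl S.toSubmodule T.toSubmodule :=
      IsCompl.of_eq (congrArg Subrepresentation.toSubmodule hST.inf_eq_bot)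
        (congrArg Subrepresentation.toSubmodule hST.sup_eq_top)
    have hlt : ∀ S : Subrepresentation ρ, S ≠ ⊤ → Module.finrank ℂ S.toSubmodule ≤ d := by
      intro S hS
      have : S.toSubmodule ≠ ⊤ := fun h => hS (Subrepresentation.toSubmodule_injective h)
      have := Submodule.finrank_lt this
      omega
    obtain ⟨ι₁, _, W₁, hW₁, hc₁⟩ := ih _ S.toRepresentation (hlt S hSt)
    obtain ⟨ι₂, _, W₂, hW₂, hc₂⟩ := ih _ T.toRepresentation (hlt T hTt)
    refine ⟨ι₁ ⊕ ι₂, inferInstance, Sum.elim W₁ W₂, ?_, fun g => ?_⟩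
    · rintro (i | i)
      exacts [hW₁ i, hW₂ i]
    let N : Bool → Submodule ℂ V := fun b => if b then S.toSubmodule else T.toSubmodule
    have hN : DirectSum.IsInternal N :=
      (DirectSum.isInternal_submodule_iff_isCompl N (i := true) (j := false) (by simp)
        (by ext b; cases b <;> simp)).2 hc
    have hm : ∀ b, Set.MapsTo (ρ g) (N b) (N b) := by
      rintro (_ | _)
      exacts [T.apply_mem_toSubmodule g, S.apply_mem_toSubmodule g]
    rw [LinearMap.trace_eq_sum_trace_restrict hN hm, Fintype.sum_bool, Fintype.sum_sum_type]
    exact congrArg₂ (· + ·) (hc₁ g) (hc₂ g)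

theorem FDRep.exists_isotypic {G S K : Type} [Group G] [Group S] [Group K] [Fintype K]
    (V : FDRep ℂ G) (u : K →* G) (χ : K →* ℂ) (l : S →* G) (α : S → K → K)
    (hα : ∀ s a, u a * l s = l s * u (α s a)) (hχ : ∀ s a, χ (α s a) = χ a) :
    ∃ E : FDRep ℂ S, ∀ s, E.character s =
      (Fintype.card K : ℂ)⁻¹ * ∑ a, χ a⁻¹ * V.character (l s * u a) := by
  have hK : (Fintype.card K : ℂ) ≠ 0 := Nat.cast_ne_zero.2 Fintype.card_ne_zero
  have hinv : ∀ a, χ a⁻¹ * χ a = 1 := fun a => by rw [← map_mul]; simp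
  let E : Submodule ℂ V := ⨅ a, LinearMap.ker (V.ρ (u a) - χ a • LinearMap.id)
  have hE : ∀ v, v ∈ E ↔ ∀ a, V.ρ (u a) v = χ a • v := fun v => by
    simp [E, sub_eq_zero]
  let P : V →ₗ[ℂ] V := (Fintype.card K : ℂ)⁻¹ • ∑ a, χ a⁻¹ • V.ρ (u a)
  have hP : ∀ v, P v = (Fintype.card K : ℂ)⁻¹ • ∑ a, χ a⁻¹ • V.ρ (u a) v := fun v => by
    simp [P]
  have hPE : ∀ v, P v ∈ E := by
    intro v
    rw [hE]
    intro b
    rw [hP, map_smul, map_sum, smul_comm (χ b), Finset.smul_sum (r := χ b)]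
    congr 1
    refine Fintype.sum_equiv (Equiv.mulLeft b) _ _ fun a => ?_
    simp only [Equiv.coe_mulLeft, _root_.map_smul, map_mul, Module.End.mul_apply,
      _root_.mul_inv_rev, smul_smul]
    rw [mul_left_comm, mul_comm (χ b), hinv, mul_one]
  have hPid : ∀ v ∈ E, P v = v := by
    intro v hv
    rw [hE] at hv
    simp only [hP, hv, smul_smul, hinv, one_smul, Finset.sum_const, Finset.card_univ]
    rw [← Nat.cast_smul_eq_nsmul ℂ, smul_smul, inv_mul_cancel₀ hK, one_smul]
  have hlE : ∀ s, ∀ v ∈ E, V.ρ (l s) v ∈ E := by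
    intro s v hv
    rw [hE] at hv ⊢
    intro a
    rw [← Module.End.mul_apply, ← map_mul, hα, map_mul, Module.End.mul_apply, hv, map_smul, hχ]
  let ρE : Representation ℂ S E :=
    { toFun s := (V.ρ (l s)).restrict (hlE s)
      map_one' := by ext; simp
      map_mul' s t := by ext; simp }
  refine ⟨FDRep.of ρE, fun s => ?_⟩
  have hf : ∀ s, ∀ v ∈ E, (V.ρ (l s) ∘ₗ P) v ∈ E := fun s v _ => hlE s _ (hPE v)
  have h1 : ρE s = (V.ρ (l s) ∘ₗ P).restrict (p := E) (q := E)
      (hf s) := by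
    ext v
    simp [ρE, hPid v v.2]
  change LinearMap.trace ℂ E (ρE s) = _
  rw [h1, LinearMap.trace_restrict_eq_of_forall_mem E (V.ρ (l s) ∘ₗ P) (fun v => hlE s _ (hPE v))
    (hf s)]
  have h2 : V.ρ (l s) ∘ₗ P = (Fintype.card K : ℂ)⁻¹ • ∑ a, χ a⁻¹ • V.ρ (l s * u a) := by
    ext v
    simp [hP, map_sum]
  rw [h2]
  simp [FDRep.character, map_sum]

/-- The permutation representation on complex-valued functions. -/
noncomputable def permRepresentation {G X : Type} [Group G] (φ : G →* Equiv.Perm X) :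
    Representation ℂ G (X → ℂ) where
  toFun g := LinearMap.funLeft ℂ ℂ ((φ g)⁻¹ : Equiv.Perm X)
  map_one' := by ext; simp
  map_mul' g h := by ext; simp

theorem trace_permRepresentation {G X : Type} [Group G] [Finite X] (φ : G →* Equiv.Perm X)
    (g : G) :
    LinearMap.trace ℂ (X → ℂ) (permRepresentation φ g) = Nat.card {x // φ g x = x} := by
  classical
  have := Fintype.ofFinite X
  rw [LinearMap.trace_eq_matrix_trace ℂ (Pi.basisFun ℂ X), Matrix.trace, Nat.card_eq_fintype_card,
    Fintype.card_subtype, Finset.card_filter, Nat.cast_sum]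
  refine Finset.sum_congr rfl fun x _ => ?_
  have : (φ g).symm x = x ↔ φ g x = x := by
    rw [Equiv.symm_apply_eq, eq_comm]
  simp [permRepresentation, LinearMap.funLeft_apply, Pi.single_apply,
    this]

theorem FDRep.exists_multiplicitySpace {G H X : Type} [Group G] [Group H] [Fintype H] [Finite X]
    (φ : G × H →* Equiv.Perm X) (τ : FDRep ℂ H) :
    ∃ M : FDRep ℂ G, ∀ g, M.character g = (Fintype.card H : ℂ)⁻¹ *
      ∑ h, τ.character h⁻¹ * (Nat.card {x // φ (g, h) x = x} : ℂ) := by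
  have := Fintype.ofFinite X
  let V : FDRep ℂ (G × H) := FDRep.of
    (Representation.tprod ((Representation.dual τ.ρ).comp (MonoidHom.snd G H))
      (permRepresentation φ))
  have hV : ∀ g h, V.character (g, h) =
      τ.character h⁻¹ * (Nat.card {x // φ (g, h) x = x} : ℂ) := by
    intro g h
    change LinearMap.trace ℂ _ (TensorProduct.map _ _) = _
    rw [LinearMap.trace_tensorProduct']
    congr 1
    · exact FDRep.char_dual τ h
    · exact trace_permRepresentation φ (g, h)
  obtain ⟨M, hM⟩ := FDRep.exists_isotypic V (MonoidHom.inr G H) 1 (MonoidHom.inl G H)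
    (fun _ h => h) (by simp) (by simp)
  refine ⟨M, fun g => ?_⟩
  rw [hM]
  simp [← hV]

section Constituents

variable {G H : Type} [Group G] [Group H] [Fintype G] [Fintype H]

open scoped Classical in
theorem FDRep.charInner_eq (V W : FDRep ℂ G) [Simple V] [Simple W] :
    (Nat.card G : ℂ)⁻¹ * ∑ g : G, V.character g * W.character g⁻¹ =
      if Nonempty (V ≅ W) then 1 else 0 := by
  have := invertibleOfNonzero (Nat.cast_ne_zero.2 Nat.card_pos.ne' : (Nat.card G : ℂ) ≠ 0)
  exact FDRep.char_orthonormal V W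

open scoped Classical in
theorem FDRep.charInner_eq_card (V : FDRep ℂ G) {ι : Type} [Fintype ι] (W : ι → FDRep ℂ G)
    (hW : ∀ i, Simple (W i)) (hV : ∀ g, V.character g = ∑ i, (W i).character g)
    (σ : FDRep ℂ G) [Simple σ] :
    (Nat.card G : ℂ)⁻¹ * ∑ g : G, V.character g * σ.character g⁻¹ =
      (Finset.univ.filter fun i => Nonempty (W i ≅ σ)).card := by
  simp_rw [hV, Finset.sum_mul]
  rw [Finset.sum_comm, Finset.mul_sum, Finset.card_filter, Nat.cast_sum]
  refine Finset.sum_congr rfl fun i _ => ?_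
  rw [FDRep.charInner_eq]
  simp

theorem FDRep.simple_dual (V : FDRep ℂ G) [Simple V] :
    Simple (FDRep.of (Representation.dual V.ρ)) := by
  rw [FDRep.simple_iff_char_is_norm_one]
  have h := (FDRep.simple_iff_char_is_norm_one V).1 inferInstance
  rw [← h]
  refine Finset.sum_congr rfl fun g _ => ?_
  rw [FDRep.char_dual, FDRep.char_dual, inv_inv, mul_comm]

/-- A functional on characters taking natural number values on representations and vanishing on
`M` vanishes on every irreducible constituent of `M`. -/
theorem FDRep.eq_zero_of_constituent (M σ : FDRep ℂ G) [Simple σ]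
    (hσ : (Nat.card G : ℂ)⁻¹ * ∑ g : G, M.character g * σ.character g⁻¹ ≠ 0)
    (D : (G → ℂ) →ₗ[ℂ] ℂ) (hD : ∀ V : FDRep ℂ G, ∃ d : ℕ, D V.character = d)
    (hM : D M.character = 0) : D σ.character = 0 := by
  classical
  obtain ⟨ι, _, W, hW, hc⟩ := FDRep.exists_sum_simple M
  rw [FDRep.charInner_eq_card M W hW hc, Nat.cast_ne_zero, Finset.card_ne_zero] at hσ
  obtain ⟨i, hi⟩ := hσ
  obtain ⟨e⟩ := (Finset.mem_filter.1 hi).2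
  rw [← FDRep.char_iso e]
  choose d hd using hD
  have hc' : M.character = ∑ i, (W i).character := by ext g; simp [hc]
  rw [hc', map_sum] at hM
  simp_rw [hd] at hM ⊢
  norm_cast at hM ⊢
  simpa using (Finset.sum_eq_zero_iff.1 hM) i (Finset.mem_univ i)

/-- If `T` sends characters of `G` to characters of `H` and the character of `M` to the character
of the dual of the irreducible representation `τ`, then exactly one irreducible constituent of `M`
is not annihilated by `T`; it occurs with multiplicity one. -/
theorem FDRep.exists_unique_constituent (M : FDRep ℂ G) (τ : FDRep ℂ H) [Simple τ]
    (T : (G → ℂ) →ₗ[ℂ] (H → ℂ))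
    (hT : ∀ V : FDRep ℂ G, ∃ E : FDRep ℂ H, T V.character = E.character)
    (hM : ∀ x, T M.character x = τ.character x⁻¹) :
    ∃ η : FDRep ℂ G, Simple η ∧
      (Nat.card G : ℂ)⁻¹ * ∑ g : G, M.character g * η.character g⁻¹ = 1 ∧
      T η.character 1 ≠ 0 ∧
      (∀ σ : FDRep ℂ G, Simple σ →
        (Nat.card G : ℂ)⁻¹ * ∑ g : G, M.character g * σ.character g⁻¹ ≠ 0 →
        ¬ Nonempty (σ ≅ η) → T σ.character 1 = 0) ∧
      (∀ τ' : FDRep ℂ H, Simple τ' →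
        ((Nat.card H : ℂ)⁻¹ * ∑ x : H, T η.character x * τ'.character x ≠ 0 ↔
          Nonempty (τ' ≅ τ))) := by
  classical
  obtain ⟨ι, _, W, hW, hc⟩ := FDRep.exists_sum_simple M
  have hc' : M.character = ∑ i, (W i).character := by ext g; simp [hc]
  have hinv := invertibleOfNonzero
    (Nat.cast_ne_zero.2 Nat.card_pos.ne' : (Nat.card H : ℂ) ≠ 0)
  have hnat : ∀ (V : FDRep ℂ G) (τ' : FDRep ℂ H), ∃ d : ℕ,
      (Nat.card H : ℂ)⁻¹ * ∑ x : H, T V.character x * τ'.character x = d := by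
    intro V τ'
    obtain ⟨E, hE⟩ := hT V
    refine ⟨_, Eq.trans ?_
      (FDRep.scalar_product_char_eq_finrank_equivariant (FDRep.of (Representation.dual τ'.ρ)) E)⟩
    simp_rw [hE, FDRep.char_dual, inv_inv]
  choose r hr using hnat
  have hsum : ∀ (τ' : FDRep ℂ H), Simple τ' →
      ∑ i, r (W i) τ' = if Nonempty (τ' ≅ τ) then 1 else 0 := by
    intro τ' _
    rw [← Nat.cast_inj (R := ℂ), Nat.cast_sum]
    simp_rw [← hr]
    rw [← Finset.mul_sum, Finset.sum_comm]
    simp_rw [← Finset.sum_mul, ← Finset.sum_apply, ← map_sum, ← hc', hM, mul_comm (τ.character _)]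
    rw [FDRep.charInner_eq]
    simp
  have hone := hsum τ inferInstance
  rw [if_pos ⟨Iso.refl τ⟩] at hone
  obtain ⟨i, hi⟩ : ∃ i, r (W i) τ ≠ 0 := by
    by_contra! h
    simp [h] at hone
  have hrest : ∀ j, j ≠ i → r (W j) τ = 0 := by
    intro j hj
    have h1 := Finset.add_sum_erase Finset.univ (fun i => r (W i) τ) (Finset.mem_univ i)
    have h2 : ∑ x ∈ Finset.univ.erase i, r (W x) τ = 0 := by
      omega
    exact Finset.sum_eq_zero_iff.1 h2 j (by simp [hj])
  have hTj : ∀ j, T (W j).character 1 ≠ 0 → r (W j) τ ≠ 0 := by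
    intro j hj
    obtain ⟨E, hE⟩ := hT (W j)
    obtain ⟨κ, _, S, hS, hES⟩ := FDRep.exists_sum_simple E
    obtain ⟨l⟩ : Nonempty κ := by
      by_contra h
      rw [not_nonempty_iff] at h
      simp [hE, hES] at hj
    have hd := FDRep.simple_dual (S l)
    have h1 : r (W j) (FDRep.of (Representation.dual (S l).ρ)) ≠ 0 := by
      rw [← Nat.cast_ne_zero (R := ℂ), ← hr]
      simp_rw [hE, FDRep.char_dual]
      rw [FDRep.charInner_eq_card E S hS hES, Nat.cast_ne_zero, Finset.card_ne_zero]
      exact ⟨l, by simpa using ⟨Iso.refl _⟩⟩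
    have h2 := hsum _ hd
    obtain ⟨e⟩ : Nonempty (FDRep.of (Representation.dual (S l).ρ) ≅ τ) := by
      by_contra h
      rw [if_neg h] at h2
      exact h1 (Finset.sum_eq_zero_iff.1 h2 j (Finset.mem_univ j))
    rw [← Nat.cast_ne_zero (R := ℂ), ← hr, ← FDRep.char_iso e, hr, Nat.cast_ne_zero]
    exact h1
  have hcong : ∀ j, Nonempty (W j ≅ W i) → j = i := by
    rintro j ⟨e⟩
    by_contra hj
    have h1 := hrest j hj
    rw [← Nat.cast_eq_zero (R := ℂ), ← hr, FDRep.char_iso e, hr, Nat.cast_eq_zero] at h1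
    exact hi h1
  refine ⟨W i, hW i, ?_, ?_, ?_, ?_⟩
  · have := hW i
    rw [FDRep.charInner_eq_card M W hW hc]
    have : (Finset.univ.filter fun j => Nonempty (W j ≅ W i)) = {i} := by
      ext j
      simp only [Finset.mem_filter, Finset.mem_univ, true_and, Finset.mem_singleton]
      exact ⟨hcong j, by rintro rfl; exact ⟨Iso.refl _⟩⟩
    rw [this]
    simp
  · intro h0
    obtain ⟨E, hE⟩ := hT (W i)
    rw [hE, FDRep.char_one, Nat.cast_eq_zero] at h0
    have hs : Subsingleton E := (Module.finrank_zero_iff (R := ℂ)).1 h0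
    refine hi ?_
    rw [← Nat.cast_eq_zero (R := ℂ), ← hr, hE]
    have : ∀ x, E.character x = 0 := fun x => by
      rw [FDRep.character, Subsingleton.elim (E.ρ x) 0, map_zero]
    simp [this]
  · intro σ _ hσ hne
    rw [FDRep.charInner_eq_card M W hW hc, Nat.cast_ne_zero, Finset.card_ne_zero] at hσ
    obtain ⟨j, hj⟩ := hσ
    obtain ⟨e⟩ := (Finset.mem_filter.1 hj).2
    rw [← FDRep.char_iso e]
    by_contra h
    have hji : j = i := by
      by_contra hji
      exact hTj j h (hrest j hji)
    subst hji
    exact hne ⟨e.symm⟩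
  · intro τ' _
    rw [hr, Nat.cast_ne_zero]
    constructor
    · intro h
      by_contra hne
      have h2 := hsum τ' inferInstance
      rw [if_neg hne] at h2
      exact h (Finset.sum_eq_zero_iff.1 h2 i (Finset.mem_univ i))
    · rintro ⟨e⟩
      rw [← Nat.cast_ne_zero (R := ℂ), ← hr, FDRep.char_iso e, hr, Nat.cast_ne_zero]
      exact hi

end Constituents

end RepresentationTheory

section MatrixCounting

variable {F : Type} [Field F] {p r κ : Type} [Fintype p] [Fintype r] [Fintype κ]
  [DecidableEq p] [DecidableEq r] [DecidableEq κ]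

/-- The homomorphism from `κ × κ` matrices to `p × p` matrices letting `x` act on the image of `P`
and trivially on the kernel of its left inverse `P'`. -/
def inflate (P : Matrix p κ F) (P' : Matrix κ p F) (h : P' * P = 1) :
    Matrix κ κ F →* Matrix p p F where
  toFun x := 1 + P * (x - 1) * P'
  map_one' := by simp
  map_mul' x y := by
    have h1 : P * (x - 1) * P' * (P * (y - 1) * P') = P * ((x - 1) * (y - 1)) * P' := by
      calc _ = P * (x - 1) * (P' * P) * (y - 1) * P' := by simp only [Matrix.mul_assoc]
        _ = _ := by rw [h, Matrix.mul_one, Matrix.mul_assoc P]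
    have h2 : x * y - 1 = (x - 1) + (y - 1) + (x - 1) * (y - 1) := by noncomm_ring
    rw [add_mul, mul_add, mul_add, h1, h2]
    simp only [Matrix.mul_add, Matrix.add_mul, Matrix.one_mul, Matrix.mul_one]
    abel

theorem inflate_mul_left (P : Matrix p κ F) (P' : Matrix κ p F) (h : P' * P = 1)
    (x : Matrix κ κ F) : inflate P P' h x * P = P * x := by
  change (1 + P * (x - 1) * P') * P = P * x
  rw [Matrix.add_mul, Matrix.mul_assoc _ P', h, Matrix.mul_one, Matrix.one_mul, Matrix.mul_sub,
    Matrix.mul_one]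
  abel

theorem mul_inflate_right (P : Matrix p κ F) (P' : Matrix κ p F) (h : P' * P = 1)
    (x : Matrix κ κ F) : P' * inflate P P' h x = x * P' := by
  change P' * (1 + P * (x - 1) * P') = x * P'
  rw [Matrix.mul_add, ← Matrix.mul_assoc, ← Matrix.mul_assoc, h, Matrix.mul_one, Matrix.one_mul,
    Matrix.sub_mul, Matrix.one_mul]
  abel

theorem exists_mul_mul_self_eq (Y : Matrix r κ F) :
    ∃ Y' : Matrix κ r F, Y * Y' * Y = Y := by
  let f := Matrix.toLin' Y
  obtain ⟨s, hs⟩ := f.rangeRestrict.exists_rightInverse_of_surjective f.range_rangeRestrict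
  obtain ⟨g, hg⟩ := s.exists_extend
  refine ⟨LinearMap.toMatrix' g, (Matrix.toLin' (R := F)).injective ?_⟩
  rw [Matrix.toLin'_mul, Matrix.toLin'_mul, Matrix.toLin'_toMatrix']
  refine LinearMap.ext fun v => ?_
  have h1 : g (f v) = s (f.rangeRestrict v) := LinearMap.congr_fun hg (f.rangeRestrict v)
  have h2 := congrArg Subtype.val (LinearMap.congr_fun hs (f.rangeRestrict v))
  change f (g (f v)) = f v
  rw [h1]
  exact h2

omit [DecidableEq p] in
theorem exists_eq_mul_of_forall_trace {ψ : AddChar F ℂ} (hψ : ψ ≠ 1) (C : Matrix r p F)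
    (Y : Matrix r κ F) (h : ∀ A : Matrix p r F, A * Y = 0 → ψ (C * A).trace = 1) :
    ∃ D : Matrix κ p F, C = Y * D := by
  obtain ⟨Y', hY'⟩ := exists_mul_mul_self_eq Y
  have h0 : ∀ A : Matrix p r F, A * Y = 0 → (C * A).trace = 0 := by
    intro A hA
    by_contra hne
    refine hψ (DFunLike.ext _ _ fun t => ?_)
    have := h ((t / (C * A).trace) • A) (by rw [Matrix.smul_mul, hA, smul_zero])
    rw [Matrix.mul_smul, Matrix.trace_smul, smul_eq_mul, div_mul_cancel₀ _ hne] at this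
    simpa using this
  have hZ : (1 - Y * Y') * C = 0 := by
    refine Matrix.ext_iff_trace_mul_left.2 fun W => ?_
    have := h0 (W * (1 - Y * Y')) (by
      rw [Matrix.mul_assoc, Matrix.sub_mul, Matrix.one_mul, hY', sub_self, Matrix.mul_zero])
    rw [← Matrix.mul_assoc, Matrix.trace_mul_comm, ← Matrix.mul_assoc] at this
    rw [Matrix.mul_zero, Matrix.trace_zero, Matrix.trace_mul_comm, ← this]
  refine ⟨Y' * C, ?_⟩
  rw [← Matrix.mul_assoc]
  rw [Matrix.sub_mul, Matrix.one_mul, sub_eq_zero] at hZ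
  exact hZ

variable [Fintype F] [DecidableEq F]

theorem sum_filter_mul_eq_zero {ψ : AddChar F ℂ} (hψ : ψ ≠ 1) (C : Matrix r p F)
    (Y : Matrix r κ F) (hY : ¬ ∃ D : Matrix κ p F, C = Y * D) (Z : Matrix p κ F) :
    ∑ A : Matrix p r F, (if A * Y = Z then ψ (-(C * A).trace) else 0) = 0 := by
  obtain ⟨A₀, hA₀, hne⟩ : ∃ A : Matrix p r F, A * Y = 0 ∧ ψ (C * A).trace ≠ 1 := by
    by_contra! h
    exact hY (exists_eq_mul_of_forall_trace hψ C Y h)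
  set S := ∑ A : Matrix p r F, (if A * Y = Z then ψ (-(C * A).trace) else 0) with hS
  have h1 : S = ψ (C * A₀).trace * S := by
    rw [hS, Finset.mul_sum]
    refine Fintype.sum_equiv (Equiv.addRight A₀) _ _ fun A => ?_
    simp only [Equiv.coe_addRight, Matrix.add_mul, hA₀, add_zero, Matrix.mul_add, Matrix.trace_add,
      mul_ite, mul_zero, ← AddChar.map_add_eq_mul]
    congr 2
    abel
  by_contra h
  exact hne (mul_right_cancel₀ h (by rw [one_mul]; exact h1.symm))

/-- The sum, over unipotent elements twisted by a character, of the numbers of fixed points. -/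
theorem sum_card_eq_sum_sum (ψ : AddChar F ℂ) (C : Matrix r p F) {a ai : Matrix p p F}
    (ha : a * ai = 1) (d : Matrix r r F) (h : Matrix κ κ F) :
    ∑ A : Matrix p r F, ψ (-(C * A).trace) *
      (Nat.card {m : Matrix p κ F × Matrix r κ F //
        m.1 * h = a * (m.1 + A * m.2) ∧ m.2 * h = d * m.2} : ℂ) =
    ∑ Y : Matrix r κ F, if Y * h = d * Y then
      ∑ X : Matrix p κ F, ∑ A : Matrix p r F,
        (if A * Y = ai * X * h - X then ψ (-(C * A).trace) else 0) else 0 := by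
  have hai : ai * a = 1 := mul_eq_one_comm.1 ha
  have key : ∀ (X : Matrix p κ F) (Y : Matrix r κ F) (A : Matrix p r F), X * h = a * (X + A * Y) ↔ A * Y = ai * X * h - X := by
    intro X Y A
    constructor
    · intro hX
      rw [Matrix.mul_assoc, hX, ← Matrix.mul_assoc, hai, Matrix.one_mul]
      abel
    · intro hX
      rw [hX, add_sub_cancel, ← Matrix.mul_assoc, ← Matrix.mul_assoc, ha, Matrix.one_mul]
  have hcard : ∀ A : Matrix p r F, (Nat.card {m : Matrix p κ F × Matrix r κ F //
        m.1 * h = a * (m.1 + A * m.2) ∧ m.2 * h = d * m.2} : ℂ) =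
      ∑ Y : Matrix r κ F, ∑ X : Matrix p κ F,
        if A * Y = ai * X * h - X ∧ Y * h = d * Y then 1 else 0 := by
    intro A
    rw [Nat.card_eq_fintype_card, Fintype.card_subtype, Finset.card_filter, Nat.cast_sum,
      Fintype.sum_prod_type_right]
    simp [key]
  simp_rw [hcard, Finset.mul_sum]
  rw [Finset.sum_comm]
  refine Finset.sum_congr rfl fun Y _ => ?_
  rw [Finset.sum_comm]
  split_ifs with hY <;> simp [hY]

theorem sum_card_eq_zero_of_lt_rank {ψ : AddChar F ℂ} (hψ : ψ ≠ 1) (C : Matrix r p F)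
    (hC : Fintype.card κ < C.rank) (h : Matrix κ κ F) :
    ∑ A : Matrix p r F, ψ (-(C * A).trace) *
      (Nat.card {m : Matrix p κ F × Matrix r κ F //
        m.1 * h = (1 : Matrix p p F) * (m.1 + A * m.2) ∧
        m.2 * h = (1 : Matrix r r F) * m.2} : ℂ) = 0 := by
  rw [sum_card_eq_sum_sum ψ C (ai := 1) (by simp)]
  refine Finset.sum_eq_zero fun Y _ => ?_
  have hY : ¬ ∃ D : Matrix κ p F, C = Y * D := by
    rintro ⟨D, rfl⟩
    exact absurd ((Matrix.rank_mul_le_left Y D).trans Y.rank_le_card_width) (not_le.2 hC)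
  simp [sum_filter_mul_eq_zero hψ C Y hY]

theorem sum_card_of_rank_factorization {ψ : AddChar F ℂ} (hψ : ψ ≠ 1)
    {P : Matrix p κ F} {P' : Matrix κ p F} (hP : P' * P = 1)
    {Q : Matrix r κ F} {Q' : Matrix κ r F} (hQ : Q' * Q = 1)
    (x h : GL κ F) :
    ∑ A : Matrix p r F, ψ (-(Q * P' * A).trace) *
      (Nat.card {m : Matrix p κ F × Matrix r κ F //
        m.1 * (h : Matrix κ κ F) = inflate P P' hP x * (m.1 + A * m.2) ∧
        m.2 * (h : Matrix κ κ F) = inflate Q Q' hQ x * m.2} : ℂ) =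
    Fintype.card (Matrix p r F) * Nat.card {y : GL κ F // y * h = x * y} := by
  have := Fintype.ofFinite (GL κ F)
  set a := inflate P P' hP x with ha
  set d := inflate Q Q' hQ x with hd
  set ai := inflate P P' hP (x⁻¹ : GL κ F) with hai
  have haai : a * ai = 1 := by rw [ha, hai, ← map_mul, ← Units.val_mul]; simp
  rw [sum_card_eq_sum_sum ψ (Q * P') haai d]
  have hinj : Function.Injective fun y : GL κ F => Q * (y : Matrix κ κ F) := by
    intro y z hyz
    have := congrArg (Q' * ·) hyz
    simp only [← Matrix.mul_assoc, hQ, Matrix.one_mul] at this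
    exact Units.ext this
  rw [← Fintype.sum_of_injective _ hinj
    (fun y => if y * h = x * y then (Fintype.card (Matrix p r F) : ℂ) else 0)]
  · rw [Nat.card_eq_fintype_card, Fintype.card_subtype, Finset.card_filter, Nat.cast_sum,
      Finset.mul_sum]
    simp
  · intro Y hY
    have hYD : ¬ ∃ D : Matrix κ p F, Q * P' = Y * D := by
      rintro ⟨D, hD⟩
      have h1 : Q = Y * (D * P) := by
        rw [← Matrix.mul_assoc, ← hD, Matrix.mul_assoc, hP, Matrix.mul_one]
      have h2 : Q' * Y * (D * P) = 1 := by rw [Matrix.mul_assoc, ← h1, hQ]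
      refine hY ⟨⟨Q' * Y, D * P, h2, mul_eq_one_comm.1 h2⟩, ?_⟩
      change Q * (Q' * Y) = Y
      calc Q * (Q' * Y) = Y * ((D * P) * (Q' * Y)) := by
            conv_lhs => rw [h1]
            rw [Matrix.mul_assoc]
        _ = Y := by rw [mul_eq_one_comm.1 h2, Matrix.mul_one]
    simp [sum_filter_mul_eq_zero hψ _ Y hYD]
  · intro y
    have hcond : Q * (y : Matrix κ κ F) * (h : Matrix κ κ F) = d * (Q * (y : Matrix κ κ F)) ↔
        y * h = x * y := by
      rw [← Matrix.mul_assoc d, hd, inflate_mul_left, Matrix.mul_assoc, Matrix.mul_assoc,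
        ← Units.val_mul, ← Units.val_mul]
      exact hinj.eq_iff
    simp only [hcond]
    split_ifs with hxy
    swap
    · rfl
    have hψ1 : ∀ (X : Matrix p κ F) (A : Matrix p r F), A * (Q * (y : Matrix κ κ F)) = ai * X * (h : Matrix κ κ F) - X →
        ψ (-(Q * P' * A).trace) = 1 := by
      intro X A hA
      have h1 : A * Q = (ai * X * (h : Matrix κ κ F) - X) * ((y⁻¹ : GL κ F) : Matrix κ κ F) := by
        rw [← hA, ← Matrix.mul_assoc, Matrix.mul_assoc (A * Q), ← Units.val_mul]
        simp
      have h2 : (h : Matrix κ κ F) * ((y⁻¹ : GL κ F) : Matrix κ κ F) =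
          ((y⁻¹ : GL κ F) : Matrix κ κ F) * (x : Matrix κ κ F) := by
        rw [← Units.val_mul, ← Units.val_mul]
        congr 1
        rw [eq_inv_mul_iff_mul_eq, ← mul_assoc, hxy, mul_assoc, mul_inv_cancel, mul_one]
      have h3 : (Q * P' * A).trace = 0 := by
        rw [Matrix.mul_assoc, Matrix.trace_mul_comm, Matrix.mul_assoc, h1, Matrix.sub_mul,
          Matrix.mul_assoc (ai * X), h2, Matrix.mul_sub, Matrix.trace_sub, sub_eq_zero,
          ← Matrix.mul_assoc, ← Matrix.mul_assoc P', hai, mul_inflate_right, ← Matrix.mul_assoc,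
          Matrix.trace_mul_comm]
        simp only [← Matrix.mul_assoc]
        rw [← Units.val_mul]
        simp
      rw [h3]
      simp
    have hsum : ∀ (X : Matrix p κ F) (A : Matrix p r F),
        (if A * (Q * (y : Matrix κ κ F)) = ai * X * (h : Matrix κ κ F) - X then
        ψ (-(Q * P' * A).trace) else 0) =
        ((if A * (Q * (y : Matrix κ κ F)) = ai * X * (h : Matrix κ κ F) - X then 1 else 0 : ℕ) : ℂ) := by
      intro X A
      split_ifs with hc
      · simp [hψ1 X A hc]
      · simp
    simp_rw [hsum]
    norm_cast
    rw [← Fintype.sum_prod_type' (f := fun (X : Matrix p κ F) (A : Matrix p r F) => if A * (Q * (y : Matrix κ κ F)) =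
      ai * X * (h : Matrix κ κ F) - X then 1 else 0), ← Finset.card_filter, ← Fintype.card_subtype]
    set w : Matrix κ κ F := ((y⁻¹ : GL κ F) : Matrix κ κ F) with hw
    have hyw : (y : Matrix κ κ F) * w = 1 := by rw [hw, ← Units.val_mul]; simp
    have hwy : w * (y : Matrix κ κ F) = 1 := by rw [hw, ← Units.val_mul]; simp
    have hE : (1 - Q * Q') * Q = 0 := by
      rw [Matrix.sub_mul, Matrix.mul_assoc, hQ, Matrix.mul_one, Matrix.one_mul, sub_self]
    have hE' : Q' * (1 - Q * Q') = 0 := by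
      rw [Matrix.mul_sub, ← Matrix.mul_assoc, hQ, Matrix.mul_one, Matrix.one_mul, sub_self]
    have hEE : (1 - Q * Q') * (1 - Q * Q') = 1 - Q * Q' := by
      rw [Matrix.mul_sub (1 - Q * Q'), ← Matrix.mul_assoc, hE, Matrix.zero_mul, sub_zero,
        Matrix.mul_one]
    have hAQ : ∀ (A : Matrix p r F) (Z : Matrix p κ F),
        (A * (1 - Q * Q') + Z * w * Q') * (Q * (y : Matrix κ κ F)) = Z := by
      intro A Z
      rw [← Matrix.mul_assoc, Matrix.add_mul, Matrix.mul_assoc A, hE, Matrix.mul_zero, zero_add,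
        Matrix.mul_assoc _ Q' Q, hQ, Matrix.mul_one, Matrix.mul_assoc, hwy, Matrix.mul_one]
    have hAE : ∀ (A : Matrix p r F) (Z : Matrix p κ F),
        (A * (1 - Q * Q') + Z * w * Q') * (1 - Q * Q') = A * (1 - Q * Q') := by
      intro A Z
      rw [Matrix.add_mul, Matrix.mul_assoc A, hEE, Matrix.mul_assoc (Z * w), hE', Matrix.mul_zero,
        add_zero]
    have hAy : ∀ A : Matrix p r F, A * (Q * (y : Matrix κ κ F)) * w * Q' = A * (Q * Q') := by
      intro A
      rw [Matrix.mul_assoc A, Matrix.mul_assoc Q, hyw, Matrix.mul_one, Matrix.mul_assoc]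
    have hA1 : ∀ A : Matrix p r F, A * (1 - Q * Q') + A * (Q * Q') = A := by
      intro A
      rw [← Matrix.mul_add, sub_add_cancel, Matrix.mul_one]
    refine Eq.symm <| Fintype.card_congr
      { toFun := fun m => m.1.2 * (1 - Q * Q') + m.1.1 * w * Q'
        invFun := fun A => ⟨(A * (Q * (y : Matrix κ κ F)), A * (1 - Q * Q') +
          (ai * (A * (Q * (y : Matrix κ κ F))) * (h : Matrix κ κ F) -
            A * (Q * (y : Matrix κ κ F))) * w * Q'), hAQ _ _⟩
        left_inv := ?_
        right_inv := ?_ }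
    · rintro ⟨⟨X, A⟩, hXA⟩
      refine Subtype.ext (Prod.ext (hAQ A X) ?_)
      change (A * (1 - Q * Q') + X * w * Q') * (1 - Q * Q') + (ai * ((A * (1 - Q * Q') +
        X * w * Q') * (Q * (y : Matrix κ κ F))) * (h : Matrix κ κ F) - (A * (1 - Q * Q') +
        X * w * Q') * (Q * (y : Matrix κ κ F))) * w * Q' = A
      rw [hAE, hAQ, ← hXA, hAy, hA1]
    · intro A
      change (A * (1 - Q * Q') + (_ : Matrix p κ F) * w * Q') * (1 - Q * Q') +
        A * (Q * (y : Matrix κ κ F)) * w * Q' = A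
      rw [hAE, hAy, hA1]

end MatrixCounting

theorem sum_class_mul_card {H : Type} [Group H] [Fintype H] (f : H → ℂ)
    (hf : ∀ a b, f (a * b * a⁻¹) = f b) (x : H) :
    ∑ h : H, f h⁻¹ * (Nat.card {y // y * h = x * y} : ℂ) = Fintype.card H * f x⁻¹ := by
  classical
  have : ∀ h : H, (Nat.card {y // y * h = x * y} : ℂ) = ∑ y, if h = y⁻¹ * x * y then 1 else 0 := by
    intro h
    rw [Nat.card_eq_fintype_card, Fintype.card_subtype, Finset.card_filter, Nat.cast_sum]
    simp [eq_inv_mul_iff_mul_eq, mul_assoc]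
  simp_rw [this, Finset.mul_sum]
  rw [Finset.sum_comm]
  have h2 : ∀ y : H, f (y⁻¹ * x * y)⁻¹ = f x⁻¹ := by
    intro y
    rw [← hf y⁻¹ x⁻¹]
    congr 1
    group
  simp only [mul_ite, mul_one, mul_zero, Finset.sum_ite_eq', Finset.mem_univ,
    if_true, h2]
  simp

section RankFactorization

variable {F : Type} [Field F] {p r κ : Type} [Fintype p] [Fintype r] [Fintype κ]
  [DecidableEq p] [DecidableEq r] [DecidableEq κ]

omit [DecidableEq r] in
theorem exists_rank_factorization (C : Matrix r p F) (hC : C.rank = Fintype.card κ) :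
    ∃ (Q : Matrix r κ F) (Q' : Matrix κ r F) (P' : Matrix κ p F) (P : Matrix p κ F),
      C = Q * P' ∧ Q' * Q = 1 ∧ P' * P = 1 := by
  classical
  let f := Matrix.toLin' C
  let e : LinearMap.range f ≃ₗ[F] (κ → F) := LinearEquiv.ofFinrankEq _ _ (by
    rw [Module.finrank_fintype_fun_eq_card, ← hC]
    rfl)
  let q : (κ → F) →ₗ[F] (r → F) := (LinearMap.range f).subtype ∘ₗ e.symm.toLinearMap
  let s : (p → F) →ₗ[F] (κ → F) := e.toLinearMap ∘ₗ f.rangeRestrict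
  obtain ⟨q', hq'⟩ := q.exists_leftInverse_of_injective (LinearMap.ker_eq_bot.2
    (Subtype.val_injective.comp e.symm.injective))
  obtain ⟨s', hs'⟩ := s.exists_rightInverse_of_surjective (LinearMap.range_eq_top.2
    (e.surjective.comp f.surjective_rangeRestrict))
  refine ⟨LinearMap.toMatrix' q, LinearMap.toMatrix' q', LinearMap.toMatrix' s,
    LinearMap.toMatrix' s', ?_, ?_, ?_⟩
  · rw [← LinearMap.toMatrix'_comp, ← LinearMap.toMatrix'_toLin' C]
    congr 1
    refine LinearMap.ext fun v => ?_
    change _ = ((e.symm (e (f.rangeRestrict v)) : LinearMap.range f) : r → F)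
    rw [e.symm_apply_apply]
    rfl
  · rw [← LinearMap.toMatrix'_comp, hq', LinearMap.toMatrix'_id]
  · rw [← LinearMap.toMatrix'_comp, hs', LinearMap.toMatrix'_id]

theorem exists_unit_mul_eq {Q₁ Q₂ : Matrix r κ F} {Q₁' Q₂' : Matrix κ r F} (h₁ : Q₁' * Q₁ = 1)
    (h₂ : Q₂' * Q₂ = 1) : ∃ L : (Matrix r r F)ˣ, (L : Matrix r r F) * Q₁ = Q₂ := by
  have hinj : ∀ {Q : Matrix r κ F} {Q' : Matrix κ r F}, Q' * Q = 1 →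
      Function.Injective (Matrix.toLin' Q) := by
    intro Q Q' h
    refine Function.LeftInverse.injective (g := Matrix.toLin' Q') fun v => ?_
    rw [← Matrix.toLin'_mul_apply, h, Matrix.toLin'_one, LinearMap.id_apply]
  obtain ⟨g, hg⟩ := Submodule.exists_linearEquiv_restrict_eq
    ((LinearEquiv.ofInjective _ (hinj h₁)).symm ≪≫ₗ LinearEquiv.ofInjective _ (hinj h₂))
  have hg' : g.toLinearMap ∘ₗ Matrix.toLin' Q₁ = Matrix.toLin' Q₂ := by
    refine LinearMap.ext fun v => ?_
    have := hg (LinearEquiv.ofInjective _ (hinj h₁) v)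
    rw [LinearEquiv.trans_apply, LinearEquiv.symm_apply_apply] at this
    exact this.symm
  refine ⟨⟨LinearMap.toMatrix' g.toLinearMap, LinearMap.toMatrix' g.symm.toLinearMap, ?_, ?_⟩, ?_⟩
  · rw [← LinearMap.toMatrix'_comp, LinearEquiv.comp_symm, LinearMap.toMatrix'_id]
  · rw [← LinearMap.toMatrix'_comp, LinearEquiv.symm_comp, LinearMap.toMatrix'_id]
  · change LinearMap.toMatrix' g.toLinearMap * Q₁ = Q₂
    rw [← LinearMap.toMatrix'_toLin' Q₁, ← LinearMap.toMatrix'_comp, hg',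
      LinearMap.toMatrix'_toLin']

/-- Matrices of equal rank are equivalent. -/
theorem exists_unit_mul_mul_eq {C₁ C₂ : Matrix r p F} (h : C₁.rank = C₂.rank) :
    ∃ (L : (Matrix r r F)ˣ) (R : (Matrix p p F)ˣ),
      (L : Matrix r r F) * C₁ * (R : Matrix p p F) = C₂ := by
  obtain ⟨Q₁, Q₁', P₁', P₁, rfl, hQ₁, hP₁⟩ :=
    exists_rank_factorization (κ := Fin C₂.rank) C₁ (by simp [h])
  obtain ⟨Q₂, Q₂', P₂', P₂, hC₂, hQ₂, hP₂⟩ :=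
    exists_rank_factorization (κ := Fin C₂.rank) C₂ (by simp)
  obtain ⟨L, hL⟩ := exists_unit_mul_eq hQ₁ hQ₂
  obtain ⟨R, hR⟩ := exists_unit_mul_eq (Q₁ := P₁'ᵀ) (Q₂ := P₂'ᵀ) (Q₁' := P₁ᵀ) (Q₂' := P₂ᵀ)
    (by rw [← Matrix.transpose_mul, hP₁, Matrix.transpose_one])
    (by rw [← Matrix.transpose_mul, hP₂, Matrix.transpose_one])
  have hR' : P₁' * (R : Matrix p p F)ᵀ = P₂' := by
    rw [← Matrix.transpose_transpose P₂', ← hR, Matrix.transpose_mul, Matrix.transpose_transpose]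
  obtain ⟨R', hR''⟩ := (Matrix.isUnit_transpose (A := (R : Matrix p p F))).2 R.isUnit
  refine ⟨L, R', Eq.trans ?_ hC₂.symm⟩
  rw [hR'', ← hL, ← hR']
  simp only [Matrix.mul_assoc]

end RankFactorization

section BlockMatrices

variable {F : Type} [Field F] {n : ℕ}

/-- The block diagonal embedding of pairs of matrices. -/
def blockDiagHom (F : Type) [Field F] (n : ℕ) :
    Matrix (Fin (n / 2)) (Fin (n / 2)) F × Matrix (Fin (n - n / 2)) (Fin (n - n / 2)) F →*
      Matrix (Fin n) (Fin n) F where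
  toFun x := (Matrix.fromBlocks x.1 0 0 x.2).submatrix (blockEquiv n).symm (blockEquiv n).symm
  map_one' := by simp
  map_mul' x y := by
    rw [Matrix.submatrix_mul_equiv, Matrix.fromBlocks_multiply]
    simp

/-- The block diagonal embedding on invertible elements. -/
def blockDiagGL (F : Type) [Field F] (n : ℕ) :
    (Matrix (Fin (n / 2)) (Fin (n / 2)) F ×
      Matrix (Fin (n - n / 2)) (Fin (n - n / 2)) F)ˣ →* GL (Fin n) F :=
  Units.map (blockDiagHom F n)

theorem uMat_mul_blockDiagHom (A : Matrix (Fin (n / 2)) (Fin (n - n / 2)) F)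
    (x : Matrix (Fin (n / 2)) (Fin (n / 2)) F × Matrix (Fin (n - n / 2)) (Fin (n - n / 2)) F)
    (y : Matrix (Fin (n / 2)) (Fin (n / 2)) F) (hxy : x.1 * y = 1) :
    uMat F n A * blockDiagHom F n x = blockDiagHom F n x * uMat F n (y * A * x.2) := by
  change (Matrix.fromBlocks 1 A 0 1).submatrix _ _ * (Matrix.fromBlocks x.1 0 0 x.2).submatrix _ _ =
    (Matrix.fromBlocks x.1 0 0 x.2).submatrix _ _ *
      (Matrix.fromBlocks 1 (y * A * x.2) 0 1).submatrix _ _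
  rw [Matrix.submatrix_mul_equiv, Matrix.submatrix_mul_equiv, Matrix.fromBlocks_multiply,
    Matrix.fromBlocks_multiply, ← Matrix.mul_assoc x.1, ← Matrix.mul_assoc x.1, hxy]
  simp

theorem uMat_mul_uMat (A B : Matrix (Fin (n / 2)) (Fin (n - n / 2)) F) :
    uMat F n A * uMat F n B = uMat F n (A + B) := by
  unfold uMat
  rw [Matrix.submatrix_mul_equiv, Matrix.fromBlocks_multiply]
  simp [add_comm]

theorem blockDiagHom_mul_uMat (A : Matrix (Fin (n / 2)) (Fin (n - n / 2)) F)
    (x : Matrix (Fin (n / 2)) (Fin (n / 2)) F × Matrix (Fin (n - n / 2)) (Fin (n - n / 2)) F) :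
    blockDiagHom F n x * uMat F n A = (Matrix.fromBlocks x.1 (x.1 * A) 0 x.2).submatrix
      (blockEquiv n).symm (blockEquiv n).symm := by
  change (Matrix.fromBlocks x.1 0 0 x.2).submatrix _ _ * (Matrix.fromBlocks 1 A 0 1).submatrix _ _ =
    _
  rw [Matrix.submatrix_mul_equiv, Matrix.fromBlocks_multiply]
  simp

/-- Splitting the rows of a matrix into two blocks. -/
def rowsEquiv (F : Type) (n : ℕ) (κ : Type) :
    Matrix (Fin n) κ F ≃ Matrix (Fin (n / 2)) κ F × Matrix (Fin (n - n / 2)) κ F where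
  toFun m := ((m.submatrix (blockEquiv n) id).toRows₁, (m.submatrix (blockEquiv n) id).toRows₂)
  invFun m := (Matrix.fromRows m.1 m.2).submatrix (blockEquiv n).symm id
  left_inv m := by
    simp only [Matrix.fromRows_toRows, Matrix.submatrix_submatrix]
    simp
  right_inv m := by
    simp [Matrix.submatrix_submatrix]

variable {κ : Type} [Fintype κ]

theorem rowsEquiv_symm_mul (m : Matrix (Fin (n / 2)) κ F × Matrix (Fin (n - n / 2)) κ F)
    (h : Matrix κ κ F) :
    (rowsEquiv F n κ).symm m * h = (rowsEquiv F n κ).symm (m.1 * h, m.2 * h) := by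
  change (Matrix.fromRows m.1 m.2).submatrix _ _ * h = (Matrix.fromRows (m.1 * h) _).submatrix _ _
  rw [← Matrix.fromRows_mul]
  exact (Matrix.submatrix_mul _ h _ id id Function.bijective_id).symm

omit [Fintype κ] in
theorem blockDiagHom_mul_uMat_mul_rowsEquiv_symm (A : Matrix (Fin (n / 2)) (Fin (n - n / 2)) F)
    (x : Matrix (Fin (n / 2)) (Fin (n / 2)) F × Matrix (Fin (n - n / 2)) (Fin (n - n / 2)) F)
    (m : Matrix (Fin (n / 2)) κ F × Matrix (Fin (n - n / 2)) κ F) :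
    blockDiagHom F n x * uMat F n A * (rowsEquiv F n κ).symm m =
      (rowsEquiv F n κ).symm (x.1 * (m.1 + A * m.2), x.2 * m.2) := by
  rw [blockDiagHom_mul_uMat]
  change _ * (Matrix.fromRows m.1 m.2).submatrix _ _ =
    (Matrix.fromRows (x.1 * (m.1 + A * m.2)) (x.2 * m.2)).submatrix _ _
  rw [Matrix.submatrix_mul_equiv, Matrix.fromBlocks_mul_fromRows, Matrix.mul_add,
    Matrix.mul_assoc, Matrix.zero_mul, zero_add]

variable [DecidableEq κ]

/-- The action of `GL_n × GL_κ` on `n × κ` matrices by left and right multiplication. -/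
def matrixAction (F : Type) [Field F] (n : ℕ) (κ : Type) [Fintype κ] [DecidableEq κ] :
    GL (Fin n) F × GL κ F →* Equiv.Perm (Matrix (Fin n) κ F) where
  toFun x :=
    { toFun m := (x.1 : Matrix (Fin n) (Fin n) F) * m * ((x.2⁻¹ : GL κ F) : Matrix κ κ F)
      invFun m := ((x.1⁻¹ : GL (Fin n) F) : Matrix (Fin n) (Fin n) F) * m * (x.2 : Matrix κ κ F)
      left_inv m := by
        dsimp only
        rw [← Matrix.mul_assoc, ← Matrix.mul_assoc, ← Units.val_mul, Matrix.mul_assoc,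
          ← Units.val_mul]
        simp
      right_inv m := by
        dsimp only
        rw [← Matrix.mul_assoc, ← Matrix.mul_assoc, ← Units.val_mul, Matrix.mul_assoc,
          ← Units.val_mul]
        simp }
  map_one' := by
    ext1 m
    simp
  map_mul' x y := by
    ext1 m
    simp only [Prod.fst_mul, Prod.snd_mul, _root_.mul_inv_rev, Units.val_mul, Equiv.coe_fn_mk,
      Equiv.Perm.coe_mul, Function.comp_apply, Matrix.mul_assoc]

theorem matrixAction_apply_eq_iff (g : GL (Fin n) F) (h : GL κ F) (m : Matrix (Fin n) κ F) :
    matrixAction F n κ (g, h) m = m ↔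
      m * (h : Matrix κ κ F) = (g : Matrix (Fin n) (Fin n) F) * m := by
  change (g : Matrix (Fin n) (Fin n) F) * m * ((h⁻¹ : GL κ F) : Matrix κ κ F) = m ↔ _
  constructor
  · intro hm
    conv_lhs => rw [← hm]
    rw [Matrix.mul_assoc, ← Units.val_mul, inv_mul_cancel, Units.val_one, Matrix.mul_one]
  · intro hm
    rw [← hm, Matrix.mul_assoc, ← Units.val_mul, mul_inv_cancel, Units.val_one, Matrix.mul_one]

variable [Fintype F]

theorem card_fixed_blockDiagGL_mul_uGL
    (x : (Matrix (Fin (n / 2)) (Fin (n / 2)) F ×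
      Matrix (Fin (n - n / 2)) (Fin (n - n / 2)) F)ˣ)
    (A : Matrix (Fin (n / 2)) (Fin (n - n / 2)) F) (h : GL κ F) :
    Nat.card {m // matrixAction F n κ (blockDiagGL F n x * uGL F n A, h) m = m} =
      Nat.card {m : Matrix (Fin (n / 2)) κ F × Matrix (Fin (n - n / 2)) κ F //
        m.1 * (h : Matrix κ κ F) = x.val.1 * (m.1 + A * m.2) ∧
        m.2 * (h : Matrix κ κ F) = x.val.2 * m.2} := by
  refine Nat.card_congr (Equiv.subtypeEquiv (rowsEquiv F n κ) fun m => ?_)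
  obtain ⟨m, rfl⟩ := (rowsEquiv F n κ).symm.surjective m
  have hx : ((blockDiagGL F n x * uGL F n A : GL (Fin n) F) : Matrix (Fin n) (Fin n) F) =
    blockDiagHom F n x.val * uMat F n A := rfl
  rw [matrixAction_apply_eq_iff, rowsEquiv_symm_mul, Equiv.apply_symm_apply, hx,
    blockDiagHom_mul_uMat_mul_rowsEquiv_symm, (rowsEquiv F n κ).symm.injective.eq_iff,
    Prod.mk.injEq]

theorem uGL_mul_blockDiagGL (A : Matrix (Fin (n / 2)) (Fin (n - n / 2)) F)
    (x : (Matrix (Fin (n / 2)) (Fin (n / 2)) F ×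
      Matrix (Fin (n - n / 2)) (Fin (n - n / 2)) F)ˣ) :
    uGL F n A * blockDiagGL F n x =
      blockDiagGL F n x * uGL F n (x⁻¹.val.1 * A * x.val.2) :=
  Units.ext (uMat_mul_blockDiagHom A x.val x⁻¹.val.1
    (congrArg Prod.fst (Units.mul_inv x)))

/-- The homomorphism `A ↦ u(A)`. -/
noncomputable def uHom (F : Type) [Field F] [Fintype F] (n : ℕ) :
    Multiplicative (Matrix (Fin (n / 2)) (Fin (n - n / 2)) F) →* GL (Fin n) F where
  toFun A := uGL F n A.toAdd
  map_one' := by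
    refine Units.ext ?_
    change uMat F n 0 = 1
    simp [uMat]
  map_mul' A B := Units.ext (uMat_mul_uMat _ _).symm

end BlockMatrices

section UnipotentCoefficients

variable {F : Type} [Field F] [Fintype F] {n : ℕ}

theorem sum_character_uGL_mul_mul (ψ : AddChar F ℂ) (V : FDRep ℂ (GL (Fin n) F))
    (C : Matrix (Fin (n - n / 2)) (Fin (n / 2)) F)
    (L : (Matrix (Fin (n - n / 2)) (Fin (n - n / 2)) F)ˣ)
    (R : (Matrix (Fin (n / 2)) (Fin (n / 2)) F)ˣ) :
    ∑ A, V.character (uGL F n A) * ψ (-(L.val * C * R.val * A).trace) =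
      ∑ A, V.character (uGL F n A) * ψ (-(C * A).trace) := by
  let e : Matrix (Fin (n / 2)) (Fin (n - n / 2)) F ≃ Matrix (Fin (n / 2)) (Fin (n - n / 2)) F :=
    { toFun A := R.val * A * L.val
      invFun A := R⁻¹.val * A * L⁻¹.val
      left_inv A := by
        dsimp only
        rw [← Matrix.mul_assoc, ← Matrix.mul_assoc, ← Units.val_mul, Matrix.mul_assoc,
          ← Units.val_mul]
        simp
      right_inv A := by
        dsimp only
        rw [← Matrix.mul_assoc, ← Matrix.mul_assoc, ← Units.val_mul, Matrix.mul_assoc,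
          ← Units.val_mul]
        simp }
  refine Fintype.sum_equiv e _ _ fun A => ?_
  have h1 : uGL F n (e A) = (blockDiagGL F n (MulEquiv.prodUnits.symm (R⁻¹, L)))⁻¹ * uGL F n A *
      ((blockDiagGL F n (MulEquiv.prodUnits.symm (R⁻¹, L)))⁻¹)⁻¹ := by
    rw [inv_inv, mul_assoc, uGL_mul_blockDiagGL, inv_mul_cancel_left, ← map_inv]
    rfl
  rw [h1, FDRep.char_conj]
  congr 3
  change _ = (C * (R.val * A * L.val)).trace
  simp only [Matrix.mul_assoc]
  rw [Matrix.trace_mul_comm]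
  simp only [Matrix.mul_assoc]

theorem occursInRes_iff_of_rank_eq (ψ : AddChar F ℂ) (V : FDRep ℂ (GL (Fin n) F))
    {B₁ B₂ : Matrix (Fin (n / 2)) (Fin (n - n / 2)) F} (h : B₁.rank = B₂.rank) :
    OccursInRes n F ψ V B₁ ↔ OccursInRes n F ψ V B₂ := by
  obtain ⟨L, R, hLR⟩ := exists_unit_mul_mul_eq (C₁ := B₁ᵀ) (C₂ := B₂ᵀ) (by
    rw [Matrix.rank_transpose, Matrix.rank_transpose, h])
  unfold OccursInRes
  rw [← hLR, sum_character_uGL_mul_mul]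

/-- The functions `s ↦ (1/#U) ∑_A ψ(-trace(C A)) f(D(s) u(A))`, depending linearly on `f`. -/
noncomputable def unipotentCoefficient (ψ : AddChar F ℂ)
    (C : Matrix (Fin (n - n / 2)) (Fin (n / 2)) F) {S : Type}
    (D : S → (Matrix (Fin (n / 2)) (Fin (n / 2)) F ×
      Matrix (Fin (n - n / 2)) (Fin (n - n / 2)) F)ˣ) :
    (GL (Fin n) F → ℂ) →ₗ[ℂ] (S → ℂ) where
  toFun f s := (Nat.card (Matrix (Fin (n / 2)) (Fin (n - n / 2)) F) : ℂ)⁻¹ *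
    ∑ A : Matrix (Fin (n / 2)) (Fin (n - n / 2)) F,
      ψ (-(C * A).trace) * f (blockDiagGL F n (D s) * uGL F n A)
  map_add' f g := by
    ext s
    simp [mul_add, Finset.sum_add_distrib]
  map_smul' c f := by
    ext s
    simp only [Pi.smul_apply, smul_eq_mul, RingHom.id_apply, Finset.mul_sum]
    exact Finset.sum_congr rfl fun A _ => by ring

theorem unipotentCoefficient_ne_zero_iff (ψ : AddChar F ℂ)
    (B : Matrix (Fin (n / 2)) (Fin (n - n / 2)) F) {S : Type}
    (D : S → (Matrix (Fin (n / 2)) (Fin (n / 2)) F ×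
      Matrix (Fin (n - n / 2)) (Fin (n - n / 2)) F)ˣ) {s : S} (hs : D s = 1)
    (V : FDRep ℂ (GL (Fin n) F)) :
    unipotentCoefficient ψ Bᵀ D V.character s ≠ 0 ↔ OccursInRes n F ψ V B := by
  change (Nat.card (Matrix (Fin (n / 2)) (Fin (n - n / 2)) F) : ℂ)⁻¹ *
    ∑ A : Matrix (Fin (n / 2)) (Fin (n - n / 2)) F,
      ψ (-(Bᵀ * A).trace) * V.character (blockDiagGL F n (D s) * uGL F n A) ≠ 0 ↔ _
  rw [mul_ne_zero_iff, and_iff_right (inv_ne_zero (Nat.cast_ne_zero.2 Nat.card_pos.ne')), hs]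
  simp only [map_one, one_mul]
  unfold OccursInRes
  simp only [mul_comm]

theorem FDRep.exists_unipotentCoefficient_eq (ψ : AddChar F ℂ)
    (C : Matrix (Fin (n - n / 2)) (Fin (n / 2)) F) {S : Type} [Group S] [Finite S]
    (D : S →* (Matrix (Fin (n / 2)) (Fin (n / 2)) F ×
      Matrix (Fin (n - n / 2)) (Fin (n - n / 2)) F)ˣ)
    (hD : ∀ s, (D s).val.2 * C = C * (D s).val.1) (V : FDRep ℂ (GL (Fin n) F)) :
    ∃ E : FDRep ℂ S, unipotentCoefficient ψ C D V.character = E.character := by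
  classical
  let χ : Multiplicative (Matrix (Fin (n / 2)) (Fin (n - n / 2)) F) →* ℂ :=
    { toFun A := ψ (C * A.toAdd).trace
      map_one' := by simp
      map_mul' A B := by
        rw [toAdd_mul, Matrix.mul_add, Matrix.trace_add, AddChar.map_add_eq_mul] }
  obtain ⟨E, hE⟩ := FDRep.exists_isotypic V (uHom F n) χ ((blockDiagGL F n).comp D)
    (fun s A => Multiplicative.ofAdd ((D s)⁻¹.val.1 * A.toAdd * (D s).val.2))
    (fun s A => uGL_mul_blockDiagGL A.toAdd (D s)) (fun s A => by
      change ψ (C * ((D s)⁻¹.val.1 * A.toAdd * (D s).val.2)).trace = ψ (C * A.toAdd).trace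
      have h1 : (D s).val.1 * (D s)⁻¹.val.1 = 1 := congrArg Prod.fst (Units.mul_inv (D s))
      rw [← Matrix.mul_assoc, Matrix.trace_mul_comm, ← Matrix.mul_assoc, hD, ← Matrix.mul_assoc,
        Matrix.mul_assoc C, h1, Matrix.mul_one])
  refine ⟨E, funext fun s => ?_⟩
  rw [hE]
  change (Nat.card (Matrix (Fin (n / 2)) (Fin (n - n / 2)) F) : ℂ)⁻¹ * _ = _
  rw [Nat.card_eq_fintype_card, Fintype.card_multiplicative]
  congr 1
  refine Fintype.sum_equiv Multiplicative.ofAdd _ _ fun A => ?_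
  change _ = ψ (C * -A).trace * _
  rw [Matrix.mul_neg, Matrix.trace_neg]
  rfl

end UnipotentCoefficients

section MultiplicitySpace

variable {F : Type} [Field F] [Fintype F] {n k : ℕ}

/-- The embedding `x ↦ (1 + P (x - 1) P', 1 + Q (x - 1) Q')` of `GL_k` into pairs of invertible
matrices. -/
def inflateUnits {P : Matrix (Fin (n / 2)) (Fin k) F} {P' : Matrix (Fin k) (Fin (n / 2)) F}
    (hP : P' * P = 1) {Q : Matrix (Fin (n - n / 2)) (Fin k) F}
    {Q' : Matrix (Fin k) (Fin (n - n / 2)) F} (hQ : Q' * Q = 1) :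
    GL (Fin k) F →* (Matrix (Fin (n / 2)) (Fin (n / 2)) F ×
      Matrix (Fin (n - n / 2)) (Fin (n - n / 2)) F)ˣ :=
  Units.map ((inflate P P' hP).prod (inflate Q Q' hQ))

theorem exists_multiplicitySpace_etaMult {ψ : AddChar F ℂ} (hψ : ψ ≠ 1)
    [Fintype (GL (Fin n) F)] [Fintype (GL (Fin k) F)] (τ : FDRep ℂ (GL (Fin k) F)) :
    ∃ M : FDRep ℂ (GL (Fin n) F),
      (∀ σ : FDRep ℂ (GL (Fin n) F), etaMult n k F σ τ =
        (Nat.card (GL (Fin n) F) : ℂ)⁻¹ * ∑ g, M.character g * σ.character g⁻¹) ∧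
      (∀ C : Matrix (Fin (n - n / 2)) (Fin (n / 2)) F, k < C.rank →
        unipotentCoefficient ψ C (fun _ : Unit => 1) M.character () = 0) ∧
      (∀ (P : Matrix (Fin (n / 2)) (Fin k) F) (P' : Matrix (Fin k) (Fin (n / 2)) F)
        (hP : P' * P = 1) (Q : Matrix (Fin (n - n / 2)) (Fin k) F)
        (Q' : Matrix (Fin k) (Fin (n - n / 2)) F) (hQ : Q' * Q = 1) (x : GL (Fin k) F),
        unipotentCoefficient ψ (Q * P') (inflateUnits hP hQ) M.character x =
          τ.character x⁻¹) := by
  classical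
  obtain ⟨M, hM⟩ := FDRep.exists_multiplicitySpace (matrixAction F n (Fin k)) τ
  have hcoeff : ∀ {S : Type} (C : Matrix (Fin (n - n / 2)) (Fin (n / 2)) F)
      (D : S → (Matrix (Fin (n / 2)) (Fin (n / 2)) F ×
        Matrix (Fin (n - n / 2)) (Fin (n - n / 2)) F)ˣ) (s : S),
      unipotentCoefficient ψ C D M.character s =
        (Fintype.card (Matrix (Fin (n / 2)) (Fin (n - n / 2)) F) : ℂ)⁻¹ *
          ((Fintype.card (GL (Fin k) F) : ℂ)⁻¹ * ∑ h : GL (Fin k) F, τ.character h⁻¹ *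
            ∑ A : Matrix (Fin (n / 2)) (Fin (n - n / 2)) F, ψ (-(C * A).trace) *
              (Nat.card {m : Matrix (Fin (n / 2)) (Fin k) F × Matrix (Fin (n - n / 2)) (Fin k) F //
                m.1 * (h : Matrix (Fin k) (Fin k) F) = (D s).val.1 * (m.1 + A * m.2) ∧
                m.2 * (h : Matrix (Fin k) (Fin k) F) = (D s).val.2 * m.2} : ℂ)) := by
    intro S C D s
    change (Nat.card (Matrix (Fin (n / 2)) (Fin (n - n / 2)) F) : ℂ)⁻¹ *
      ∑ A : Matrix (Fin (n / 2)) (Fin (n - n / 2)) F,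
        ψ (-(C * A).trace) * M.character (blockDiagGL F n (D s) * uGL F n A) = _
    rw [Nat.card_eq_fintype_card]
    congr 1
    simp only [hM, card_fixed_blockDiagGL_mul_uGL, Finset.mul_sum]
    rw [Finset.sum_comm]
    refine Finset.sum_congr rfl fun h _ => Finset.sum_congr rfl fun A _ => ?_
    ring
  refine ⟨M, fun σ => ?_, fun C hC => ?_, fun P P' hP Q Q' hQ x => ?_⟩
  · unfold etaMult
    rw [Subsingleton.elim (Fintype.ofFinite (GL (Fin n) F)) ‹Fintype (GL (Fin n) F)›,
      Subsingleton.elim (Fintype.ofFinite (GL (Fin k) F)) ‹Fintype (GL (Fin k) F)›, mul_assoc]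
    congr 1
    rw [Finset.mul_sum]
    refine Finset.sum_congr rfl fun g _ => ?_
    rw [hM, ← Nat.card_eq_fintype_card, mul_assoc, Finset.sum_mul]
    refine congrArg _ (Fintype.sum_congr _ _ fun h => ?_)
    have hcard : Nat.card {m : Matrix (Fin n) (Fin k) F //
        ((g⁻¹ : GL (Fin n) F) : Matrix (Fin n) (Fin n) F) * m *
          (h : Matrix (Fin k) (Fin k) F) = m} =
        Nat.card {m // matrixAction F n (Fin k) (g, h) m = m} := by
      refine Nat.card_congr (Equiv.subtypeEquivRight fun m => ?_)
      rw [← Equiv.Perm.inv_eq_iff_eq.trans eq_comm, ← map_inv]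
      change _ ↔ (matrixAction F n (Fin k) (g⁻¹, h⁻¹)) m = m
      change _ ↔ ((g⁻¹ : GL (Fin n) F) : Matrix (Fin n) (Fin n) F) * m *
        ((h⁻¹⁻¹ : GL (Fin k) F) : Matrix (Fin k) (Fin k) F) = m
      rw [inv_inv]
    rw [hcard]
    ring
  · rw [hcoeff]
    refine mul_eq_zero_of_right _ (mul_eq_zero_of_right _ (Finset.sum_eq_zero fun h _ => ?_))
    have := sum_card_eq_zero_of_lt_rank hψ C (by rwa [Fintype.card_fin])
      (h : Matrix (Fin k) (Fin k) F)
    exact mul_eq_zero_of_right _ this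
  · rw [hcoeff]
    have h1 := fun h : GL (Fin k) F => sum_card_of_rank_factorization hψ hP hQ x h
    have h2 := sum_class_mul_card (fun g => τ.character g) (fun a b => FDRep.char_conj τ b a) x
    have hU : (Fintype.card (Matrix (Fin (n / 2)) (Fin (n - n / 2)) F) : ℂ) ≠ 0 :=
      Nat.cast_ne_zero.2 Fintype.card_ne_zero
    have hH : (Fintype.card (GL (Fin k) F) : ℂ) ≠ 0 := Nat.cast_ne_zero.2 Fintype.card_ne_zero
    rw [inv_mul_eq_iff_eq_mul₀ hU, inv_mul_eq_iff_eq_mul₀ hH, mul_left_comm, ← h2, Finset.mul_sum]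
    refine Finset.sum_congr rfl fun h _ => ?_
    rw [mul_left_comm, ← h1 h]
    rfl

end MultiplicitySpace

theorem rank_mul_of_leftInverse {F p r κ : Type} [Field F] [Fintype p] [Fintype r] [Fintype κ]
    [DecidableEq κ] {P : Matrix p κ F} {P' : Matrix κ p F} (hP : P' * P = 1)
    {Q : Matrix r κ F} {Q' : Matrix κ r F} (hQ : Q' * Q = 1) :
    (Q * P').rank = Fintype.card κ := by
  refine le_antisymm ((Matrix.rank_mul_le_left _ _).trans Q.rank_le_card_width) ?_
  have h : Q' * (Q * P') * P = 1 := by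
    rw [← Matrix.mul_assoc, hQ, Matrix.one_mul, hP]
  rw [← Matrix.rank_one (R := F) (n := κ), ← h]
  exact (Matrix.rank_mul_le_left _ _).trans (Matrix.rank_mul_le_right _ _)

theorem submatrix_one_mul_submatrix_one {F p κ : Type} [Field F] [Fintype p] [DecidableEq p]
    [DecidableEq κ] {f : κ → p} (hf : Function.Injective f) :
    (1 : Matrix p p F).submatrix f id * (1 : Matrix p p F).submatrix id f = 1 := by
  rw [← Matrix.submatrix_mul _ _ f id f Function.bijective_id, Matrix.one_mul,
    Matrix.submatrix_one f hf]

/-- eta correspondence: fix `n ≥ 2` and `1 ≤ k ≤ ⌊n/2⌋`.  For each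
irreducible representation `τ` of `GL_k(F_q)`, the multiplicity space
`M(τ) = Hom_{GL_k}(τ, ω_{n,k})` contains exactly one irreducible constituent `η(τ)` of
`U`-rank `k`, occurring with multiplicity one, all other irreducible constituents having
`U`-rank strictly less than `k`; and `τ ↦ η(τ)` is injective on isomorphism classes. -/
theorem eta_correspondence (n k : ℕ) (hn : 2 ≤ n) (hk1 : 1 ≤ k) (hk : k ≤ n / 2)
    (F : Type) [Field F] [Fintype F] (ψ : AddChar F ℂ) (hψ : ψ ≠ 1) :
    ∃ η : FDRep ℂ (GL (Fin k) F) → FDRep ℂ (GL (Fin n) F),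
      (∀ τ : FDRep ℂ (GL (Fin k) F), Simple τ →
        Simple (η τ) ∧ HasURank n F ψ (η τ) k ∧ etaMult n k F (η τ) τ = 1 ∧
        (∀ σ : FDRep ℂ (GL (Fin n) F), Simple σ → etaMult n k F σ τ ≠ 0 →
          ¬ Nonempty (σ ≅ η τ) → URankLt n F ψ σ k))
      ∧ (∀ τ τ' : FDRep ℂ (GL (Fin k) F), Simple τ → Simple τ' →
          ¬ Nonempty (τ ≅ τ') → ¬ Nonempty (η τ ≅ η τ')) := by
  classical
  let : Fintype (GL (Fin n) F) := Fintype.ofFinite _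
  let : Fintype (GL (Fin k) F) := Fintype.ofFinite _
  have hP := submatrix_one_mul_submatrix_one (F := F) (Fin.castLE_injective hk)
  have hQ := submatrix_one_mul_submatrix_one (F := F)
    (Fin.castLE_injective (show k ≤ n - n / 2 by omega))
  have hrank := rank_mul_of_leftInverse hP hQ
  set P' := (1 : Matrix (Fin (n / 2)) (Fin (n / 2)) F).submatrix (Fin.castLE hk) id
  set Q := (1 : Matrix (Fin (n - n / 2)) (Fin (n - n / 2)) F).submatrix id
    (Fin.castLE (show k ≤ n - n / 2 by omega))
  rw [Fintype.card_fin] at hrank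
  set B₀ : Matrix (Fin (n / 2)) (Fin (n - n / 2)) F := (Q * P')ᵀ with hB₀
  have hB₀rank : B₀.rank = k := by rw [hB₀, Matrix.rank_transpose, hrank]
  have hB₀T : B₀ᵀ = Q * P' := Matrix.transpose_transpose _
  let T := unipotentCoefficient ψ B₀ᵀ (inflateUnits hP hQ)
  have hT : ∀ V : FDRep ℂ (GL (Fin n) F), ∃ E : FDRep ℂ (GL (Fin k) F),
      T V.character = E.character := by
    refine FDRep.exists_unipotentCoefficient_eq ψ B₀ᵀ (inflateUnits hP hQ) fun s => ?_
    change inflate Q _ hQ s * B₀ᵀ = B₀ᵀ * inflate _ P' hP s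
    rw [hB₀T, ← Matrix.mul_assoc, inflate_mul_left, Matrix.mul_assoc, Matrix.mul_assoc,
      mul_inflate_right]
  have hocc : ∀ (V : FDRep ℂ (GL (Fin n) F)) (B : Matrix (Fin (n / 2)) (Fin (n - n / 2)) F),
      B.rank = k → (T V.character 1 ≠ 0 ↔ OccursInRes n F ψ V B) := fun V B hB =>
    (unipotentCoefficient_ne_zero_iff ψ B₀ _ (map_one _) V).trans
      (occursInRes_iff_of_rank_eq ψ V (hB₀rank.trans hB.symm))
  have main : ∀ τ : FDRep ℂ (GL (Fin k) F), Simple τ → ∃ η : FDRep ℂ (GL (Fin n) F),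
      (Simple η ∧ HasURank n F ψ η k ∧ etaMult n k F η τ = 1 ∧
        (∀ σ : FDRep ℂ (GL (Fin n) F), Simple σ → etaMult n k F σ τ ≠ 0 →
          ¬ Nonempty (σ ≅ η) → URankLt n F ψ σ k)) ∧
      ∀ τ' : FDRep ℂ (GL (Fin k) F), Simple τ' →
        ((Nat.card (GL (Fin k) F) : ℂ)⁻¹ * ∑ x, T η.character x * τ'.character x ≠ 0 ↔
          Nonempty (τ' ≅ τ)) := by
    intro τ hτ
    obtain ⟨M, hMmult, hMlt, hMeq⟩ := exists_multiplicitySpace_etaMult (n := n) hψ τ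
    have hMT : ∀ x, T M.character x = τ.character x⁻¹ := fun x => by
      rw [← hMeq _ _ hP _ _ hQ, ← hB₀T]
    obtain ⟨η, hη, hη1, hηT, hησ, hητ⟩ := FDRep.exists_unique_constituent M τ T hT hMT
    have hlt : ∀ σ : FDRep ℂ (GL (Fin n) F), Simple σ → etaMult n k F σ τ ≠ 0 →
        ∀ B : Matrix (Fin (n / 2)) (Fin (n - n / 2)) F, k < B.rank → ¬ OccursInRes n F ψ σ B := by
      intro σ hσ hmult B hB
      rw [← unipotentCoefficient_ne_zero_iff ψ B (fun _ : Unit => 1) (s := ()) rfl, not_not]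
      rw [hMmult] at hmult
      refine FDRep.eq_zero_of_constituent M σ hmult
        ((LinearMap.proj ()).comp (unipotentCoefficient ψ Bᵀ fun _ : Unit => 1))
        (fun V => ?_) (hMlt Bᵀ (by rwa [Matrix.rank_transpose]))
      obtain ⟨E, hE⟩ := FDRep.exists_unipotentCoefficient_eq ψ Bᵀ (1 : Unit →* _)
        (fun _ => (Matrix.one_mul Bᵀ).trans (Matrix.mul_one Bᵀ).symm) V
      exact ⟨_, (congrFun hE 1).trans E.char_one⟩
    rw [← hMmult] at hη1
    refine ⟨η, ⟨hη, ⟨⟨B₀, hB₀rank, (hocc η B₀ hB₀rank).1 hηT⟩,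
      hlt η hη (by rw [hη1]; exact one_ne_zero)⟩, hη1, fun σ hσ hmult hne B hB => ?_⟩, hητ⟩
    rcases hB.eq_or_lt with h | h
    · rw [← hocc σ B h.symm, not_not]
      exact hησ σ hσ (by rwa [← hMmult]) hne
    · exact hlt σ hσ hmult B h
  have : Nonempty (FDRep ℂ (GL (Fin n) F)) :=
    ⟨FDRep.of (Representation.trivial ℂ (GL (Fin n) F) ℂ)⟩
  choose! η hη hητ using main
  refine ⟨η, hη, fun τ τ' hτ hτ' hne ⟨e⟩ => hne ?_⟩
  obtain ⟨i⟩ := (hητ τ hτ τ' hτ').1 (by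
    rw [FDRep.char_iso e]
    exact (hητ τ' hτ' τ' hτ').2 ⟨Iso.refl _⟩)
  exact ⟨i.symm⟩
end
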